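/- Let ε > 0, let α ∈ 𝒦, and let γ ∈ ℝ. Then there exists a set 𝒢 ⊆ ℬ with Hausdorff dimension dim_H(𝒢) = 2 (as a subset of ℝ²) such that for every pair (β, δ) ∈ 𝒢, there are infinitely many positive integers n with n · ‖nα − γ‖ · ‖nβ − δ‖ < (log log n)^(3+ε) / log n. -/

import Mathlib

open Real MeasureTheory Set

/-- Distance from `x` to the nearest integer. -/
noncomputable def nint (x : ℝ) : ℝ := ⨅ n : ℤ, |x - n|

/-- The set of badly approximable numbers. -/
def Bad : Set ℝ := {α : ℝ | ∃ c > 0, ∀ n : ℕ, 1 ≤ n → c ≤ n * nint (n * α)}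

/-- The set of `δ`-inhomogeneously badly approximable numbers. -/
def BadShift (δ : ℝ) : Set ℝ := {β : ℝ | ∃ c > 0, ∀ n : ℕ, 1 ≤ n → c ≤ n * nint (n * β - δ)}

/-- The set `ℬ = {(β, δ) : β ∈ Bad ∩ Bad(δ)}`. -/
def calB : Set (ℝ × ℝ) := {p : ℝ × ℝ | p.1 ∈ Bad ∧ p.1 ∈ BadShift p.2}

/-- The `k`-th continuant `q_k(α)` (denominator of the `k`-th convergent) of the
continued fraction expansion of `α`. -/
noncomputable def contDen (α : ℝ) (k : ℕ) : ℝ := (GenContFract.of α).dens k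

/-- `Λ(α) = sup_{k ≥ 1} (log q_k(α)) / k`. -/
noncomputable def Lam (α : ℝ) : ℝ := ⨆ k : ℕ+, Real.log (contDen α k) / k

/-- Membership in the set `𝒦` of irrational numbers with `Λ(α) < ∞`. -/
def memK (α : ℝ) : Prop :=
  Irrational α ∧ BddAbove (Set.range fun k : ℕ+ => Real.log (contDen α k) / k)

/-- The Fourier transform `μ̂(ξ) = ∫ e^{-2πiξx} dμ(x)` of a measure `μ` on `ℝ`. -/
noncomputable def mFT (μ : Measure ℝ) (ξ : ℝ) : ℂ :=
  ∫ x, Complex.exp (-(2 * Real.pi * ξ * x : ℝ) * Complex.I) ∂μ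

/-- Dispersion of a (finite) set `A ⊆ [0,1)`: the largest gap between circularly
consecutive elements, where the gap between the largest and the smallest element
wraps around, i.e. equals `min A + 1 - max A`. -/
noncomputable def disp (A : Set ℝ) : ℝ :=
  sSup {d : ℝ |
    (∃ a ∈ A, ∃ b ∈ A, a < b ∧ (∀ x ∈ A, x ≤ a ∨ b ≤ x) ∧ d = b - a) ∨
    (∃ a ∈ A, ∃ b ∈ A, (∀ x ∈ A, b ≤ x ∧ x ≤ a) ∧ d = b + 1 - a)}

/-- `m * |m β - a| ≥ c` for all positive `m ≤ N` and all integers `a`. -/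
def HomBd (c N β : ℝ) : Prop :=
  ∀ m : ℕ, 0 < m → (m : ℝ) ≤ N → ∀ a : ℤ, c ≤ m * |m * β - a|

/-- `m * |m β - δ - a| ≥ c` for all positive `m ≤ N` and all integers `a`. -/
def InhBd (c N β δ : ℝ) : Prop :=
  ∀ m : ℕ, 0 < m → (m : ℝ) ≤ N → ∀ a : ℤ, c ≤ m * |m * β - δ - a|

/-- The closed grid interval of length `1 / B` with index `i`. -/
def cell (B : ℝ) (i : ℤ) : Set ℝ := Icc (i / B) ((i + 1) / B)

theorem cell_subset_cell {B K : ℝ} (hB : 0 < B) (hK : 0 < K) {i j : ℤ}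
    (h1 : K * i ≤ j) (h2 : (j : ℝ) + 1 ≤ K * i + K) : cell (B * K) j ⊆ cell B i := by
  apply Icc_subset_Icc
  · rw [div_le_div_iff₀ hB (by positivity)]
    nlinarith
  · rw [div_le_div_iff₀ (by positivity) hB]
    nlinarith

theorem left_mem_cell {B : ℝ} (hB : 0 < B) (i : ℤ) : (i : ℝ) / B ∈ cell B i :=
  ⟨le_rfl, by gcongr; linarith⟩

theorem right_mem_cell {B : ℝ} (hB : 0 < B) (i : ℤ) : ((i : ℝ) + 1) / B ∈ cell B i :=
  ⟨by gcongr; linarith, le_rfl⟩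

theorem cell_index_unique {B B' : ℝ} (hB : 0 < B) (hB' : 0 < B') {i i' j : ℤ}
    (h : cell B' j ⊆ cell B i) (h' : cell B' j ⊆ cell B i') : i = i' := by
  have l1 := h (left_mem_cell hB' j)
  have r1 := h (right_mem_cell hB' j)
  have l2 := h' (left_mem_cell hB' j)
  have r2 := h' (right_mem_cell hB' j)
  have lt : (j : ℝ) / B' < (j + 1) / B' := by gcongr; linarith
  have e1 : (i : ℝ) / B < (i' + 1) / B := lt_of_le_of_lt l1.1 (lt.trans_le r2.2)
  have e2 : (i' : ℝ) / B < (i + 1) / B := lt_of_le_of_lt l2.1 (lt.trans_le r1.2)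
  rw [div_lt_div_iff_of_pos_right hB] at e1 e2
  have e1' : i < i' + 1 := by exact_mod_cast e1
  have e2' : i' < i + 1 := by exact_mod_cast e2
  omega

theorem abs_sub_le_of_mem_cell {B : ℝ} {i : ℤ} {x y : ℝ}
    (hx : x ∈ cell B i) (hy : y ∈ cell B i) : |x - y| ≤ 1 / B := by
  have : ((i : ℝ) + 1) / B = i / B + 1 / B := by ring
  rw [abs_le]
  constructor <;> linarith [hx.1, hx.2, hy.1, hy.2]

theorem exists_cell_subset_Icc {B lo hi : ℝ} (hB : 0 < B) (h : 2 / B ≤ hi - lo) :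
    ∃ i : ℤ, cell B i ⊆ Icc lo hi := by
  refine ⟨⌈lo * B⌉, Icc_subset_Icc ?_ ?_⟩
  · rw [le_div_iff₀ hB]
    exact Int.le_ceil _
  · rw [div_le_iff₀ hB]
    have := Int.ceil_lt_add_one (lo * B)
    rw [div_le_iff₀ hB] at h
    nlinarith

theorem exists_finset_cells_near {B : ℝ} (hB : 0 < B) (x : ℝ) (r : ℕ) :
    ∃ T : Finset ℤ, T.card ≤ 2 * r + 2 ∧
      ∀ j : ℤ, (∃ z ∈ cell B j, |z - x| ≤ r / B) → j ∈ T := by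
  refine ⟨Finset.Icc ⌈x * B - r - 1⌉ ⌊x * B + r⌋, ?_, ?_⟩
  · rw [Int.card_Icc]
    have h1 := Int.le_ceil (x * B - r - 1)
    have h2 := Int.floor_le (x * B + r)
    have : (⌊x * B + r⌋ : ℝ) - ⌈x * B - r - 1⌉ ≤ 2 * r + 1 := by linarith
    have : ⌊x * B + r⌋ - ⌈x * B - r - 1⌉ ≤ 2 * (r : ℤ) + 1 := by exact_mod_cast this
    omega
  · rintro j ⟨z, ⟨hz1, hz2⟩, hz⟩
    rw [abs_le] at hz
    rw [div_le_iff₀ hB] at hz1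
    rw [le_div_iff₀ hB] at hz2
    have h1 : (r : ℝ) / B * B = r := by field_simp
    have h3 : z * B ≤ x * B + r := by nlinarith
    have h4 : x * B - r ≤ z * B := by nlinarith
    rw [Finset.mem_Icc]
    constructor
    · rw [Int.ceil_le]; linarith
    · rw [Int.le_floor]; linarith

/-- Two fractions with denominators at most `N` closer than `1 / N ^ 2` coincide. -/
theorem frac_eq_of_close {N : ℝ} {m m' : ℕ} (hm : 0 < m) (hm' : 0 < m') (hmN : (m : ℝ) ≤ N)
    (hmN' : (m' : ℝ) ≤ N) {a a' : ℤ} (h : |(a : ℝ) / m - a' / m'| < 1 / N ^ 2) :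
    (a : ℝ) / m = a' / m' := by
  have hm0 : (0 : ℝ) < m := by exact_mod_cast hm
  have hm0' : (0 : ℝ) < m' := by exact_mod_cast hm'
  by_contra hne
  have hz : a * m' - a' * m ≠ 0 := by
    intro h0
    apply hne
    rw [div_eq_div_iff hm0.ne' hm0'.ne']
    have : ((a * m' - a' * m : ℤ) : ℝ) = 0 := by rw [h0]; simp
    push_cast at this
    linarith
  have h1 : (1 : ℝ) ≤ |(a : ℝ) * m' - a' * m| := by
    have := Int.one_le_abs hz
    exact_mod_cast this
  have h2 : (a : ℝ) / m - a' / m' = (a * m' - a' * m) / (m * m') := by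
    field_simp
  rw [h2, abs_div, abs_of_pos (by positivity : (0 : ℝ) < m * m'),
    div_lt_div_iff₀ (by positivity) (by nlinarith)] at h
  nlinarith [mul_le_mul hmN hmN' hm0'.le (hm0.le.trans hmN)]

theorem homStep {k : ℕ} (hk : 3 ≤ k) {h : ℕ} (hh : 2 ≤ h) (t : ℕ) (i : ℤ) :
    ∃ T : Finset ℤ, T.card ≤ 4 ∧ ∀ j : ℤ, j ∉ T →
      cell ((k : ℝ) ^ (2 * (t + 1))) j ⊆ cell ((k : ℝ) ^ (2 * t)) i →
      ∀ β ∈ cell ((k : ℝ) ^ (2 * (t + 1))) j, ∀ m : ℕ, (k : ℝ) ^ t / k ^ h < m →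
        (m : ℝ) ≤ (k : ℝ) ^ (t + 1) / k ^ h → ∀ a : ℤ,
        1 / (k : ℝ) ^ (2 * h + 2) ≤ m * |m * β - a| := by
  have hk0 : (0 : ℝ) < k := by positivity
  have hk3 : (3 : ℝ) ≤ k := by exact_mod_cast hk
  set B := (k : ℝ) ^ (2 * t) with hB
  have hB0 : 0 < B := by positivity
  have hB' : (k : ℝ) ^ (2 * (t + 1)) = B * k ^ 2 := by rw [hB]; ring
  rw [hB']
  have hB'0 : 0 < B * (k : ℝ) ^ 2 := by positivity
  set N1 := (k : ℝ) ^ t / k ^ h with hN1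
  set N2 := (k : ℝ) ^ (t + 1) / k ^ h with hN2
  have hN10 : 0 < N1 := by positivity
  have hN20 : 0 < N2 := by positivity
  have hN1sq : N1 ^ 2 * k ^ (2 * h) = B := by
    rw [hN1, hB]; field_simp; ring
  have hN2sq : N2 ^ 2 * k ^ (2 * h) = B * k ^ 2 := by
    rw [hN2, hB]; field_simp; ring
  -- a bad `β` is close to a fraction
  have key : ∀ β : ℝ, ∀ m : ℕ, N1 < m → ∀ a : ℤ,
      m * |m * β - a| < 1 / (k : ℝ) ^ (2 * h + 2) → |β - a / m| ≤ 1 / (B * k ^ 2) := by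
    intro β m hm a hlt
    have hm0 : (0 : ℝ) < m := hN10.trans hm
    have e1 : |m * β - a| = m * |β - a / m| := by
      rw [← abs_of_pos hm0, ← abs_mul, abs_of_pos hm0]
      congr 1; field_simp
    rw [e1, lt_div_iff₀ (by positivity)] at hlt
    rw [le_div_iff₀ hB'0, ← hN1sq]
    have hmm : N1 ^ 2 ≤ (m : ℝ) ^ 2 := by gcongr
    calc |β - a / m| * (N1 ^ 2 * k ^ (2 * h) * k ^ 2)
        ≤ |β - a / m| * ((m : ℝ) ^ 2 * k ^ (2 * h) * k ^ 2) := by gcongr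
      _ = m * (m * |β - a / m|) * (k : ℝ) ^ (2 * h + 2) := by ring
      _ ≤ 1 := hlt.le
  by_cases hbad : ∃ β ∈ cell B i, ∃ m : ℕ, N1 < m ∧ (m : ℝ) ≤ N2 ∧ ∃ a : ℤ,
      m * |m * β - a| < 1 / (k : ℝ) ^ (2 * h + 2)
  · obtain ⟨β0, hβ0, m0, hm0, hm0', a0, hlt0⟩ := hbad
    obtain ⟨T, hT, hTj⟩ := exists_finset_cells_near hB'0 ((a0 : ℝ) / m0) 1
    refine ⟨T, by simpa using hT, fun j hj hsub β hβ m hm hm' a => ?_⟩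
    by_contra! hlt
    apply hj
    apply hTj
    refine ⟨β, hβ, ?_⟩
    have c0 := key β0 m0 hm0 a0 hlt0
    have c1 := key β m hm a hlt
    have c2 := abs_sub_le_of_mem_cell hβ0 (hsub hβ)
    have heq : (a0 : ℝ) / m0 = a / m := by
      apply frac_eq_of_close (N := N2) (by exact_mod_cast hN10.trans hm0)
        (by exact_mod_cast hN10.trans hm) hm0' hm'
      have h3 : |(a0 : ℝ) / m0 - a / m| ≤ |β0 - a0 / m0| + |β0 - β| + |β - a / m| := by
        rw [show (a0 : ℝ) / m0 - a / m = -(β0 - a0 / m0) + (β0 - β) + (β - a / m) by ring]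
        refine (abs_add_le _ _).trans ?_
        gcongr
        refine (abs_add_le _ _).trans ?_
        rw [abs_neg]
      have h4 : 1 / (B * (k : ℝ) ^ 2) ≤ 1 / B := by
        apply one_div_le_one_div_of_le hB0
        exact le_mul_of_one_le_right hB0.le (one_le_pow₀ (by linarith))
      have h5 : 3 / B < 1 / N2 ^ 2 := by
        rw [div_lt_div_iff₀ hB0 (by positivity), one_mul]
        have : (k : ℝ) ^ 4 ≤ k ^ (2 * h) := pow_le_pow_right₀ (by linarith) (by omega)
        have e : N2 ^ 2 * (k : ℝ) ^ 4 ≤ B * k ^ 2 := by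
          rw [← hN2sq]; gcongr
        have e2 : N2 ^ 2 * (k : ℝ) ^ 2 ≤ B := by
          have hk2 : (0 : ℝ) < k ^ 2 := by positivity
          nlinarith
        have h9 : (9 : ℝ) ≤ k ^ 2 := by nlinarith
        have h10 := pow_pos hN20 2
        nlinarith
      have h6 : 3 / B = 1 / B + 1 / B + 1 / B := by ring
      linarith
    rw [heq]
    simpa using c1
  · push Not at hbad
    exact ⟨∅, by simp, fun j _ hsub β hβ m hm hm' a => hbad β (hsub hβ) m hm hm' a⟩

theorem cell_child_subset {k : ℕ} (hk : 0 < k) (t q : ℕ) (i : ℤ) {d : ℕ} (hd : d < k ^ q) :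
    cell ((k : ℝ) ^ (t + q)) ((k : ℤ) ^ q * i + d) ⊆ cell ((k : ℝ) ^ t) i := by
  have hk0 : (0 : ℝ) < k := by exact_mod_cast hk
  have hd' : (d : ℝ) + 1 ≤ (k : ℝ) ^ q := by exact_mod_cast hd
  rw [pow_add]
  apply cell_subset_cell (by positivity) (by positivity)
  · push_cast
    have : (0 : ℝ) ≤ d := by positivity
    linarith
  · push_cast
    linarith

/-- Homogeneous lower bound, for denominators above `N`, on the whole cell of level `t` with
index `i`. -/
def HomCell (k h : ℕ) (c N : ℝ) (t : ℕ) (i : ℤ) : Prop :=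
  ∀ β ∈ cell ((k : ℝ) ^ (2 * t)) i, ∀ m : ℕ, N < m → (m : ℝ) ≤ (k : ℝ) ^ t / k ^ h →
    ∀ a : ℤ, c ≤ m * |m * β - a|

theorem homCell_zero_iff {k h : ℕ} {c : ℝ} {t : ℕ} {i : ℤ} : HomCell k h c 0 t i ↔
    ∀ β ∈ cell ((k : ℝ) ^ (2 * t)) i, HomBd c ((k : ℝ) ^ t / k ^ h) β := by
  constructor
  · intro H β hβ m hm hmN a
    exact H β hβ m (by exact_mod_cast hm) hmN a
  · intro H β hβ m hm hmN a
    exact H β hβ m (by exact_mod_cast hm) hmN a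

theorem card_filter_notMem_image {N : ℕ} (T : Finset ℤ) (x : ℤ) :
    N - T.card ≤ ((Finset.range N).filter fun d : ℕ => x + d ∉ T).card := by
  have h1 := Finset.card_filter_add_card_filter_not (s := Finset.range N) (fun d : ℕ => x + d ∈ T)
  have h2 : ((Finset.range N).filter fun d : ℕ => x + d ∈ T).card ≤ T.card := by
    apply Finset.card_le_card_of_injOn (fun d : ℕ => x + d)
    · intro d hd
      simp only [Finset.coe_filter, Set.mem_ofPred_eq] at hd
      exact hd.2
    · intro a _ b _ hab
      simpa using hab
  rw [Finset.card_range] at h1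
  omega

theorem homChildren {k : ℕ} (hk : 3 ≤ k) {h : ℕ} (hh : 2 ≤ h) {c N : ℝ}
    (hc : c ≤ 1 / (k : ℝ) ^ (2 * h + 2)) {t : ℕ} {i : ℤ} (H : HomCell k h c N t i) :
    ∃ S : Finset ℕ, k ^ 2 - 4 ≤ S.card ∧ ∀ d ∈ S, d < k ^ 2 ∧
      HomCell k h c N (t + 1) ((k : ℤ) ^ 2 * i + d) := by
  obtain ⟨T, hT, hT'⟩ := homStep hk hh t i
  refine ⟨(Finset.range (k ^ 2)).filter fun d : ℕ => (k : ℤ) ^ 2 * i + d ∉ T, ?_, ?_⟩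
  · have := card_filter_notMem_image (N := k ^ 2) T ((k : ℤ) ^ 2 * i)
    omega
  · intro d hd
    rw [Finset.mem_filter, Finset.mem_range] at hd
    refine ⟨hd.1, fun β hβ m hm hmN a => ?_⟩
    have hsub := cell_child_subset (by omega : 0 < k) (2 * t) 2 i hd.1
    by_cases hm' : (m : ℝ) ≤ (k : ℝ) ^ t / k ^ h
    · exact H β (hsub hβ) m hm hm' a
    · exact hc.trans (hT' _ hd.2 hsub β hβ m (not_le.mp hm') hmN a)

theorem homTree {k : ℕ} (hk : 3 ≤ k) {h : ℕ} (hh : 2 ≤ h) {c N : ℝ}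
    (hc : c ≤ 1 / (k : ℝ) ^ (2 * h + 2)) {t : ℕ} {i : ℤ} (H : HomCell k h c N t i) (q : ℕ) :
    ∃ S : Finset ℕ, (k ^ 2 - 4) ^ q ≤ S.card ∧ ∀ d ∈ S, d < k ^ (2 * q) ∧
      HomCell k h c N (t + q) ((k : ℤ) ^ (2 * q) * i + d) := by
  induction q with
  | zero => exact ⟨{0}, by simp, by simpa using H⟩
  | succ q ih =>
    obtain ⟨S, hS, hS'⟩ := ih
    have hch : ∀ d : ℕ, ∃ C : Finset ℕ, d ∈ S → k ^ 2 - 4 ≤ C.card ∧ ∀ e ∈ C, e < k ^ 2 ∧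
        HomCell k h c N (t + q + 1) ((k : ℤ) ^ 2 * ((k : ℤ) ^ (2 * q) * i + d) + e) := by
      intro d
      by_cases hd : d ∈ S
      · obtain ⟨C, hC⟩ := homChildren hk hh hc (hS' d hd).2
        exact ⟨C, fun _ => hC⟩
      · exact ⟨∅, fun h => absurd h hd⟩
    choose C hC using hch
    refine ⟨(S.sigma C).image fun p => k ^ 2 * p.1 + p.2, ?_, ?_⟩
    · rw [Finset.card_image_of_injOn, Finset.card_sigma]
      · calc (k ^ 2 - 4) ^ (q + 1) ≤ S.card * (k ^ 2 - 4) := by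
              rw [pow_succ]; gcongr
          _ = ∑ _d ∈ S, (k ^ 2 - 4) := by rw [Finset.sum_const, smul_eq_mul]
          _ ≤ _ := Finset.sum_le_sum fun d hd => (hC d hd).1
      · rintro ⟨d, e⟩ hde ⟨d', e'⟩ hde' heq
        simp only [Finset.coe_sigma, Set.mem_sigma_iff, Finset.mem_coe] at hde hde'
        have he := ((hC d hde.1).2 e hde.2).1
        have he' := ((hC d' hde'.1).2 e' hde'.2).1
        simp only at heq
        have h1 : (k ^ 2 * d + e) / k ^ 2 = d := by
          rw [Nat.mul_add_div (by positivity), Nat.div_eq_of_lt he, add_zero]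
        have h2 : (k ^ 2 * d' + e') / k ^ 2 = d' := by
          rw [Nat.mul_add_div (by positivity), Nat.div_eq_of_lt he', add_zero]
        have h3 : d = d' := by rw [← h1, heq, h2]
        subst h3
        have : e = e' := by omega
        subst this
        rfl
    · intro x hx
      rw [Finset.mem_image] at hx
      obtain ⟨⟨d, e⟩, hde, rfl⟩ := hx
      rw [Finset.mem_sigma] at hde
      have h1 := (hS' d hde.1).1
      have h2 := (hC d hde.1).2 e hde.2
      simp only at h1 h2 ⊢
      constructor
      · calc k ^ 2 * d + e < k ^ 2 * (d + 1) := by rw [mul_add]; omega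
          _ ≤ k ^ 2 * k ^ (2 * q) := by gcongr; omega
          _ = _ := by ring
      · have e1 : (k : ℤ) ^ (2 * (q + 1)) * i + ((k ^ 2 * d + e : ℕ) : ℤ) =
            (k : ℤ) ^ 2 * ((k : ℤ) ^ (2 * q) * i + d) + e := by
          push_cast
          ring
        rw [e1]
        exact h2.2

theorem HomCell.exists_descend {k : ℕ} (hk : 3 ≤ k) {h : ℕ} (hh : 2 ≤ h) {c N : ℝ}
    (hc : c ≤ 1 / (k : ℝ) ^ (2 * h + 2)) {t : ℕ} {i : ℤ} (H : HomCell k h c N t i) (q : ℕ) :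
    ∃ j, HomCell k h c N (t + q) j ∧
      cell ((k : ℝ) ^ (2 * (t + q))) j ⊆ cell ((k : ℝ) ^ (2 * t)) i := by
  obtain ⟨S, hS, hS'⟩ := homTree hk hh hc H q
  have : 0 < (k ^ 2 - 4) ^ q := by
    have : 3 ^ 2 ≤ k ^ 2 := Nat.pow_le_pow_left hk 2
    apply Nat.pow_pos
    omega
  obtain ⟨d, hd⟩ := Finset.card_pos.mp (this.trans_le hS)
  refine ⟨_, (hS' d hd).2, ?_⟩
  rw [mul_add]
  exact cell_child_subset (by omega) (2 * t) (2 * q) i (hS' d hd).1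

/-- Inhomogeneous step: few children of a `δ`-cell are bad for a small set of `β`. -/
theorem inhStep {k : ℕ} (hk : 3 ≤ k) {h h' : ℕ} (hhh : h ≤ h') {c : ℝ} (hc : c ≤ 1)
    (hck : 4 * (k : ℝ) < c * k ^ h') {t : ℕ}
    {J : Set ℝ} (hJ : ∀ x ∈ J, ∀ y ∈ J, |x - y| ≤ 1 / (k : ℝ) ^ (2 * t + 2))
    (H : ∀ β ∈ J, HomBd c ((k : ℝ) ^ (t + 1) / k ^ h) β) (d : ℤ) :
    ∃ T : Finset ℤ, T.card ≤ 6 ∧ ∀ j : ℤ, j ∉ T →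
      cell ((k : ℝ) ^ (t + 1)) j ⊆ cell ((k : ℝ) ^ t) d →
      ∀ β ∈ J, ∀ δ ∈ cell ((k : ℝ) ^ (t + 1)) j, ∀ m : ℕ, (k : ℝ) ^ t / k ^ h' < m →
        (m : ℝ) ≤ (k : ℝ) ^ (t + 1) / k ^ h' → ∀ a : ℤ,
        1 / (k : ℝ) ^ (h' + 1) ≤ m * |m * β - δ - a| := by
  have hk0 : (0 : ℝ) < k := by positivity
  have hk3 : (3 : ℝ) ≤ k := by exact_mod_cast hk
  set B := (k : ℝ) ^ t with hB
  have hB0 : 0 < B := by positivity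
  have hB' : (k : ℝ) ^ (t + 1) = B * k := by rw [hB]; ring
  have hB2 : (k : ℝ) ^ (2 * t + 2) = (B * k) ^ 2 := by rw [hB]; ring
  rw [hB2] at hJ
  rw [hB'] at H ⊢
  have hB'0 : 0 < B * (k : ℝ) := by positivity
  have hh0 : 1 ≤ (k : ℝ) ^ h' := one_le_pow₀ (by linarith)
  have key : ∀ β δ : ℝ, ∀ m : ℕ, B / k ^ h' < m → ∀ a : ℤ,
      m * |m * β - δ - a| < 1 / (k : ℝ) ^ (h' + 1) → |m * β - δ - a| ≤ 1 / (B * k) := by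
    intro β δ m hm a hlt
    have hm0 : (0 : ℝ) < m := lt_trans (by positivity) hm
    rw [lt_div_iff₀ (by positivity)] at hlt
    rw [div_lt_iff₀ (by positivity)] at hm
    rw [le_div_iff₀ hB'0]
    calc |m * β - δ - a| * (B * k) ≤ |m * β - δ - a| * (m * k ^ h' * k) := by gcongr
      _ = m * |m * β - δ - a| * (k : ℝ) ^ (h' + 1) := by ring
      _ ≤ 1 := hlt.le
  -- the drift of `m β` inside `J`
  have drift : ∀ β ∈ J, ∀ β' ∈ J, ∀ m : ℕ, (m : ℝ) ≤ B * k / k ^ h' →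
      |m * β - m * β'| ≤ 1 / (B * k) := by
    intro β hβ β' hβ' m hm
    rw [← mul_sub, abs_mul, abs_of_nonneg (by positivity)]
    have hm2 : (m : ℝ) ≤ B * k := hm.trans (div_le_self hB'0.le hh0)
    calc (m : ℝ) * |β - β'| ≤ (B * k) * (1 / (B * k) ^ 2) := by
          gcongr
          exact hJ β hβ β' hβ'
      _ = 1 / (B * k) := by field_simp
  by_cases hbad : ∃ β ∈ J, ∃ δ ∈ cell B d, ∃ m : ℕ, B / (k : ℝ) ^ h' < m ∧
      (m : ℝ) ≤ B * k / k ^ h' ∧ ∃ a : ℤ, m * |m * β - δ - a| < 1 / (k : ℝ) ^ (h' + 1)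
  · obtain ⟨β0, hβ0, δ0, hδ0, m0, hm0, hm0', a0, hlt0⟩ := hbad
    obtain ⟨T, hT, hTj⟩ := exists_finset_cells_near hB'0 (m0 * β0 - a0) 2
    refine ⟨T, by simpa using hT, fun j hj hsub β hβ δ hδ m hm hm' a => ?_⟩
    by_contra! hlt
    apply hj
    apply hTj
    refine ⟨δ, hδ, ?_⟩
    have c0 := key β0 δ0 m0 hm0 a0 hlt0
    have c1 := key β δ m hm a hlt
    have c2 : |δ0 - δ| ≤ 1 / B := abs_sub_le_of_mem_cell hδ0 (hsub hδ)
    have c3 := drift β0 hβ0 β hβ m0 hm0'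
    have h4 : 1 / (B * (k : ℝ)) ≤ 1 / B := by
      apply one_div_le_one_div_of_le hB0
      exact le_mul_of_one_le_right hB0.le (by linarith)
    -- the pairs `(m, a)` and `(m0, a0)` coincide
    have hz : |((m0 : ℝ) - m) * β - (a0 - a)| ≤ 4 / B := by
      have e : ((m0 : ℝ) - m) * β - (a0 - a) =
        (m0 * β0 - δ0 - a0) - (m * β - δ - a) + (δ0 - δ) - (m0 * β0 - m0 * β) := by ring
      rw [e]
      have h5 : 4 / B = 1 / B + 1 / B + 1 / B + 1 / B := by ring
      rw [h5]
      refine (abs_sub _ _).trans ?_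
      gcongr
      · refine (abs_add_le _ _).trans ?_
        gcongr
        refine (abs_sub _ _).trans ?_
        gcongr
        · exact c0.trans h4
        · exact c1.trans h4
      · exact c3.trans h4
    have hmm : m0 = m := by
      by_contra hne
      have hl0 : (0 : ℝ) < m := lt_trans (by positivity) hm
      have hl1 : (0 : ℝ) < m0 := lt_trans (by positivity) hm0
      have main : ∀ l : ℕ, 0 < l → (l : ℝ) ≤ B * k / k ^ h' → ∀ b : ℤ,
          |l * β - b| ≤ 4 / B → False := by
        intro l hl hlN b hb
        have hlN' : (l : ℝ) ≤ B * k / k ^ h := by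
          refine hlN.trans ?_
          apply div_le_div_of_nonneg_left hB'0.le (by positivity)
          exact pow_le_pow_right₀ (by linarith) hhh
        have := H β hβ l hl hlN' b
        have h6 : c ≤ B * k / k ^ h' * (4 / B) := by
          refine this.trans ?_
          gcongr
        have h7 : B * k / k ^ h' * (4 / B) = 4 * k / k ^ h' := by field_simp
        rw [h7, le_div_iff₀ (by positivity)] at h6
        linarith
      rcases lt_or_gt_of_ne hne with hlt' | hlt'
      · apply main (m - m0) (by omega) ?_ (a - a0)
        · rw [Nat.cast_sub hlt'.le]
          push_cast
          rw [← abs_neg]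
          convert hz using 2
          ring
        · rw [Nat.cast_sub hlt'.le]; linarith
      · apply main (m0 - m) (by omega) ?_ (a0 - a)
        · rw [Nat.cast_sub hlt'.le]
          push_cast
          exact hz
        · rw [Nat.cast_sub hlt'.le]; linarith
    subst hmm
    have haa : a0 = a := by
      by_contra hne
      have h8 : (1 : ℝ) ≤ |(a0 : ℝ) - a| := by
        have := Int.one_le_abs (sub_ne_zero.mpr hne)
        exact_mod_cast this
      rw [sub_self, zero_mul, zero_sub, abs_neg] at hz
      have hm1 : (1 : ℝ) ≤ m0 := by
        have : (0 : ℝ) < m0 := lt_trans (by positivity) hm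
        exact_mod_cast this
      have h9 : 1 ≤ B * k / k ^ h' := hm1.trans hm'
      rw [le_div_iff₀ (by positivity), one_mul] at h9
      have h10 : 1 ≤ 4 / B := h8.trans hz
      rw [le_div_iff₀ hB0] at h10
      nlinarith
    subst haa
    have e : δ - (m0 * β0 - a0) = -(m0 * β - δ - a0) - (m0 * β0 - m0 * β) := by ring
    rw [e]
    have h5 : ((2 : ℕ) : ℝ) / (B * k) = 1 / (B * k) + 1 / (B * k) := by push_cast; ring
    rw [h5]
    refine (abs_sub _ _).trans ?_
    rw [abs_neg]
    gcongr
  · push Not at hbad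
    exact ⟨∅, by simp, fun j _ hsub β hβ δ hδ m hm hm' a =>
      hbad β hβ δ (hsub hδ) m hm hm' a⟩

/-- An integer matrix acting on the line by `y ↦ (P + P' y) / (Q + Q' y)`. -/
structure Mob where
  P : ℤ
  Q : ℤ
  P' : ℤ
  Q' : ℤ

namespace Mob

/-- The denominator of the action. -/
def den (M : Mob) (y : ℝ) : ℝ := M.Q + M.Q' * y

/-- The action of a matrix on the line. -/
noncomputable def app (M : Mob) (y : ℝ) : ℝ := (M.P + M.P' * y) / M.den y

/-- The determinant. -/
def det (M : Mob) : ℤ := M.P' * M.Q - M.P * M.Q'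

/-- Composition with `y ↦ 1 / (a + y)`. -/
def child (M : Mob) (a : ℤ) : Mob := ⟨a * M.P + M.P', a * M.Q + M.Q', M.P, M.Q⟩

theorem det_child (M : Mob) (a : ℤ) : (M.child a).det = -M.det := by
  simp only [child, det]; ring

theorem den_pos {M : Mob} (hQ : 0 < M.Q) (hQ' : 0 < M.Q') {y : ℝ} (hy : 0 ≤ y) :
    0 < M.den y := by
  have h1 : (0 : ℝ) < M.Q := by exact_mod_cast hQ
  have h2 : (0 : ℝ) < M.Q' := by exact_mod_cast hQ'
  unfold den; positivity

theorem den_ge {M : Mob} (hQ' : 0 < M.Q') {y : ℝ} (hy : 0 ≤ y) : (M.Q : ℝ) ≤ M.den y := by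
  have h2 : (0 : ℝ) < M.Q' := by exact_mod_cast hQ'
  unfold den; nlinarith

theorem den_le {M : Mob} (hQ' : 0 < M.Q') {y : ℝ} (hy : y ≤ 1) :
    M.den y ≤ M.Q + M.Q' := by
  have h2 : (0 : ℝ) < M.Q' := by exact_mod_cast hQ'
  unfold den; nlinarith

theorem app_child {M : Mob} (hQ : 0 < M.Q) (hQ' : 0 < M.Q') {a : ℤ} (ha : 0 < a) {y : ℝ}
    (hy : 0 ≤ y) : (M.child a).app y = M.app (1 / (a + y)) := by
  have h1 : (0 : ℝ) < M.Q := by exact_mod_cast hQ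
  have h2 : (0 : ℝ) < M.Q' := by exact_mod_cast hQ'
  have h3 : (0 : ℝ) < a := by exact_mod_cast ha
  have h4 : (0 : ℝ) < a + y := by positivity
  have h5 : (0 : ℝ) < a * M.Q + M.Q' + M.Q * y := by positivity
  have h6 : (0 : ℝ) < M.Q + M.Q' * (1 / (a + y)) := by positivity
  simp only [app, den, child]
  push_cast
  rw [div_eq_div_iff h5.ne' h6.ne']
  field_simp
  ring

theorem app_sub_app {M : Mob} (hQ : 0 < M.Q) (hQ' : 0 < M.Q') {y z : ℝ} (hy : 0 ≤ y)
    (hz : 0 ≤ z) : M.app y - M.app z = M.det * (y - z) / (M.den y * M.den z) := by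
  have h1 := (den_pos hQ hQ' hy).ne'
  have h2 := (den_pos hQ hQ' hz).ne'
  rw [app, app, div_sub_div _ _ h1 h2]
  congr 1
  simp only [den, det]
  push_cast
  ring

theorem mul_app_sub {M : Mob} (hQ : 0 < M.Q) (hQ' : 0 < M.Q') {y : ℝ} (hy : 0 ≤ y) (m a : ℤ) :
    m * M.app y - a =
      (((m * M.P - a * M.Q : ℤ) : ℝ) + ((m * M.P' - a * M.Q' : ℤ) : ℝ) * y) / M.den y := by
  have h1 := (den_pos hQ hQ' hy).ne'
  rw [eq_div_iff h1, app, sub_mul, mul_assoc, div_mul_cancel₀ _ h1]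
  simp only [den]
  push_cast
  ring

/-- Lower bound below the sum of the denominators. -/
theorem le_abs_mul_app_sub {M : Mob} (hQ : 0 < M.Q) (hQ' : 0 < M.Q') (hdet : |M.det| = 1)
    {y : ℝ} (hy : 0 ≤ y) (hy1 : y ≤ 1) {m : ℕ} (hm : 0 < m) (hmQ : (m : ℤ) < M.Q + M.Q') (a : ℤ) :
    y / (M.Q + M.Q') ≤ |m * M.app y - a| := by
  have h1 := den_pos hQ hQ' hy
  have h2 := den_le hQ' hy1
  have e := mul_app_sub hQ hQ' hy m a
  set u := (m : ℤ) * M.P - a * M.Q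
  set v := (m : ℤ) * M.P' - a * M.Q'
  have huv : v * M.Q - u * M.Q' = m * M.det := by simp only [u, v, det]; ring
  have habs : |v * M.Q - u * M.Q'| = m := by rw [huv, abs_mul, hdet]; simp
  have hnn : 0 ≤ u * v := by
    by_contra! hneg
    rcases mul_neg_iff.mp hneg with ⟨hu, hv⟩ | ⟨hu, hv⟩
    · have : v * M.Q - u * M.Q' ≤ -(M.Q + M.Q') := by nlinarith
      rw [abs_of_neg (by linarith)] at habs
      linarith
    · have : M.Q + M.Q' ≤ v * M.Q - u * M.Q' := by nlinarith
      rw [abs_of_pos (by linarith)] at habs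
      linarith
  have hne : u ≠ 0 ∨ v ≠ 0 := by
    by_contra! h
    rw [h.1, h.2] at habs
    simp at habs
    omega
  have hlow : y ≤ |(u : ℝ) + v * y| := by
    have key : ∀ u v : ℤ, 0 ≤ u → 0 ≤ v → (u ≠ 0 ∨ v ≠ 0) → y ≤ (u : ℝ) + v * y := by
      intro u v hu hv h
      have hu' : (0 : ℝ) ≤ u := by exact_mod_cast hu
      have hv' : (0 : ℝ) ≤ v := by exact_mod_cast hv
      rcases h with h | h
      · have : (1 : ℝ) ≤ u := by
          have : 1 ≤ u := by omega
          exact_mod_cast this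
        nlinarith
      · have : (1 : ℝ) ≤ v := by
          have : 1 ≤ v := by omega
          exact_mod_cast this
        nlinarith
    rcases mul_nonneg_iff.mp hnn with ⟨hu, hv⟩ | ⟨hu, hv⟩
    · exact (key u v hu hv hne).trans (le_abs_self _)
    · have := key (-u) (-v) (by omega) (by omega) (by omega)
      push_cast at this
      refine this.trans ?_
      rw [← abs_neg]
      refine le_trans (le_of_eq ?_) (le_abs_self _)
      ring
  have e' : (m : ℝ) * M.app y - a = (u + v * y) / M.den y := by exact_mod_cast e
  rw [e', abs_div, abs_of_pos h1]
  gcongr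

/-- Lower bound inherited from a lower bound for the argument. -/
theorem tail_bound {M : Mob} (hQ : 0 < M.Q) (hQ' : 0 < M.Q') (hQQ : M.Q' ≤ M.Q)
    (hdet : |M.det| = 1) {y c V : ℝ} (hc : c ≤ 1) (hV : 1 ≤ V) (hy : 0 ≤ y) (hy1 : y ≤ 1)
    (H : HomBd c V y) {m : ℕ} (hm : (M.Q : ℝ) ≤ 4 * m) (hmV : 2 * (m : ℝ) ≤ V * M.Q) (a : ℤ) :
    c / 16 ≤ m * |m * M.app y - a| := by
  have hQ0 : (0 : ℝ) < M.Q := by exact_mod_cast hQ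
  have hQ0' : (0 : ℝ) < M.Q' := by exact_mod_cast hQ'
  have hQQ' : (M.Q' : ℝ) ≤ M.Q := by exact_mod_cast hQQ
  have h1 := den_pos hQ hQ' hy
  have h2 := den_le hQ' hy1
  have h3 := den_ge hQ' hy
  have hD : M.den y ≤ 2 * M.Q := by linarith
  have e := mul_app_sub hQ hQ' hy m a
  set u := (m : ℤ) * M.P - a * M.Q
  set v := (m : ℤ) * M.P' - a * M.Q'
  have huv : v * M.Q - u * M.Q' = m * M.det := by simp only [u, v, det]; ring
  have habs : |v * M.Q - u * M.Q'| = m := by rw [huv, abs_mul, hdet]; simp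
  have e' : (m : ℝ) * M.app y - a = (u + v * y) / M.den y := by exact_mod_cast e
  have hm0 : (0 : ℝ) < m := by linarith
  rw [e', abs_div, abs_of_pos h1, mul_div_assoc', div_le_div_iff₀ (by norm_num) h1]
  set w := (u : ℝ) + v * y with hw
  have habs' : |(v : ℝ) * M.den y - w * M.Q'| = m := by
    have : (v : ℝ) * M.den y - w * M.Q' = ((v * M.Q - u * M.Q' : ℤ) : ℝ) := by
      simp only [hw, den]; push_cast; ring
    rw [this]
    exact_mod_cast habs
  have hcD : c * M.den y ≤ 2 * M.Q := by nlinarith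
  rcases le_or_gt (1 / 2) |w| with hbig | hsmall
  · nlinarith
  · have hv : |(v : ℝ)| * M.Q ≤ m + M.Q / 2 := by
      have t1 : |(v : ℝ) * M.den y| ≤ m + |w * M.Q'| := by
        rw [← habs']
        have := abs_add_le ((v : ℝ) * M.den y - w * M.Q') (w * M.Q')
        rwa [sub_add_cancel] at this
      rw [abs_mul, abs_mul, abs_of_pos h1, abs_of_pos hQ0'] at t1
      have t2 : |(v : ℝ)| * M.Q ≤ |(v : ℝ)| * M.den y := by gcongr
      have t3 : |w| * M.Q' ≤ 1 / 2 * M.Q := by gcongr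
      linarith
    have hvne : v ≠ 0 := by
      intro h0
      have hu : (u : ℝ) = w := by rw [hw, h0]; simp
      have : |u| < 1 := by
        have : |(u : ℝ)| < 1 := by rw [hu]; linarith
        exact_mod_cast this
      have hu0 : u = 0 := Int.abs_lt_one_iff.mp this
      rw [h0, hu0] at habs
      simp at habs
      have : (m : ℝ) = 0 := by exact_mod_cast habs.symm
      linarith
    have hvV : ((v.natAbs : ℕ) : ℝ) ≤ V := by
      rw [Nat.cast_natAbs, Int.cast_abs]
      have : |(v : ℝ)| * M.Q ≤ V * M.Q := by nlinarith
      exact le_of_mul_le_mul_right this hQ0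
    have main := H v.natAbs (Int.natAbs_pos.mpr hvne) hvV (-u * v.sign)
    rw [Nat.cast_natAbs, Int.cast_abs] at main
    have hs : |(|(v : ℝ)| * y - ((-u * v.sign : ℤ) : ℝ))| = |w| := by
      rcases lt_or_gt_of_ne hvne with hlt | hlt
      · have : (v : ℝ) < 0 := by exact_mod_cast hlt
        rw [Int.sign_eq_neg_one_of_neg hlt, abs_of_neg this, hw, ← abs_neg]
        congr 1
        push_cast
        ring
      · have : (0 : ℝ) < v := by exact_mod_cast hlt
        rw [Int.sign_eq_one_of_pos hlt, abs_of_pos this, hw]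
        congr 1
        push_cast
        ring
    rw [hs] at main
    have hv3 : |(v : ℝ)| * M.Q ≤ 3 * m := by linarith
    have hw0 := abs_nonneg w
    calc c * M.den y ≤ |(v : ℝ)| * |w| * M.den y := by gcongr
      _ ≤ |(v : ℝ)| * |w| * (2 * M.Q) := by gcongr
      _ = 2 * |w| * (|(v : ℝ)| * M.Q) := by ring
      _ ≤ 2 * |w| * (3 * m) := by gcongr
      _ ≤ m * |w| * 16 := by nlinarith

end Mob

/-- Consecutive Farey fractions around a real number. -/
theorem exists_farey (x : ℝ) (F : ℕ) (hF : 1 ≤ F) :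
    ∃ M : Mob, 0 < M.Q ∧ 0 < M.Q' ∧ M.Q ≤ F ∧ M.Q' ≤ F ∧ F < M.Q + M.Q' ∧ M.det = 1 ∧
      M.P ≤ x * M.Q ∧ x * M.Q' < M.P' := by
  induction F, hF using Nat.le_induction with
  | base =>
    refine ⟨⟨⌊x⌋, 1, ⌊x⌋ + 1, 1⟩, ?_⟩
    simp [Mob.det, Int.floor_le]
  | succ F hF ih =>
    obtain ⟨⟨P, Q, P', Q'⟩, h1, h2, h3, h4, h5, h6, h7, h8⟩ := ih
    simp only [Mob.det] at *
    by_cases hlt : ((F + 1 : ℕ) : ℤ) < Q + Q'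
    · exact ⟨⟨P, Q, P', Q'⟩, h1, h2, by push_cast; linarith, by push_cast; linarith, hlt, h6, h7, h8⟩
    · by_cases hx : ((P + P' : ℤ) : ℝ) ≤ x * ((Q + Q' : ℤ) : ℝ)
      · refine ⟨⟨P + P', Q + Q', P', Q'⟩, ?_⟩
        dsimp only
        exact ⟨by linarith, h2, by linarith, by push_cast; linarith,
          by push_cast at *; linarith, by linarith, hx, h8⟩
      · refine ⟨⟨P, Q, P + P', Q + Q'⟩, ?_⟩
        dsimp only
        exact ⟨h1, by linarith, by push_cast; linarith, by linarith,
          by push_cast at *; linarith, by linarith, h7, not_le.mp hx⟩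

/-- A family of `2 ^ s` matrices extending `M` by words in the letters `1` and `3`. -/
theorem exists_family (M : Mob) (hQ' : 0 < M.Q') (hQQ : M.Q' ≤ M.Q) (hdet : |M.det| = 1)
    (s : ℕ) :
    ∃ (ι : Type) (_ : Fintype ι) (_ : DecidableEq ι) (f : ι → Mob), Fintype.card ι = 2 ^ s ∧
      (∀ i, (f i).det = (-1) ^ s * M.det) ∧
      (∀ i, 0 < (f i).Q' ∧ (f i).Q' ≤ (f i).Q ∧ M.Q ≤ (f i).Q ∧ (f i).Q ≤ 4 ^ s * M.Q) ∧
      (∀ i j, i ≠ j →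
        (1 / 6 : ℝ) / 16 ^ s ≤ |((f i).Q' : ℝ) / (f i).Q - ((f j).Q' : ℝ) / (f j).Q|) ∧
      (∀ i, ∀ y : ℝ, 0 ≤ y → y ≤ 1 → ∃ z : ℝ, 0 ≤ z ∧ z ≤ 1 ∧ (f i).app y = M.app z) ∧
      (∀ i, ∀ y : ℝ, 0 ≤ y → y ≤ 1 → ∀ m : ℕ, M.Q ≤ 4 * (m : ℤ) → 4 * (m : ℤ) < (f i).Q →
        ∀ a : ℤ, (1 / 32 : ℝ) ≤ m * |m * (f i).app y - a|) := by
  induction s with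
  | zero =>
    refine ⟨Unit, inferInstance, inferInstance, fun _ => M, by simp, by simp, ?_, ?_, ?_, ?_⟩
    · exact fun _ => ⟨hQ', hQQ, le_rfl, by simp⟩
    · exact fun i j h => absurd rfl h
    · exact fun _ y hy hy1 => ⟨y, hy, hy1, rfl⟩
    · intro _ y _ _ m h1 h2
      exact absurd h2 (not_lt.mpr h1)
  | succ s ih =>
    obtain ⟨ι, _, _, f, hcard, hd, hq, hsep, hsub, hhom⟩ := ih
    let l : Bool → ℤ := fun b => if b then 1 else 3
    have hl : ∀ b, 1 ≤ l b ∧ l b ≤ 3 := by decide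
    have hlr : ∀ b, (1 : ℝ) ≤ l b ∧ (l b : ℝ) ≤ 3 := fun b =>
      ⟨by exact_mod_cast (hl b).1, by exact_mod_cast (hl b).2⟩
    have hQpos : ∀ i, 0 < (f i).Q := fun i => (hq i).1.trans_le (hq i).2.1
    have happ : ∀ i b (y : ℝ), 0 ≤ y → ((f i).child (l b)).app y = (f i).app (1 / (l b + y)) :=
      fun i b y hy => Mob.app_child (hQpos i) (hq i).1 (by have := (hl b).1; omega) hy
    have hyy : ∀ b (y : ℝ), 0 ≤ y → y ≤ 1 → 1 / 4 ≤ 1 / ((l b : ℝ) + y) ∧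
        1 / ((l b : ℝ) + y) ≤ 1 := by
      intro b y hy hy1
      have := hlr b
      constructor
      · apply one_div_le_one_div_of_le <;> linarith
      · rw [div_le_one (by linarith)]; linarith
    refine ⟨ι × Bool, inferInstance, inferInstance, fun p => (f p.1).child (l p.2), ?_, ?_, ?_, ?_,
      ?_, ?_⟩
    · rw [Fintype.card_prod, hcard, Fintype.card_bool, pow_succ]
    · intro p
      rw [Mob.det_child, hd, pow_succ]
      ring
    · rintro ⟨i, b⟩
      have h1 := hl b
      obtain ⟨h2, h3, h4, h5⟩ := hq i
      simp only [Mob.child]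
      refine ⟨hQpos i, ?_, ?_, ?_⟩
      · nlinarith
      · nlinarith
      · rw [pow_succ]; nlinarith
    · rintro ⟨i, b⟩ ⟨j, b'⟩ hne
      have hr : ∀ i b, ((((f i).child (l b)).Q' : ℤ) : ℝ) / ((f i).child (l b)).Q =
          1 / (l b + (f i).Q' / (f i).Q) := by
        intro i b
        have h1 : (0 : ℝ) < (f i).Q := by exact_mod_cast hQpos i
        simp only [Mob.child]
        push_cast
        field_simp
      have hr0 : ∀ i, (0 : ℝ) < ((f i).Q' : ℝ) / (f i).Q ∧ ((f i).Q' : ℝ) / (f i).Q ≤ 1 := by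
        intro i
        have h1 : (0 : ℝ) < (f i).Q := by exact_mod_cast hQpos i
        have h2 : (0 : ℝ) < (f i).Q' := by exact_mod_cast (hq i).1
        have h3 : ((f i).Q' : ℝ) ≤ (f i).Q := by exact_mod_cast (hq i).2.1
        exact ⟨by positivity, by rw [div_le_one h1]; exact h3⟩
      simp only
      rw [hr, hr]
      have a1 := hr0 i
      have a2 := hr0 j
      set r1 := ((f i).Q' : ℝ) / (f i).Q
      set r2 := ((f j).Q' : ℝ) / (f j).Q
      have h16 : (1 / 6 : ℝ) / 16 ^ (s + 1) ≤ 1 / 6 := by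
        apply div_le_self (by norm_num)
        exact one_le_pow₀ (by norm_num)
      have hdiff : ∀ x y : ℝ, 0 < x → x ≤ 1 → 0 < y → y ≤ 1 →
          1 / 6 ≤ 1 / ((1 : ℝ) + x) - 1 / (3 + y) := by
        intro x y hx hx1 hy hy1
        have e1 : (1 : ℝ) / 2 ≤ 1 / (1 + x) := by apply one_div_le_one_div_of_le <;> linarith
        have e2 : (1 : ℝ) / (3 + y) ≤ 1 / 3 := by apply one_div_le_one_div_of_le <;> linarith
        linarith
      by_cases hb : b = b'
      · subst hb
        have hij : i ≠ j := by rintro rfl; exact hne rfl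
        have h1 := hsep i j hij
        have h2 := hlr b
        have e : 1 / ((l b : ℝ) + r1) - 1 / (l b + r2) = (r2 - r1) / ((l b + r1) * (l b + r2)) := by
          rw [div_sub_div _ _ (by linarith) (by linarith)]
          congr 1; ring
        rw [e, abs_div, abs_of_pos (show 0 < (l b + r1) * (l b + r2) by
          apply mul_pos <;> linarith), le_div_iff₀ (by apply mul_pos <;> linarith), abs_sub_comm]
        refine le_trans ?_ h1
        have h3 : ((l b : ℝ) + r1) * (l b + r2) ≤ 16 := by nlinarith
        calc (1 / 6 : ℝ) / 16 ^ (s + 1) * ((l b + r1) * (l b + r2))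
            ≤ (1 / 6 : ℝ) / 16 ^ (s + 1) * 16 := by gcongr
          _ = _ := by rw [pow_succ]; field_simp
      · refine h16.trans ?_
        cases b <;> cases b'
        · exact absurd rfl hb
        · rw [abs_sub_comm]
          refine le_trans ?_ (le_abs_self _)
          simpa [l] using hdiff r2 r1 a2.1 a2.2 a1.1 a1.2
        · refine le_trans ?_ (le_abs_self _)
          simpa [l] using hdiff r1 r2 a1.1 a1.2 a2.1 a2.2
        · exact absurd rfl hb
    · rintro ⟨i, b⟩ y hy hy1
      obtain ⟨h1, h2⟩ := hyy b y hy hy1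
      obtain ⟨z, hz0, hz1, hz⟩ := hsub i _ (by linarith) h2
      exact ⟨z, hz0, hz1, by rw [happ i b y hy, hz]⟩
    · rintro ⟨i, b⟩ y hy hy1 m hm hmQ a
      obtain ⟨h1, h2⟩ := hyy b y hy hy1
      simp only at hmQ ⊢
      rw [happ i b y hy]
      obtain ⟨q1, q2, q3, q4⟩ := hq i
      by_cases hlt : 4 * (m : ℤ) < (f i).Q
      · exact hhom i _ (by linarith) h2 m hm hlt a
      · have hb := hl b
        simp only [Mob.child] at hmQ
        have hm1 : (m : ℤ) < (f i).Q := by nlinarith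
        have hm0 : 0 < m := by
          have := hQpos i
          omega
        have hdi : |(f i).det| = 1 := by rw [hd i, abs_mul, hdet]; simp
        have := Mob.le_abs_mul_app_sub (hQpos i) q1 hdi (by linarith) h2 hm0 (by linarith) a
        have hQ0 : (0 : ℝ) < (f i).Q := by exact_mod_cast hQpos i
        have hQ0' : (0 : ℝ) < (f i).Q' := by exact_mod_cast q1
        have hQQ' : ((f i).Q' : ℝ) ≤ (f i).Q := by exact_mod_cast q2
        have hm4 : ((f i).Q : ℝ) ≤ 4 * m := by exact_mod_cast (not_lt.mp hlt)
        calc (1 / 32 : ℝ) = ((f i).Q / 4) * ((1 / 4) / (2 * (f i).Q)) := by field_simp; norm_num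
          _ ≤ m * ((1 / (l b + y)) / ((f i).Q + (f i).Q')) := by
            gcongr
            · linarith
            · linarith
          _ ≤ _ := by gcongr

/-- The additive character `x ↦ exp (2 π i x)`. -/
noncomputable def ee (x : ℝ) : ℂ := Complex.exp (Complex.I * ((2 * π * x : ℝ) : ℂ))

theorem ee_add (x y : ℝ) : ee (x + y) = ee x * ee y := by
  rw [ee, ee, ee, ← Complex.exp_add]
  congr 1
  push_cast
  ring

theorem ee_nat_mul (n : ℕ) (x : ℝ) : ee (n * x) = ee x ^ n := by
  rw [ee, ee, ← Complex.exp_nat_mul]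
  congr 1
  push_cast
  ring

theorem norm_ee (x : ℝ) : ‖ee x‖ = 1 := by
  rw [ee, mul_comm]
  exact Complex.norm_exp_ofReal_mul_I _

theorem ee_int (a : ℤ) : ee a = 1 := by
  rw [ee, Complex.exp_eq_one_iff]
  exact ⟨a, by push_cast; ring⟩

theorem conj_ee (x : ℝ) : (starRingEnd ℂ) (ee x) = ee (-x) := by
  rw [ee, ee, ← Complex.exp_conj, map_mul, Complex.conj_I, Complex.conj_ofReal]
  congr 1
  push_cast
  ring

theorem four_mul_le_norm_ee_sub_one {x η : ℝ} (h : ∀ a : ℤ, η ≤ |x - a|) :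
    4 * η ≤ ‖ee x - 1‖ := by
  have hx : ee x = ee (x - round x) := by
    have : ee x = ee (x - round x) * ee (round x) := by rw [← ee_add]; congr 1; ring
    rw [this, ee_int, mul_one]
  have h1 := h (round x)
  have h2 := abs_sub_round x
  rw [hx]
  set y := x - round x
  rw [ee, Complex.norm_exp_I_mul_ofReal_sub_one, Real.norm_eq_abs, abs_mul, abs_two]
  have h3 : |Real.sin (2 * π * y / 2)| = Real.sin (π * |y|) := by
    rw [show 2 * π * y / 2 = π * y by ring]
    have hs : 0 ≤ Real.sin (π * |y|) := by
      apply Real.sin_nonneg_of_nonneg_of_le_pi (by positivity)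
      nlinarith [Real.pi_pos]
    rcases le_total 0 y with hy | hy
    · rw [abs_of_nonneg hy] at hs ⊢
      exact abs_of_nonneg hs
    · rw [abs_of_nonpos hy] at hs ⊢
      rw [mul_neg, Real.sin_neg] at hs ⊢
      exact abs_of_nonpos (by linarith)
  rw [h3]
  have h4 := Real.mul_le_sin (x := π * |y|) (by positivity) (by nlinarith [Real.pi_pos])
  have h5 : 2 / π * (π * |y|) = 2 * |y| := by field_simp
  linarith

theorem norm_geom_ee_le {x η : ℝ} (hη : 0 < η) (h : ∀ a : ℤ, η ≤ |x - a|) (N : ℕ) :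
    ‖∑ n ∈ Finset.range N, ee x ^ n‖ ≤ 1 / (2 * η) := by
  have h1 := four_mul_le_norm_ee_sub_one h
  have h2 : ‖ee x ^ N - 1‖ ≤ 2 := by
    refine (norm_sub_le _ _).trans ?_
    rw [norm_pow, norm_ee]
    norm_num
  have h3 := congrArg norm (geom_sum_mul (ee x) N)
  rw [norm_mul] at h3
  rw [le_div_iff₀ (by positivity)]
  nlinarith [norm_nonneg (∑ n ∈ Finset.range N, ee x ^ n)]

theorem ofReal_normSq_sum {κ : Type*} (s : Finset κ) (f : κ → ℂ) :
    ((‖∑ i ∈ s, f i‖ ^ 2 : ℝ) : ℂ) = ∑ i ∈ s, ∑ j ∈ s, f i * (starRingEnd ℂ) (f j) := by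
  rw [← Finset.sum_mul_sum, ← map_sum, Complex.mul_conj, Complex.normSq_eq_norm_sq]

/-- If all geometric sums are small then some power sum is large. -/
theorem exists_large_powerSum {ι : Type*} [Fintype ι] [Nonempty ι] (z : ι → ℂ)
    (hz : ∀ w, ‖z w‖ = 1) {H : ℕ} (hH : 0 < H)
    (hs : ∀ w, ‖∑ h ∈ Finset.range H, z w ^ h‖ ^ 2 ≤ (H : ℝ) / 4) :
    ∃ d, 1 ≤ d ∧ d < H ∧ 3 / 4 * (Fintype.card ι : ℝ) / H ≤ ‖∑ w, z w ^ d‖ := by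
  by_contra! hcon
  have hL : (0 : ℝ) < Fintype.card ι := by exact_mod_cast Fintype.card_pos
  have hH0 : (0 : ℝ) < H := by exact_mod_cast hH
  set L := (Fintype.card ι : ℝ)
  let V : ℕ → ℕ → ℂ := fun h h' => ∑ w, z w ^ h * (starRingEnd ℂ) (z w ^ h')
  have hzz : ∀ w (n : ℕ), z w ^ n * (starRingEnd ℂ) (z w ^ n) = 1 := by
    intro w n
    rw [Complex.mul_conj, Complex.normSq_eq_norm_sq, norm_pow, hz]
    simp
  have hVd : ∀ h, V h h = (L : ℂ) := by
    intro h
    simp only [V, hzz]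
    simp [L]
  have hVadd : ∀ h d, V (h + d) h = ∑ w, z w ^ d := by
    intro h d
    simp only [V]
    apply Finset.sum_congr rfl
    intro w _
    rw [pow_add, mul_right_comm, hzz, one_mul]
  have hVadd' : ∀ h d, ‖V h (h + d)‖ = ‖∑ w, z w ^ d‖ := by
    intro h d
    rw [← hVadd h d, ← Complex.norm_conj]
    simp only [V, map_sum, map_mul, Complex.conj_conj]
    congr 1
    apply Finset.sum_congr rfl
    intro w _
    ring
  have hVlt : ∀ h ∈ Finset.range H, ∀ h' ∈ Finset.range H, h ≠ h' →
      ‖V h h'‖ ≤ 3 / 4 * L / H := by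
    intro h hh h' hh' hne
    rw [Finset.mem_range] at hh hh'
    rcases lt_or_gt_of_ne hne with hlt | hlt
    · obtain ⟨d, rfl⟩ := Nat.exists_eq_add_of_lt hlt
      rw [add_assoc, hVadd']
      exact (hcon (d + 1) (by omega) (by omega)).le
    · obtain ⟨d, rfl⟩ := Nat.exists_eq_add_of_lt hlt
      rw [add_assoc, hVadd]
      exact (hcon (d + 1) (by omega) (by omega)).le
  have htot : ((∑ w, ‖∑ h ∈ Finset.range H, z w ^ h‖ ^ 2 : ℝ) : ℂ) =
      ∑ h ∈ Finset.range H, ∑ h' ∈ Finset.range H, V h h' := by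
    rw [Complex.ofReal_sum]
    simp_rw [ofReal_normSq_sum]
    rw [Finset.sum_comm]
    apply Finset.sum_congr rfl
    intro h _
    rw [Finset.sum_comm]
  have hrow : ∀ h ∈ Finset.range H, L - (H - 1) * (3 / 4 * L / H) ≤
      (∑ h' ∈ Finset.range H, V h h').re := by
    intro h hh
    rw [← Finset.add_sum_erase _ _ hh, hVd, Complex.add_re, Complex.ofReal_re]
    have h1 : ‖∑ h' ∈ (Finset.range H).erase h, V h h'‖ ≤ (H - 1) * (3 / 4 * L / H) := by
      refine (norm_sum_le _ _).trans ?_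
      have := Finset.sum_le_card_nsmul ((Finset.range H).erase h) (fun h' => ‖V h h'‖)
        (3 / 4 * L / H) (fun h' hh' => by
          rw [Finset.mem_erase] at hh'
          exact hVlt h hh h' hh'.2 (Ne.symm hh'.1))
      rw [Finset.card_erase_of_mem hh, Finset.card_range, nsmul_eq_mul,
        Nat.cast_sub hH, Nat.cast_one] at this
      exact this
    have h2 := Complex.abs_re_le_norm (∑ h' ∈ (Finset.range H).erase h, V h h')
    have h3 := neg_abs_le (∑ h' ∈ (Finset.range H).erase h, V h h').re
    linarith
  have hre := congrArg Complex.re htot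
  rw [Complex.ofReal_re, Complex.re_sum] at hre
  have hlow := Finset.card_nsmul_le_sum (Finset.range H) _ _ hrow
  rw [Finset.card_range, nsmul_eq_mul, ← hre] at hlow
  have hup : ∑ w, ‖∑ h ∈ Finset.range H, z w ^ h‖ ^ 2 ≤ L * (H / 4) := by
    have := Finset.sum_le_card_nsmul Finset.univ _ _ (fun w _ => hs w)
    rwa [nsmul_eq_mul, Finset.card_univ] at this
  have e : (H : ℝ) * (L - (H - 1) * (3 / 4 * L / H)) = H * L - (H - 1) * (3 / 4 * L) := by
    field_simp
  rw [e] at hlow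
  nlinarith

/-- Mean square of an exponential sum over a progression. -/
theorem sum_normSq_le {ι : Type*} [Fintype ι] [DecidableEq ι] (A σ : ι → ℝ) (N : ℕ) {ε : ℝ}
    (hε : 0 ≤ ε)
    (hdec : ∀ w v, w ≠ v → ‖∑ i ∈ Finset.range N, ee (σ w - σ v) ^ i‖ ≤ ε * N) :
    ∑ i ∈ Finset.range N, ‖∑ w, ee (A w + σ w * i)‖ ^ 2 ≤
      N * ((Fintype.card ι : ℝ) + (Fintype.card ι : ℝ) ^ 2 * ε) := by
  set L := (Fintype.card ι : ℝ)
  have h1 : ((∑ i ∈ Finset.range N, ‖∑ w, ee (A w + σ w * i)‖ ^ 2 : ℝ) : ℂ) =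
      ∑ w, ∑ v, ee (A w - A v) * ∑ i ∈ Finset.range N, ee (σ w - σ v) ^ i := by
    rw [Complex.ofReal_sum]
    simp_rw [ofReal_normSq_sum]
    rw [Finset.sum_comm]
    apply Finset.sum_congr rfl
    intro w _
    rw [Finset.sum_comm]
    apply Finset.sum_congr rfl
    intro v _
    rw [Finset.mul_sum]
    apply Finset.sum_congr rfl
    intro i _
    rw [conj_ee, ← ee_add, ← ee_nat_mul, ← ee_add]
    congr 1
    ring
  have h2 : ∀ w, ‖∑ v, ee (A w - A v) * ∑ i ∈ Finset.range N, ee (σ w - σ v) ^ i‖ ≤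
      N + L * (ε * N) := by
    intro w
    refine (norm_sum_le _ _).trans ?_
    rw [← Finset.add_sum_erase _ _ (Finset.mem_univ w)]
    apply add_le_add
    · rw [norm_mul, norm_ee, one_mul]
      refine (norm_sum_le _ _).trans ?_
      simp [norm_ee]
    · refine (Finset.sum_le_card_nsmul (Finset.univ.erase w) _ (ε * N) ?_).trans ?_
      · intro v hv
        rw [norm_mul, norm_ee, one_mul]
        exact hdec w v (Ne.symm (Finset.ne_of_mem_erase hv))
      · rw [nsmul_eq_mul]
        have : ((Finset.univ.erase w).card : ℝ) ≤ L :=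
          Nat.cast_le.mpr (Finset.card_le_univ (Finset.univ.erase w))
        gcongr
  have h3 : ∑ i ∈ Finset.range N, ‖∑ w, ee (A w + σ w * i)‖ ^ 2 ≤
      ∑ w : ι, ((N : ℝ) + L * (ε * N)) := by
    rw [← Complex.ofReal_re (∑ i ∈ Finset.range N, ‖∑ w, ee (A w + σ w * i)‖ ^ 2), h1]
    refine (Complex.re_le_norm _).trans ((norm_sum_le _ _).trans ?_)
    exact Finset.sum_le_sum fun w _ => h2 w
  refine h3.trans (le_of_eq ?_)
  rw [Finset.sum_const, Finset.card_univ, nsmul_eq_mul]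
  ring

theorem exists_hit {ι : Type*} [Fintype ι] [DecidableEq ι] (A σ : ι → ℝ) (N : ℕ)
    (E : Finset ℕ) (hE : E ⊆ Finset.range N) (H : ℕ) (hH : 0 < H) {η ε : ℝ} (hη : 0 < η)
    (hε : 0 ≤ ε) (hHη : 1 ≤ H * η ^ 2) [Nonempty ι]
    (hdec : ∀ w v, w ≠ v → ∀ h : ℕ, 1 ≤ h → h < H →
      ‖∑ i ∈ Finset.range N, ee (h * (σ w - σ v)) ^ i‖ ≤ ε * N)
    (hcard : 2 * (H : ℝ) ^ 3 * N * (1 / Fintype.card ι + ε) < E.card) :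
    ∃ i ∈ E, ∃ w, ∃ a : ℤ, |A w + σ w * i - a| < η := by
  by_contra! hcon
  have hL : (0 : ℝ) < Fintype.card ι := by exact_mod_cast Fintype.card_pos
  have hH0 : (0 : ℝ) < H := by exact_mod_cast hH
  set L := (Fintype.card ι : ℝ)
  have hlow : ∀ i ∈ E, 9 / 16 * L ^ 2 / H ^ 2 ≤
      ∑ d ∈ Finset.Ico 1 H, ‖∑ w, ee (d * A w + d * σ w * i)‖ ^ 2 := by
    intro i hi
    obtain ⟨d, hd1, hd2, hd3⟩ := exists_large_powerSum (fun w => ee (A w + σ w * i))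
      (fun w => norm_ee _) hH (fun w => by
        have h1 := norm_geom_ee_le hη (hcon i hi w) H
        calc _ ≤ (1 / (2 * η)) ^ 2 := by gcongr
          _ = 1 / (4 * η ^ 2) := by field_simp; norm_num
          _ ≤ H / 4 := by
            rw [div_le_div_iff₀ (by positivity) (by norm_num)]
            linarith)
    have e : ∀ w, ee (d * A w + d * σ w * i) = ee (A w + σ w * i) ^ d := by
      intro w
      rw [← ee_nat_mul]
      congr 1
      ring
    calc 9 / 16 * L ^ 2 / H ^ 2 = (3 / 4 * L / H) ^ 2 := by field_simp; norm_num
      _ ≤ ‖∑ w, ee (d * A w + d * σ w * i)‖ ^ 2 := by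
        simp_rw [e]
        gcongr
      _ ≤ _ := Finset.single_le_sum (f := fun d : ℕ => ‖∑ w, ee (d * A w + d * σ w * i)‖ ^ 2)
        (fun _ _ => by positivity) (Finset.mem_Ico.mpr ⟨hd1, hd2⟩)
  have h1 := Finset.card_nsmul_le_sum E _ _ hlow
  rw [nsmul_eq_mul, Finset.sum_comm] at h1
  have h2 : ∑ d ∈ Finset.Ico 1 H, ∑ i ∈ E, ‖∑ w, ee (d * A w + d * σ w * i)‖ ^ 2 ≤
      H * (N * (L + L ^ 2 * ε)) := by
    refine (Finset.sum_le_card_nsmul _ _ (N * (L + L ^ 2 * ε)) ?_).trans ?_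
    · intro d hd
      rw [Finset.mem_Ico] at hd
      refine (Finset.sum_le_sum_of_subset_of_nonneg hE fun _ _ _ => by positivity).trans ?_
      apply sum_normSq_le (fun w => d * A w) (fun w => d * σ w) N hε
      intro w v hwv
      have := hdec w v hwv d hd.1 hd.2
      rwa [mul_sub] at this
    · rw [nsmul_eq_mul]
      gcongr
      rw [Nat.card_Ico]
      omega
  have h3 := h1.trans h2
  have e1 : (E.card : ℝ) * (9 / 16 * L ^ 2 / H ^ 2) = E.card * (9 / 16) * (L ^ 2 / H ^ 2) := by ring
  have e2 : (H : ℝ) * (N * (L + L ^ 2 * ε)) =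
      H ^ 3 * N * (1 / L + ε) * (L ^ 2 / H ^ 2) := by field_simp
  rw [e1, e2] at h3
  have h4 := le_of_mul_le_mul_right h3 (by positivity)
  have h5 : 0 ≤ (H : ℝ) ^ 3 * N * (1 / L + ε) := by positivity
  linarith

theorem Mob.abs_app_sub_le {M : Mob} (hQ : 0 < M.Q) (hQ' : 0 < M.Q') (hdet : M.det = 1) {x : ℝ}
    (h1 : M.P ≤ x * M.Q) (h2 : x * M.Q' < M.P') {z : ℝ} (hz : 0 ≤ z) :
    |M.app z - x| ≤ 1 / (M.Q * M.Q') := by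
  have hQ0 : (0 : ℝ) < M.Q := by exact_mod_cast hQ
  have hQ0' : (0 : ℝ) < M.Q' := by exact_mod_cast hQ'
  have hd : (M.P' : ℝ) * M.Q - M.P * M.Q' = 1 := by
    have : ((M.P' * M.Q - M.P * M.Q' : ℤ) : ℝ) = 1 := by
      rw [show M.P' * M.Q - M.P * M.Q' = 1 from hdet]; simp
    push_cast at this
    exact this
  have hD : 0 < M.den z := Mob.den_pos hQ hQ' hz
  have e1 : M.app z - M.P / M.Q = z / (M.Q * M.den z) := by
    have h3 := Mob.app_sub_app hQ hQ' hz le_rfl (M := M)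
    rw [hdet] at h3
    simp only [Mob.app, Mob.den] at h3 ⊢
    simp only [mul_zero, add_zero, Int.cast_one, one_mul, sub_zero] at h3
    rw [h3, mul_comm]
  have e2 : z / (M.Q * M.den z) ≤ 1 / (M.Q * M.Q') := by
    rw [div_le_div_iff₀ (by positivity) (by positivity), Mob.den]
    nlinarith
  have e3 : 0 ≤ z / (M.Q * M.den z) := by positivity
  have e4 : (M.P : ℝ) / M.Q ≤ x := by rw [div_le_iff₀ hQ0]; exact h1
  have e5 : x - M.P / M.Q ≤ 1 / (M.Q * M.Q') := by
    rw [sub_le_iff_le_add, div_add_div _ _ (by positivity) (by positivity),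
      le_div_iff₀ (by positivity)]
    have h3 : x * M.Q' * M.Q ≤ 1 + M.P * M.Q' := by nlinarith
    nlinarith [mul_le_mul_of_nonneg_right h3 hQ0.le]
  rw [abs_le]
  constructor <;> linarith

set_option maxHeartbeats 1000000 in
theorem exists_base {k : ℕ} (hk : 10 ≤ k) {t : ℕ} {i : ℤ}
    (H : HomCell k 4 (1 / (k : ℝ) ^ 20) 0 t i) :
    ∃ M : Mob, 0 < M.Q' ∧ M.Q' ≤ M.Q ∧ |M.det| = 1 ∧ 2 * (k : ℝ) ^ (t + 6) < M.Q ∧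
      (M.Q : ℝ) ≤ 4 * (k : ℝ) ^ (t + 16) ∧
      (∀ y : ℝ, 0 ≤ y → y ≤ 1 → M.app y ∈ cell ((k : ℝ) ^ (2 * t)) i) ∧
      (∀ y : ℝ, 0 ≤ y → y ≤ 1 → ∀ m : ℕ, 0 < m → 4 * (m : ℤ) < M.Q → ∀ a : ℤ,
        1 / (k : ℝ) ^ 20 ≤ m * |m * M.app y - a|) := by
  have hk10 : (10 : ℝ) ≤ k := by exact_mod_cast hk
  have hk0 : (0 : ℝ) < k := by linarith
  have hk1 : (1 : ℝ) ≤ k := by linarith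
  -- a point well inside the cell
  have H0 : HomCell k 4 (1 / (k : ℝ) ^ (2 * 4 + 2)) ((k : ℝ) ^ t / k ^ 4) t i :=
    fun β _ m hm hm' => absurd hm' (not_le.mpr hm)
  obtain ⟨S, hS, hS'⟩ := homChildren (by omega : 3 ≤ k) (by norm_num : 2 ≤ 4) le_rfl H0
  have hk2 : 100 ≤ k ^ 2 := by nlinarith
  obtain ⟨d, hdS, hd⟩ : ∃ d ∈ S, d ∉ ({0, k ^ 2 - 1} : Finset ℕ) := by
    apply Finset.exists_mem_notMem_of_card_lt_card
    have := Finset.card_le_two (a := 0) (b := k ^ 2 - 1)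
    omega
  obtain ⟨hdk, Hd⟩ := hS' d hdS
  obtain ⟨j, Hj, hjsub⟩ := Hd.exists_descend (by omega : 3 ≤ k) (by norm_num) le_rfl 9
  have hd1 : 1 ≤ d ∧ d + 2 ≤ k ^ 2 := by
    simp at hd
    omega
  obtain ⟨x, hx⟩ : ∃ x, x ∈ cell ((k : ℝ) ^ (2 * (t + 1 + 9))) j := ⟨_, left_mem_cell (by positivity) j⟩
  have hx1 := hjsub hx
  have hxI : x ∈ cell ((k : ℝ) ^ (2 * t)) i := cell_child_subset (by omega) (2 * t) 2 i hdk hx1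
  have hN : (k : ℝ) ^ (t + 1 + 9) / k ^ 4 = k ^ (t + 6) := by field_simp; ring
  have hbd : ∀ m : ℕ, 0 < m → (m : ℝ) ≤ (k : ℝ) ^ (t + 6) → ∀ a : ℤ,
      1 ≤ (k : ℝ) ^ (t + 16) * |m * x - a| := by
    intro m hm hm' a
    have hm0 : (0 : ℝ) < m := by exact_mod_cast hm
    by_cases hmt : (m : ℝ) ≤ (k : ℝ) ^ t / k ^ 4
    · have h1 := H x hxI m hm0 hmt a
      rw [div_le_iff₀ (by positivity)] at h1
      refine h1.trans ?_
      rw [mul_right_comm]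
      gcongr
      rw [le_div_iff₀ (by positivity)] at hmt
      calc (m : ℝ) * (k : ℝ) ^ 20 = m * (k : ℝ) ^ 4 * (k : ℝ) ^ 16 := by ring
        _ ≤ (k : ℝ) ^ t * (k : ℝ) ^ 16 := by gcongr
        _ = _ := by ring
    · have h1 := Hj x hx m (not_le.mp hmt) (by rw [hN]; exact hm') a
      rw [div_le_iff₀ (by positivity)] at h1
      refine h1.trans ?_
      rw [mul_right_comm]
      gcongr
      calc (m : ℝ) * k ^ (2 * 4 + 2) ≤ k ^ (t + 6) * k ^ (2 * 4 + 2) := by gcongr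
        _ = _ := by ring
  -- Farey neighbours of that point
  obtain ⟨M0, hQ, hQ', hQF, hQF', hF, hdet, hP, hP'⟩ :=
    exists_farey x (2 * k ^ (t + 16)) (by
      have := Nat.pow_pos (n := t + 16) (by omega : 0 < k)
      omega)
  have hQ0 : (0 : ℝ) < M0.Q := by exact_mod_cast hQ
  have hQ0' : (0 : ℝ) < M0.Q' := by exact_mod_cast hQ'
  have hFr : 2 * (k : ℝ) ^ (t + 16) < M0.Q + M0.Q' := by exact_mod_cast hF
  have hQFr : (M0.Q : ℝ) ≤ 2 * (k : ℝ) ^ (t + 16) := by exact_mod_cast hQF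
  have hQFr' : (M0.Q' : ℝ) ≤ 2 * (k : ℝ) ^ (t + 16) := by exact_mod_cast hQF'
  have hd : (M0.P' : ℝ) * M0.Q - M0.P * M0.Q' = 1 := by
    have : ((M0.P' * M0.Q - M0.P * M0.Q' : ℤ) : ℝ) = 1 := by
      rw [show M0.P' * M0.Q - M0.P * M0.Q' = 1 from hdet]; simp
    push_cast at this
    exact this
  have hpow : (k : ℝ) ^ (t + 6) ≤ k ^ (t + 16) := pow_le_pow_right₀ hk1 (by omega)
  have hpow0 : (0 : ℝ) < (k : ℝ) ^ (t + 16) := by positivity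
  have hQT : (k : ℝ) ^ (t + 6) < M0.Q := by
    by_contra! hle
    have hn : ((M0.Q.natAbs : ℕ) : ℝ) = M0.Q := by
      rw [Nat.cast_natAbs, abs_of_pos hQ]
    have h1 := hbd M0.Q.natAbs (Int.natAbs_pos.mpr hQ.ne') (by rw [hn]; exact hle) M0.P
    rw [hn, abs_of_nonneg (by linarith)] at h1
    have h2 : (M0.Q * x - M0.P) * M0.Q' ≤ 1 := by nlinarith
    have h3 : (M0.Q' : ℝ) ≤ k ^ (t + 16) := by nlinarith
    linarith
  have hQT' : (k : ℝ) ^ (t + 6) < M0.Q' := by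
    by_contra! hle
    have hn : ((M0.Q'.natAbs : ℕ) : ℝ) = M0.Q' := by
      rw [Nat.cast_natAbs, abs_of_pos hQ']
    have h1 := hbd M0.Q'.natAbs (Int.natAbs_pos.mpr hQ'.ne') (by rw [hn]; exact hle) M0.P'
    rw [hn, abs_of_neg (by linarith)] at h1
    have h2 : -(M0.Q' * x - M0.P') * M0.Q ≤ 1 := by nlinarith
    have h3 : (M0.Q : ℝ) ≤ k ^ (t + 16) := by nlinarith
    linarith
  have hclose : ∀ z : ℝ, 0 ≤ z → |M0.app z - x| ≤ 1 / (k : ℝ) ^ (2 * t + 12) := by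
    intro z hz
    refine (Mob.abs_app_sub_le hQ hQ' hdet hP hP' hz).trans ?_
    apply one_div_le_one_div_of_le (by positivity)
    calc (k : ℝ) ^ (2 * t + 12) = k ^ (t + 6) * k ^ (t + 6) := by ring
      _ ≤ _ := by gcongr
  have happ : ∀ y : ℝ, 0 ≤ y → (M0.child 1).app y = M0.app (1 / (1 + y)) := by
    intro y hy
    have := Mob.app_child hQ hQ' one_pos hy
    simpa using this
  have hyy : ∀ y : ℝ, 0 ≤ y → y ≤ 1 → 1 / 2 ≤ 1 / (1 + y) ∧ 1 / (1 + y) ≤ 1 := by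
    intro y hy hy1
    constructor
    · apply one_div_le_one_div_of_le <;> linarith
    · rw [div_le_one (by linarith)]; linarith
  have hmem : ∀ y : ℝ, 0 ≤ y → y ≤ 1 → (M0.child 1).app y ∈ cell ((k : ℝ) ^ (2 * t)) i := by
    intro y hy hy1
    rw [happ y hy]
    have h1 := hclose (1 / (1 + y)) (by positivity)
    have h2 : 1 / (k : ℝ) ^ (2 * t + 12) ≤ 1 / (k : ℝ) ^ (2 * (t + 1)) := by
      apply one_div_le_one_div_of_le (by positivity)
      exact pow_le_pow_right₀ hk1 (by omega)
    have h3 := abs_le.mp (h1.trans h2)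
    obtain ⟨l1, l2⟩ := hx1
    push_cast at l1 l2
    have hB : (0 : ℝ) < (k : ℝ) ^ (2 * (t + 1)) := by positivity
    have hd2 : (1 : ℝ) ≤ d := by exact_mod_cast hd1.1
    have hd3 : (d : ℝ) + 2 ≤ k ^ 2 := by exact_mod_cast hd1.2
    have e1 : (i : ℝ) / k ^ (2 * t) = k ^ 2 * i / k ^ (2 * (t + 1)) := by field_simp; ring
    have e2 : ((i : ℝ) + 1) / k ^ (2 * t) = (k ^ 2 * i + k ^ 2) / k ^ (2 * (t + 1)) := by
      field_simp; ring
    constructor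
    · rw [e1]
      have : (k : ℝ) ^ 2 * i / k ^ (2 * (t + 1)) ≤
          (k ^ 2 * i + d) / k ^ (2 * (t + 1)) - 1 / k ^ (2 * (t + 1)) := by
        rw [← sub_div]
        apply div_le_div_of_nonneg_right _ hB.le
        linarith
      linarith
    · rw [e2]
      have : ((k : ℝ) ^ 2 * i + d + 1) / k ^ (2 * (t + 1)) + 1 / k ^ (2 * (t + 1)) ≤
          (k ^ 2 * i + k ^ 2) / k ^ (2 * (t + 1)) := by
        rw [← add_div]
        apply div_le_div_of_nonneg_right _ hB.le
        linarith
      linarith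
  refine ⟨M0.child 1, hQ, ?_, ?_, ?_, ?_, hmem, ?_⟩
  · simp only [Mob.child]; linarith
  · rw [Mob.det_child, hdet]; simp
  · simp only [Mob.child]; push_cast; linarith
  · simp only [Mob.child]; push_cast; linarith
  · intro y hy hy1 m hm hmQ a
    have hm0 : (0 : ℝ) < m := by exact_mod_cast hm
    have hm1 : (1 : ℝ) ≤ m := by exact_mod_cast hm
    by_cases hmt : (m : ℝ) ≤ (k : ℝ) ^ t / k ^ 4
    · exact H _ (hmem y hy hy1) m hm0 hmt a
    rw [happ y hy]
    by_cases hmt2 : (m : ℝ) ≤ (k : ℝ) ^ t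
    · have h1 := Hj x hx m (not_le.mp hmt)
        (by rw [hN]; exact hmt2.trans (pow_le_pow_right₀ hk1 (by omega))) a
      have h2 := hclose (1 / (1 + y)) (by positivity)
      set z := M0.app (1 / (1 + y))
      have h3 : (m : ℝ) * |m * x - a| ≤ m * |m * z - a| + m * m * |z - x| := by
        have : |(m : ℝ) * x - a| ≤ |m * z - a| + m * |z - x| := by
          rw [show (m : ℝ) * x - a = (m * z - a) - m * (z - x) by ring]
          refine (abs_sub _ _).trans ?_
          rw [abs_mul, abs_of_pos hm0]
        nlinarith
      have h4 : (m : ℝ) * m * |z - x| ≤ 1 / k ^ 12 := by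
        calc (m : ℝ) * m * |z - x| ≤ k ^ t * k ^ t * (1 / (k : ℝ) ^ (2 * t + 12)) := by gcongr
          _ = _ := by field_simp; ring
      have h5 : 1 / (k : ℝ) ^ 20 + 1 / k ^ 12 ≤ 1 / k ^ (2 * 4 + 2) := by
        have e1 : 1 / (k : ℝ) ^ 20 ≤ 1 / k ^ 12 := by
          apply one_div_le_one_div_of_le (by positivity)
          exact pow_le_pow_right₀ hk1 (by omega)
        have e2 : 1 / (k : ℝ) ^ (2 * 4 + 2) = k ^ 2 * (1 / k ^ 12) := by field_simp
        have e3 : 0 < 1 / (k : ℝ) ^ 12 := by positivity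
        have e4 : (2 : ℝ) ≤ (k : ℝ) ^ 2 := by nlinarith
        have e5 := mul_le_mul_of_nonneg_right e4 e3.le
        rw [e2]
        linarith
      linarith
    · have h1 := Mob.le_abs_mul_app_sub hQ hQ' (by rw [hdet]; simp) (by positivity)
        (hyy y hy hy1).2 hm (by simp only [Mob.child] at hmQ; linarith) a
      calc 1 / (k : ℝ) ^ 20 ≤ k ^ t * ((1 / 2) / (4 * k ^ (t + 16))) := by
            have : (k : ℝ) ^ t * ((1 / 2) / (4 * k ^ (t + 16))) = 1 / (8 * k ^ 16) := by
              rw [pow_add]; field_simp; norm_num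
            rw [this]
            apply one_div_le_one_div_of_le (by positivity)
            calc 8 * (k : ℝ) ^ 16 ≤ k * (k : ℝ) ^ 16 := by gcongr; linarith
              _ = (k : ℝ) ^ 17 := by ring
              _ ≤ (k : ℝ) ^ 20 := pow_le_pow_right₀ hk1 (by omega)
        _ ≤ m * ((1 / (1 + y)) / (M0.Q + M0.Q')) := by
            have := (hyy y hy hy1).1
            have := not_le.mp hmt2
            gcongr
            linarith
        _ ≤ _ := by gcongr

theorem Mob.linearize {M : Mob} (hQ' : 0 < M.Q') (hQQ : M.Q' ≤ M.Q) (hdet : |M.det| = 1)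
    {y y₀ : ℝ} (hy : 0 ≤ y) (hy₀ : 0 ≤ y₀) (w : ℝ) :
    |M.app y - M.app y₀ - M.det * (w - y₀) / M.den y₀ ^ 2| ≤
      ((y - y₀) ^ 2 + |y - w|) / (M.Q : ℝ) ^ 2 := by
  have hQ : 0 < M.Q := hQ'.trans_le hQQ
  have hQ0 : (0 : ℝ) < M.Q := by exact_mod_cast hQ
  have hQ0' : (0 : ℝ) < M.Q' := by exact_mod_cast hQ'
  have hQQ' : (M.Q' : ℝ) ≤ M.Q := by exact_mod_cast hQQ
  have hD := Mob.den_ge hQ' hy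
  have hD₀ := Mob.den_ge hQ' hy₀
  have hDp := Mob.den_pos hQ hQ' hy
  have hDp₀ := Mob.den_pos hQ hQ' hy₀
  rw [Mob.app_sub_app hQ hQ' hy hy₀]
  have hd : |(M.det : ℝ)| = 1 := by
    have : ((|M.det| : ℤ) : ℝ) = 1 := by rw [hdet]; simp
    rwa [Int.cast_abs] at this
  have hdd : M.den y = M.den y₀ + M.Q' * (y - y₀) := by simp only [Mob.den]; ring
  have e : M.det * (y - y₀) / (M.den y * M.den y₀) - M.det * (w - y₀) / M.den y₀ ^ 2 =
      M.det * (-(M.Q' * (y - y₀) ^ 2 / (M.den y * M.den y₀ ^ 2)) + (y - w) / M.den y₀ ^ 2) := by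
    field_simp
    rw [hdd]
    ring
  rw [e, abs_mul, hd, one_mul, add_div]
  refine (abs_add_le _ _).trans ?_
  rw [abs_neg, abs_div, abs_div, abs_of_pos (by positivity : 0 < M.den y * M.den y₀ ^ 2),
    abs_of_pos (by positivity : 0 < M.den y₀ ^ 2), abs_of_nonneg (by positivity :
      0 ≤ (M.Q' : ℝ) * (y - y₀) ^ 2)]
  apply add_le_add
  · rw [div_le_div_iff₀ (by positivity) (by positivity)]
    calc (M.Q' : ℝ) * (y - y₀) ^ 2 * M.Q ^ 2 ≤ M.den y * (y - y₀) ^ 2 * M.den y₀ ^ 2 := by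
          gcongr
          linarith
      _ = _ := by ring
  · gcongr

theorem exists_unspoiled {ι : Type*} [Fintype ι] [DecidableEq ι] (A B : ι → ℝ) {μ : ℝ}
    (hμ : 0 < μ) (hsep : ∀ i j, i ≠ j → μ ≤ |A i - A j| + |B i - B j|) {N : ℝ} (hN : 1 ≤ N)
    (S : Finset ℕ) (hS : 4 * Fintype.card ι ^ 2 < S.card) :
    ∃ d ∈ S, ∀ y ∈ cell N d, 0 ≤ y → y ≤ 1 → ∀ i j, i ≠ j →
      μ / (8 * N) ≤ |(A i + B i * y) - (A j + B j * y)| := by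
  have hN0 : 0 < N := by linarith
  have key : ∀ p : ι × ι, ∃ T : Finset ℤ, T.card ≤ 4 ∧ (p.1 ≠ p.2 → ∀ d : ℤ, d ∉ T →
      ∀ y ∈ cell N d, 0 ≤ y → y ≤ 1 →
        μ / (8 * N) ≤ |(A p.1 + B p.1 * y) - (A p.2 + B p.2 * y)|) := by
    rintro ⟨i, j⟩
    by_cases hij : i = j
    · exact ⟨∅, by simp, fun h => absurd hij h⟩
    by_cases hbad : ∃ y₀ : ℝ, 0 ≤ y₀ ∧ y₀ ≤ 1 ∧
        |(A i + B i * y₀) - (A j + B j * y₀)| < μ / (8 * N)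
    · obtain ⟨y₀, h0, h1, hlt⟩ := hbad
      obtain ⟨T, hT, hTj⟩ := exists_finset_cells_near hN0 y₀ 1
      refine ⟨T, by simpa using hT, fun _ d hd y hy hy0 hy1 => ?_⟩
      by_contra! hlt'
      apply hd
      apply hTj
      refine ⟨y, hy, ?_⟩
      have hs := hsep i j hij
      simp only at hlt'
      set a := A i - A j
      set b := B i - B j
      have e0 : (A i + B i * y₀) - (A j + B j * y₀) = a + b * y₀ := by simp only [a, b]; ring
      have e1 : (A i + B i * y) - (A j + B j * y) = a + b * y := by simp only [a, b]; ring
      rw [e0] at hlt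
      rw [e1] at hlt'
      have hsm : μ / (8 * N) ≤ μ / 8 := by
        apply div_le_div_of_nonneg_left hμ.le (by norm_num)
        linarith
      have hb : μ / 4 ≤ |b| := by
        by_contra! hb
        have h2 : |a| ≤ |a + b * y₀| + |b * y₀| := by
          have := abs_sub (a + b * y₀) (b * y₀)
          rwa [add_sub_cancel_right] at this
        have h3 : |b * y₀| ≤ |b| := by
          rw [abs_mul, abs_of_nonneg h0]
          exact mul_le_of_le_one_right (abs_nonneg _) h1
        linarith
      have h4 : |b| * |y - y₀| ≤ 2 * (μ / (8 * N)) := by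
        rw [← abs_mul, show b * (y - y₀) = (a + b * y) - (a + b * y₀) by ring]
        refine (abs_sub _ _).trans ?_
        linarith
      have h5 : μ / 4 * |y - y₀| ≤ μ / 4 * (1 / N) := by
        calc μ / 4 * |y - y₀| ≤ |b| * |y - y₀| := by gcongr
          _ ≤ 2 * (μ / (8 * N)) := h4
          _ = μ / 4 * (1 / N) := by field_simp; norm_num
      have h6 := le_of_mul_le_mul_left h5 (by positivity)
      simpa using h6
    · push Not at hbad
      exact ⟨∅, by simp, fun _ d _ y _ hy0 hy1 => hbad y hy0 hy1⟩
  choose T hT hT' using key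
  let U : Finset ℤ := Finset.univ.biUnion T
  have hU : U.card ≤ 4 * Fintype.card ι ^ 2 := by
    refine Finset.card_biUnion_le.trans ?_
    refine (Finset.sum_le_card_nsmul _ _ 4 fun p _ => hT p).trans (le_of_eq ?_)
    rw [Finset.card_univ, Fintype.card_prod, smul_eq_mul]
    ring
  obtain ⟨d, hdS, hd⟩ : ∃ d ∈ S, (d : ℤ) ∉ U := by
    by_contra! hcon
    have : (S.image fun d : ℕ => (d : ℤ)).card ≤ U.card := by
      apply Finset.card_le_card
      intro x hx
      obtain ⟨d, hd, rfl⟩ := Finset.mem_image.mp hx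
      exact hcon d hd
    rw [Finset.card_image_of_injective _ Nat.cast_injective] at this
    omega
  refine ⟨d, hdS, fun y hy hy0 hy1 i j hij => hT' (i, j) hij d ?_ y hy hy0 hy1⟩
  intro h
  exact hd (Finset.mem_biUnion.mpr ⟨(i, j), Finset.mem_univ _, h⟩)

/-- Separation of the coefficients from separation of their ratios. -/
theorem coeff_sep {Q Q' R R' Q₀ ρ : ℝ} (hQ₀ : 0 < Q₀) (hQ : Q₀ ≤ Q) (hR : Q₀ ≤ R)
    (hR' : 0 ≤ R') (hRR : R' ≤ R) (h : ρ ≤ |Q' / Q - R' / R|) (hρ : 0 ≤ ρ) :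
    Q₀ * ρ ≤ |Q - R| + |Q' - R'| := by
  have hQ0 : 0 < Q := by linarith
  have hR0 : 0 < R := by linarith
  have e : Q' / Q - R' / R = ((Q' - R') * R - R' * (Q - R)) / (Q * R) := by
    field_simp
    ring
  rw [e, abs_div, abs_of_pos (by positivity : 0 < Q * R), le_div_iff₀ (by positivity)] at h
  have h1 : |(Q' - R') * R - R' * (Q - R)| ≤ |Q' - R'| * R + R * |Q - R| := by
    refine (abs_sub _ _).trans ?_
    rw [abs_mul, abs_mul, abs_of_pos hR0, abs_of_nonneg hR']
    gcongr
  have h2 : (Q * ρ) * R ≤ (|Q - R| + |Q' - R'|) * R := by nlinarith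
  have h3 := le_of_mul_le_mul_right h2 hR0
  nlinarith

/-- Separation of `1 / D ^ 2`. -/
theorem inv_sq_sep {D E Q₀ κ U : ℝ} (hQ₀ : 0 < Q₀) (hD : Q₀ ≤ D) (hE : Q₀ ≤ E) (hDU : D ≤ U)
    (hEU : E ≤ U) (h : κ ≤ |D - E|) (hκ : 0 ≤ κ) :
    2 * Q₀ * κ / U ^ 4 ≤ |1 / D ^ 2 - 1 / E ^ 2| := by
  have hD0 : 0 < D := by linarith
  have hE0 : 0 < E := by linarith
  have hU0 : 0 < U := by linarith
  have e : 1 / D ^ 2 - 1 / E ^ 2 = -((D - E) * (D + E)) / (D ^ 2 * E ^ 2) := by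
    field_simp
    ring
  rw [e, abs_div, abs_neg, abs_mul, abs_of_pos (by positivity : 0 < D + E),
    abs_of_pos (by positivity : 0 < D ^ 2 * E ^ 2)]
  have h1 : D ^ 2 * E ^ 2 ≤ U ^ 4 := by
    calc D ^ 2 * E ^ 2 ≤ U ^ 2 * U ^ 2 := by gcongr
      _ = U ^ 4 := by ring
  have h2 : 2 * Q₀ * κ ≤ |D - E| * (D + E) := by nlinarith
  gcongr

theorem Mob.continuousOn_app {M : Mob} (hQ : 0 < M.Q) (hQ' : 0 < M.Q') :
    ContinuousOn M.app (Set.Ici 0) := by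
  have : ∀ y ∈ Set.Ici (0 : ℝ), (M.Q : ℝ) + M.Q' * y ≠ 0 := fun y hy =>
    (Mob.den_pos hQ hQ' hy).ne'
  exact ContinuousOn.div (by fun_prop)
    (by show ContinuousOn (fun y : ℝ => (M.Q : ℝ) + M.Q' * y) _; fun_prop) this

theorem exists_cell_in_image {k : ℕ} (hk : 32 ≤ k) {r : ℕ} (hr : 2 ≤ r) {M : Mob}
    (hQ' : 0 < M.Q') (hQQ : M.Q' ≤ M.Q) (hdet : |M.det| = 1) {e : ℤ}
    (hcell : cell ((k : ℝ) ^ (2 * r)) e ⊆ Set.Icc 0 1)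
    (HY : HomCell k 2 (1 / (k : ℝ) ^ 6) 0 r e)
    (hsmall : ∀ y : ℝ, 0 ≤ y → y ≤ 1 → ∀ m : ℕ, 0 < m → 4 * (m : ℤ) < M.Q → ∀ a : ℤ,
        1 / (k : ℝ) ^ 20 ≤ m * |m * M.app y - a|)
    {T : ℕ} (hT : k * (3 * (k : ℝ) ^ r * M.Q) ≤ (k : ℝ) ^ T) :
    ∃ j, HomCell k 4 (1 / (k : ℝ) ^ 20) 0 T j ∧
      ∀ β ∈ cell ((k : ℝ) ^ (2 * T)) j, ∃ y ∈ cell ((k : ℝ) ^ (2 * r)) e, M.app y = β := by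
  have hQ : 0 < M.Q := hQ'.trans_le hQQ
  have hk32 : (32 : ℝ) ≤ k := by exact_mod_cast hk
  have hk0 : (0 : ℝ) < k := by linarith
  have hk1 : (1 : ℝ) < k := by linarith
  have hQ0 : (0 : ℝ) < M.Q := by exact_mod_cast hQ
  have hQ1 : (1 : ℝ) ≤ M.Q := by exact_mod_cast hQ
  have hQ0' : (0 : ℝ) < M.Q' := by exact_mod_cast hQ'
  have hQQ' : (M.Q' : ℝ) ≤ M.Q := by exact_mod_cast hQQ
  have hd : |(M.det : ℝ)| = 1 := by
    have : ((|M.det| : ℤ) : ℝ) = 1 := by rw [hdet]; simp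
    rwa [Int.cast_abs] at this
  have hkr : (0 : ℝ) < (k : ℝ) ^ r := by positivity
  have hkr1 : (1 : ℝ) ≤ (k : ℝ) ^ r := one_le_pow₀ hk1.le
  obtain ⟨p, hp1, hp2⟩ := exists_nat_pow_near (by nlinarith : 1 ≤ 3 * (k : ℝ) ^ r * M.Q) hk1
  have hpT : p + 1 ≤ T := by
    rw [← pow_le_pow_iff_right₀ hk1]
    calc (k : ℝ) ^ (p + 1) = k * (k : ℝ) ^ p := by ring
      _ ≤ k * (3 * (k : ℝ) ^ r * M.Q) := by gcongr
      _ ≤ _ := hT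
  set B := (k : ℝ) ^ (2 * r) with hB
  have hB0 : 0 < B := by positivity
  have hlo := left_mem_cell hB0 e
  have hhi := right_mem_cell hB0 e
  set lo := (e : ℝ) / B
  set hi := ((e : ℝ) + 1) / B
  have hlh : hi - lo = 1 / B := by simp only [lo, hi]; rw [← sub_div]; ring_nf
  have hlo0 := hcell hlo
  have hhi0 := hcell hhi
  have hD1 := Mob.den_pos hQ hQ' hhi0.1
  have hD2 := Mob.den_pos hQ hQ' hlo0.1
  have hD3 : M.den hi ≤ 2 * M.Q := (Mob.den_le hQ' hhi0.2).trans (by linarith)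
  have hD4 : M.den lo ≤ 2 * M.Q := (Mob.den_le hQ' hlo0.2).trans (by linarith)
  have hlen : 2 / (k : ℝ) ^ (2 * (p + 1)) ≤ max (M.app lo) (M.app hi) - min (M.app lo) (M.app hi) := by
    rw [max_sub_min_eq_abs, Mob.app_sub_app hQ hQ' hhi0.1 hlo0.1, hlh, abs_div, abs_mul, hd,
      abs_of_pos (by positivity : 0 < 1 / B), abs_of_pos (by positivity : 0 < M.den hi * M.den lo)]
    rw [one_mul, div_div, div_le_div_iff₀ (by positivity) (by positivity), one_mul]
    calc 2 * (B * (M.den hi * M.den lo)) ≤ 2 * (B * ((2 * M.Q) * (2 * M.Q))) := by gcongr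
      _ ≤ (3 * (k : ℝ) ^ r * M.Q) ^ 2 := by
        have : B = (k : ℝ) ^ r * (k : ℝ) ^ r := by rw [hB]; ring
        rw [this]
        nlinarith [mul_pos (mul_pos hkr hkr) (mul_pos hQ0 hQ0)]
      _ ≤ ((k : ℝ) ^ (p + 1)) ^ 2 := by gcongr
      _ = _ := by ring
  obtain ⟨j₀, hj₀⟩ := exists_cell_subset_Icc (by positivity) hlen
  have hsurj : ∀ β ∈ cell ((k : ℝ) ^ (2 * (p + 1))) j₀, ∃ y ∈ cell B e, M.app y = β := by
    intro β hβ
    have hlohi : lo ≤ hi := by have : 0 < 1 / B := by positivity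
                               linarith
    have hc : ContinuousOn M.app (Set.uIcc lo hi) := by
      refine (Mob.continuousOn_app hQ hQ').mono ?_
      rw [Set.uIcc_of_le hlohi]
      exact fun y hy => hlo0.1.trans hy.1
    obtain ⟨y, hy, hyβ⟩ := intermediate_value_uIcc hc (hj₀ hβ)
    rw [Set.uIcc_of_le hlohi] at hy
    exact ⟨y, hy, hyβ⟩
  have Hj₀ : HomCell k 4 (1 / (k : ℝ) ^ 20) 0 (p + 1) j₀ := by
    intro β hβ m hm hmN a
    have hm' : 0 < m := by exact_mod_cast hm
    obtain ⟨y, hy, rfl⟩ := hsurj β hβ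
    obtain ⟨hy0, hy1⟩ := hcell hy
    by_cases hmQ : 4 * (m : ℤ) < M.Q
    · exact hsmall y hy0 hy1 m hm' hmQ a
    have hV : 1 ≤ (k : ℝ) ^ r / k ^ 2 := by
      rw [le_div_iff₀ (by positivity), one_mul]
      exact pow_le_pow_right₀ hk1.le hr
    have h6 : 1 / (k : ℝ) ^ 6 ≤ 1 := by
      rw [div_le_one (by positivity)]; exact one_le_pow₀ hk1.le
    have hmV : 2 * (m : ℝ) ≤ (k : ℝ) ^ r / k ^ 2 * M.Q := by
      rw [le_div_iff₀ (by positivity)] at hmN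
      rw [div_mul_eq_mul_div, le_div_iff₀ (by positivity)]
      have h1 : (m : ℝ) * (k : ℝ) ^ 4 ≤ k * (3 * (k : ℝ) ^ r * M.Q) := by
        refine hmN.trans ?_
        calc (k : ℝ) ^ (p + 1) = k * (k : ℝ) ^ p := by ring
          _ ≤ k * (3 * (k : ℝ) ^ r * M.Q) := by gcongr
      have h2 : (2 * (m : ℝ) * (k : ℝ) ^ 2) * (k : ℝ) ^ 2 ≤ ((k : ℝ) ^ r * M.Q) * (k : ℝ) ^ 2 := by
        have h3 : 0 ≤ (k : ℝ) ^ r * M.Q * k := by positivity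
        nlinarith [mul_le_mul_of_nonneg_left hk32 h3]
      exact le_of_mul_le_mul_right h2 (by positivity)
    have h := Mob.tail_bound hQ hQ' hQQ hdet h6 hV hy0 hy1
      (homCell_zero_iff.mp HY y hy) (by exact_mod_cast not_lt.mp hmQ) hmV a
    refine le_trans ?_ h
    rw [div_div]
    apply one_div_le_one_div_of_le (by positivity)
    calc (k : ℝ) ^ 6 * 16 ≤ (k : ℝ) ^ 6 * k := by gcongr; linarith
      _ = (k : ℝ) ^ 7 := by ring
      _ ≤ (k : ℝ) ^ 20 := pow_le_pow_right₀ hk1.le (by norm_num)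
  obtain ⟨j, Hj, hj⟩ := Hj₀.exists_descend (by omega : 3 ≤ k) (by norm_num)
    (one_div_le_one_div_of_le (by positivity) (pow_le_pow_right₀ hk1.le (by norm_num))) (T - (p + 1))
  rw [show p + 1 + (T - (p + 1)) = T by omega] at Hj hj
  exact ⟨j, Hj, fun β hβ => hsurj β (hj hβ)⟩

theorem half_pow_le_sub_four_pow {k : ℕ} (hk : 3 ≤ k) (q : ℕ) :
    ((k : ℝ) ^ 2) ^ q / 2 ^ q ≤ (((k ^ 2 - 4) ^ q : ℕ) : ℝ) := by
  have h9 : 9 ≤ k ^ 2 := by nlinarith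
  push_cast [Nat.cast_sub (by omega : 4 ≤ k ^ 2)]
  rw [← div_pow]
  have : (9 : ℝ) ≤ (k : ℝ) ^ 2 := by exact_mod_cast h9
  gcongr
  linarith

/-- Decay of the exponential sums attached to two progressions with separated slopes. -/
theorem norm_geom_ee_diff_le {x ρ : ℝ} (hρ : 0 < ρ) (hρ1 : ρ ≤ 1 / 2) (h1 : ρ ≤ |x|)
    (h2 : |x| ≤ 1 / 2) (N : ℕ) : ‖∑ n ∈ Finset.range N, ee x ^ n‖ ≤ 1 / (2 * ρ) := by
  refine norm_geom_ee_le hρ (fun a => ?_) N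
  by_cases ha : a = 0
  · simpa [ha] using h1
  · have : (1 : ℝ) ≤ |(a : ℝ)| := by exact_mod_cast Int.one_le_abs ha
    have h3 := abs_sub_abs_le_abs_sub (a : ℝ) x
    rw [abs_sub_comm] at h3
    linarith

/-- Separation of the slopes of two maps of the family. -/
theorem slope_sep {Q₀ X Z K n D E : ℝ} (hQ₀ : 0 < Q₀) (hX : 0 < X) (hZ : 0 < Z) (hK : 6144 ≤ K)
    (hXZ : Z ^ 144 ≤ X) (hn : X ^ 10 * Q₀ ^ 2 ≤ 16 * K ^ 32 * n)
    (hD : Q₀ ≤ D) (hE : Q₀ ≤ E) (hDU : D ≤ 2 * (Z ^ 24 * Q₀)) (hEU : E ≤ 2 * (Z ^ 24 * Q₀))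
    (h : Q₀ * ((1 / 6) / Z ^ 48) / (8 * X ^ 2) ≤ |D - E|) :
    X ^ 7 / K ^ 33 ≤ n * |1 / D ^ 2 - 1 / E ^ 2| := by
  have hK0 : 0 < K := by linarith
  have h1 := inv_sq_sep hQ₀ hD hE hDU hEU h (by positivity)
  have hn0 : 0 ≤ n := by
    have h3 : 0 < 16 * K ^ 32 * n := lt_of_lt_of_le (by positivity) hn
    exact (pos_of_mul_pos_right h3 (by positivity)).le
  have e : 2 * Q₀ * (Q₀ * ((1 / 6) / Z ^ 48) / (8 * X ^ 2)) / (2 * (Z ^ 24 * Q₀)) ^ 4 =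
      1 / (384 * Z ^ 144 * X ^ 2 * Q₀ ^ 2) := by
    field_simp
    ring
  rw [e] at h1
  calc X ^ 7 / K ^ 33 ≤ n * (1 / (384 * Z ^ 144 * X ^ 2 * Q₀ ^ 2)) := by
        rw [mul_one_div, div_le_div_iff₀ (by positivity) (by positivity)]
        calc X ^ 7 * (384 * Z ^ 144 * X ^ 2 * Q₀ ^ 2) ≤ X ^ 7 * (384 * X * X ^ 2 * Q₀ ^ 2) := by
              gcongr
          _ = 384 * (X ^ 10 * Q₀ ^ 2) := by ring
          _ ≤ 384 * (16 * K ^ 32 * n) := by gcongr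
          _ = 6144 * (K ^ 32 * n) := by ring
          _ ≤ K * (K ^ 32 * n) := by gcongr
          _ = n * K ^ 33 := by ring
    _ ≤ _ := by gcongr

theorem two_pow_le_pow {k : ℕ} (hk : 2 ^ 200 ≤ k) {a : ℕ} (ha : a ≤ 200) (g : ℕ) :
    ((2 : ℝ) ^ g) ^ a ≤ (k : ℝ) ^ g := by
  have hk' : (2 : ℝ) ^ 200 ≤ k := by exact_mod_cast hk
  calc ((2 : ℝ) ^ g) ^ a = (2 ^ a) ^ g := by rw [← pow_mul, ← pow_mul, mul_comm]
    _ ≤ (2 ^ 200) ^ g := by gcongr; norm_num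
    _ ≤ (k : ℝ) ^ g := by gcongr

theorem exists_separated_cell {k : ℕ} (hk : 2 ^ 200 ≤ k) {g : ℕ} (hg : 1 ≤ g) {ι : Type*}
    [Fintype ι] [DecidableEq ι] (hι : Fintype.card ι = 2 ^ (12 * g)) (A B : ι → ℝ) {μ : ℝ}
    (hμ : 0 < μ) (hsep : ∀ i j, i ≠ j → μ ≤ |A i - A j| + |B i - B j|) :
    ∃ j₀, HomCell k 2 (1 / (k : ℝ) ^ 6) 0 (3 * g) j₀ ∧
      cell ((k : ℝ) ^ (2 * (3 * g))) j₀ ⊆ Set.Icc 0 1 ∧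
      ∀ y ∈ cell ((k : ℝ) ^ (2 * (3 * g))) j₀, ∀ i j, i ≠ j →
        μ / (8 * ((k : ℝ) ^ g) ^ 2) ≤ |(A i + B i * y) - (A j + B j * y)| := by
  have hk3 : 3 ≤ k := le_trans (by norm_num) hk
  have hk0 : (0 : ℝ) < k := by exact_mod_cast (by omega : 0 < k)
  have hk1 : (1 : ℝ) ≤ k := by exact_mod_cast (by omega : 1 ≤ k)
  have hroot : HomCell k 2 (1 / (k : ℝ) ^ 6) 0 0 0 := by
    intro β _ m hm hm' a
    exfalso
    have hm1 : (1 : ℝ) ≤ m := by exact_mod_cast (by exact_mod_cast hm : 0 < m)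
    rw [pow_zero, le_div_iff₀ (by positivity)] at hm'
    have : (3 : ℝ) ≤ k := by exact_mod_cast hk3
    nlinarith
  obtain ⟨S, hS, hS'⟩ := homTree hk3 le_rfl le_rfl hroot g
  have hX : (1 : ℝ) ≤ (k : ℝ) ^ g := one_le_pow₀ hk1
  have hZ : (2 : ℝ) ≤ 2 ^ g := by
    calc (2 : ℝ) = 2 ^ 1 := by norm_num
      _ ≤ _ := pow_le_pow_right₀ (by norm_num) hg
  have hcard : 4 * Fintype.card ι ^ 2 < S.card := by
    have h1 := half_pow_le_sub_four_pow hk3 g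
    have h2 : (((k ^ 2 - 4) ^ g : ℕ) : ℝ) ≤ S.card := by exact_mod_cast hS
    have h3 := two_pow_le_pow hk (by norm_num : 28 ≤ 200) g
    rw [hι]
    have : ((4 * (2 ^ (12 * g)) ^ 2 : ℕ) : ℝ) < S.card := by
      refine lt_of_lt_of_le ?_ (h1.trans h2)
      rw [lt_div_iff₀ (by positivity)]
      push_cast
      calc 4 * ((2 : ℝ) ^ (12 * g)) ^ 2 * 2 ^ g = 4 * (2 ^ g) ^ 25 := by
            rw [← pow_mul, ← pow_mul, mul_assoc, ← pow_add]; ring_nf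
        _ < (2 ^ g) ^ 3 * (2 ^ g) ^ 25 := by
            gcongr
            nlinarith [mul_le_mul hZ hZ (by norm_num) (by positivity)]
        _ = ((2 : ℝ) ^ g) ^ 28 := by ring
        _ ≤ (k : ℝ) ^ g * 1 := by simpa using h3
        _ ≤ (k : ℝ) ^ g * (k : ℝ) ^ g := by gcongr
        _ = _ := by ring
    exact_mod_cast this
  obtain ⟨d, hdS, hd⟩ := exists_unspoiled A B hμ hsep (N := (k : ℝ) ^ (2 * g))
    (one_le_pow₀ hk1) S hcard
  obtain ⟨hdk, Hd⟩ := hS' d hdS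
  obtain ⟨j₀, Hj₀, hj₀⟩ := Hd.exists_descend hk3 le_rfl le_rfl (2 * g)
  have e1 : 0 + g + 2 * g = 3 * g := by ring
  rw [e1] at Hj₀ hj₀
  have hsub1 := cell_child_subset (by omega : 0 < k) 0 (2 * g) 0 hdk
  have hroot' : cell ((k : ℝ) ^ 0) 0 ⊆ Set.Icc 0 1 := by simp [cell]
  rw [show 2 * (0 + g) = 0 + 2 * g by ring] at hj₀
  refine ⟨j₀, Hj₀, (hj₀.trans hsub1).trans hroot', fun y hy i j hij => ?_⟩
  have h01 := hroot' (hsub1 (hj₀ hy))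
  have hy' := hj₀ hy
  have h := hd y (by simpa using hy') h01.1 h01.2 i j hij
  rwa [show (k : ℝ) ^ (2 * g) = ((k : ℝ) ^ g) ^ 2 by rw [← pow_mul, mul_comm]] at h

set_option maxHeartbeats 1000000 in
/-- Among the maps of the family and the cells of the tree, some image is close to the
prescribed class modulo one. -/
theorem exists_family_hit {k : ℕ} (hk : 2 ^ 200 ≤ k) {g : ℕ} (hg : 36 ≤ g) {M : Mob}
    (hQ' : 0 < M.Q') (hQQ : M.Q' ≤ M.Q) (hdet : |M.det| = 1) {n : ℝ}
    (hn1 : ((k : ℝ) ^ g) ^ 10 * (M.Q : ℝ) ^ 2 ≤ 16 * (k : ℝ) ^ 32 * n)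
    (hn2 : n ≤ ((k : ℝ) ^ g) ^ 10 * (M.Q : ℝ) ^ 2) (θ : ℝ) :
    ∃ F : Mob, 0 < F.Q' ∧ F.Q' ≤ F.Q ∧ |F.det| = 1 ∧ (F.Q : ℝ) ≤ (2 ^ g) ^ 24 * M.Q ∧
      (∀ y : ℝ, 0 ≤ y → y ≤ 1 → ∃ z : ℝ, 0 ≤ z ∧ z ≤ 1 ∧ F.app y = M.app z) ∧
      (∀ y : ℝ, 0 ≤ y → y ≤ 1 → ∀ m : ℕ, M.Q ≤ 4 * (m : ℤ) → 4 * (m : ℤ) < F.Q →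
        ∀ a : ℤ, (1 / 32 : ℝ) ≤ m * |m * F.app y - a|) ∧
      ∃ e : ℤ, HomCell k 2 (1 / (k : ℝ) ^ 6) 0 (6 * g) e ∧
        cell ((k : ℝ) ^ (2 * (6 * g))) e ⊆ Set.Icc 0 1 ∧
        ∃ a : ℤ, ∀ y ∈ cell ((k : ℝ) ^ (2 * (6 * g))) e, |n * F.app y - θ - a| ≤ 2 * (1 / 2) ^ g := by
  have hk3 : 3 ≤ k := le_trans (by norm_num) hk
  have hkbig : (2 : ℝ) ^ 200 ≤ k := by exact_mod_cast hk
  have hk6144 : (6144 : ℝ) ≤ k := le_trans (by norm_num) hkbig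
  have hk0 : (0 : ℝ) < k := by linarith
  have hk1 : (1 : ℝ) ≤ k := by linarith
  have hQ : 0 < M.Q := hQ'.trans_le hQQ
  have hQ0 : (0 : ℝ) < M.Q := by exact_mod_cast hQ
  obtain ⟨ι, _, _, f, hcard, hd, hq, hsep, hsub, hhom⟩ := exists_family M hQ' hQQ hdet (12 * g)
  set Q₀ := (M.Q : ℝ) with hQ₀
  set X := (k : ℝ) ^ g with hX
  set Z := (2 : ℝ) ^ g with hZ
  have hZ0 : 0 < Z := by positivity
  have hX0 : 0 < X := by positivity
  have hX1 : 1 ≤ X := one_le_pow₀ hk1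
  have hZ1 : 1 ≤ Z := one_le_pow₀ (by norm_num)
  have hZ36 : (2 : ℝ) ^ 36 ≤ Z := pow_le_pow_right₀ (by norm_num) hg
  have e16 : (16 : ℝ) ^ (12 * g) = Z ^ 48 := by
    rw [hZ, ← pow_mul, show (16 : ℝ) = 2 ^ 4 by norm_num, ← pow_mul]; ring_nf
  have e4 : (4 : ℝ) ^ (12 * g) = Z ^ 24 := by
    rw [hZ, ← pow_mul, show (4 : ℝ) = 2 ^ 2 by norm_num, ← pow_mul]; ring_nf
  have e2 : (2 : ℝ) ^ (12 * g) = Z ^ 12 := by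
    rw [hZ, ← pow_mul]; ring_nf
  have hqr : ∀ w, (0 : ℝ) < (f w).Q' ∧ ((f w).Q' : ℝ) ≤ (f w).Q ∧ Q₀ ≤ (f w).Q ∧
      ((f w).Q : ℝ) ≤ Z ^ 24 * Q₀ := by
    intro w
    obtain ⟨h1, h2, h3, h4⟩ := hq w
    refine ⟨by exact_mod_cast h1, by exact_mod_cast h2, by rw [hQ₀]; exact_mod_cast h3, ?_⟩
    rw [← e4, hQ₀]
    exact_mod_cast h4
  have hdet' : ∀ w, |(f w).det| = 1 := by
    intro w
    rw [hd w, abs_mul, hdet, abs_pow]; simp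
  have hμ : 0 < Q₀ * ((1 / 6) / Z ^ 48) := by positivity
  obtain ⟨j₀, Hj₀, hj₀, hsep'⟩ := exists_separated_cell hk (by omega : 1 ≤ g) hcard
    (fun w => ((f w).Q : ℝ)) (fun w => ((f w).Q' : ℝ)) hμ (by
      intro i j hij
      have h := hsep i j hij
      rw [e16] at h
      exact coeff_sep hQ0 (hqr i).2.2.1 (hqr j).2.2.1 (hqr j).1.le (hqr j).2.1 h (by positivity))
  obtain ⟨E, hE, hE'⟩ := homTree hk3 le_rfl le_rfl Hj₀ (3 * g)
  have hB0 : (0 : ℝ) < (k : ℝ) ^ (2 * (3 * g)) := by positivity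
  set y₀ := (j₀ : ℝ) / (k : ℝ) ^ (2 * (3 * g)) with hy₀
  have hy₀mem : y₀ ∈ cell ((k : ℝ) ^ (2 * (3 * g))) j₀ := left_mem_cell hB0 j₀
  obtain ⟨hy₀0, hy₀1⟩ := hj₀ hy₀mem
  have eX6 : (k : ℝ) ^ (2 * (3 * g)) = X ^ 6 := by rw [hX, ← pow_mul]; ring_nf
  have hDge : ∀ w, Q₀ ≤ (f w).den y₀ := fun w =>
    (hqr w).2.2.1.trans (Mob.den_ge (hq w).1 hy₀0)
  have hDle : ∀ w, (f w).den y₀ ≤ 2 * (Z ^ 24 * Q₀) := fun w => by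
    have := Mob.den_le (hq w).1 hy₀1
    have := hqr w
    linarith
  have hn0 : 0 ≤ n := by
    have h3 : 0 < 16 * (k : ℝ) ^ 32 * n := lt_of_lt_of_le (by positivity) hn1
    exact (pos_of_mul_pos_right h3 (by positivity)).le
  have hslope : ∀ w v, w ≠ v →
      X ^ 7 / (k : ℝ) ^ 33 ≤ n * |1 / (f w).den y₀ ^ 2 - 1 / (f v).den y₀ ^ 2| := by
    intro w v hwv
    refine slope_sep hQ0 hX0 hZ0 hk6144 (two_pow_le_pow hk (by norm_num) g) hn1 (hDge w) (hDge v)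
      (hDle w) (hDle v) ?_
    exact hsep' y₀ hy₀mem w v hwv
  have hslope' : ∀ w v, n * |1 / (f w).den y₀ ^ 2 - 1 / (f v).den y₀ ^ 2| ≤ X ^ 10 := by
    intro w v
    have hb : ∀ u, 0 ≤ 1 / (f u).den y₀ ^ 2 ∧ 1 / (f u).den y₀ ^ 2 ≤ 1 / Q₀ ^ 2 := fun u =>
      ⟨by positivity, one_div_le_one_div_of_le (by positivity) (by gcongr; exact hDge u)⟩
    have h1 : |1 / (f w).den y₀ ^ 2 - 1 / (f v).den y₀ ^ 2| ≤ 1 / Q₀ ^ 2 := by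
      rw [abs_le]
      have := hb w
      have := hb v
      constructor <;> linarith
    calc n * |1 / (f w).den y₀ ^ 2 - 1 / (f v).den y₀ ^ 2| ≤ (X ^ 10 * Q₀ ^ 2) * (1 / Q₀ ^ 2) := by
          gcongr
      _ = X ^ 10 := by field_simp
  set s : ℝ := (-1) ^ (12 * g) * (M.det : ℝ) with hs
  have hs1 : |s| = 1 := by
    have : ((|M.det| : ℤ) : ℝ) = 1 := by rw [hdet]; simp
    rw [Int.cast_abs] at this
    rw [hs, abs_mul, abs_pow, this]; simp
  have hds : ∀ w, ((f w).det : ℝ) = s := fun w => by rw [hd w]; push_cast; rfl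
  set A : ι → ℝ := fun w => n * (f w).app y₀ - θ with hA
  set σ : ι → ℝ := fun w => n * (s / (f w).den y₀ ^ 2) * (1 / X ^ 12) with hσ
  have hσd : ∀ w v, |σ w - σ v| =
      n * |1 / (f w).den y₀ ^ 2 - 1 / (f v).den y₀ ^ 2| * (1 / X ^ 12) := by
    intro w v
    have : σ w - σ v = n * (s * (1 / (f w).den y₀ ^ 2 - 1 / (f v).den y₀ ^ 2)) * (1 / X ^ 12) := by
      simp only [hσ]; ring
    rw [this, abs_mul, abs_mul, abs_mul, hs1, abs_of_nonneg hn0,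
      abs_of_pos (by positivity : 0 < 1 / X ^ 12), one_mul]
  have hZX : Z ^ 4 ≤ X := two_pow_le_pow hk (by norm_num) g
  have hkX : (k : ℝ) ^ 33 * Z ^ 12 ≤ X := by
    have h1 : Z ^ 12 ≤ (k : ℝ) ^ (g - 33) := by
      have h2 : ((2 : ℝ) ^ 200) ^ (g - 33) ≤ (k : ℝ) ^ (g - 33) := by gcongr
      refine le_trans ?_ h2
      rw [hZ, ← pow_mul, ← pow_mul]
      exact pow_le_pow_right₀ (by norm_num) (by omega)
    calc (k : ℝ) ^ 33 * Z ^ 12 ≤ (k : ℝ) ^ 33 * (k : ℝ) ^ (g - 33) := by gcongr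
      _ = X := by rw [← pow_add, hX]; congr 1; omega
  have hN : ((k ^ (2 * (3 * g)) : ℕ) : ℝ) = X ^ 6 := by push_cast; exact eX6
  have hH4 : ((4 ^ g : ℕ) : ℝ) = Z ^ 2 := by
    push_cast
    rw [hZ, ← pow_mul, show (4 : ℝ) = 2 ^ 2 by norm_num, ← pow_mul, mul_comm]
  have hE2 : X ^ 6 / Z ^ 3 ≤ (E.card : ℝ) := by
    have h1 := half_pow_le_sub_four_pow hk3 (3 * g)
    have h2 : (((k ^ 2 - 4) ^ (3 * g) : ℕ) : ℝ) ≤ E.card := by exact_mod_cast hE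
    refine le_trans (le_of_eq ?_) (h1.trans h2)
    rw [hX, hZ]
    simp only [← pow_mul]
    ring_nf
  have hne : Nonempty ι := by
    rw [← Fintype.card_pos_iff, hcard]; positivity
  obtain ⟨e, heE, w, a, hea⟩ := exists_hit A σ (k ^ (2 * (3 * g))) E
    (fun d hd => Finset.mem_range.mpr (hE' d hd).1) (4 ^ g) (by positivity)
    (η := (1 / 2) ^ g) (ε := (k : ℝ) ^ 33 / X) (by positivity) (by positivity)
    (by
      rw [hH4, ← mul_pow, hZ, ← mul_pow]
      norm_num)
    (by
      intro w v hwv h h1 h2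
      have h1r : (1 : ℝ) ≤ h := by exact_mod_cast h1
      have h2r : (h : ℝ) ≤ Z ^ 2 := by rw [← hH4]; exact_mod_cast h2.le
      have h33 : (1 : ℝ) ≤ (k : ℝ) ^ 33 := one_le_pow₀ hk1
      have hx : |(h : ℝ) * (σ w - σ v)| =
          h * (n * |1 / (f w).den y₀ ^ 2 - 1 / (f v).den y₀ ^ 2| * (1 / X ^ 12)) := by
        rw [abs_mul, hσd, abs_of_nonneg (by positivity : (0 : ℝ) ≤ h)]
      have hlow : 1 / (X ^ 5 * (k : ℝ) ^ 33) ≤ |(h : ℝ) * (σ w - σ v)| := by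
        rw [hx]
        calc 1 / (X ^ 5 * (k : ℝ) ^ 33) = 1 * (X ^ 7 / (k : ℝ) ^ 33 * (1 / X ^ 12)) := by
              field_simp
          _ ≤ _ := by gcongr; exact hslope w v hwv
      have hX2 : 2 ≤ X := le_trans (by norm_num) (hZ36.trans
        (le_trans (by nlinarith [one_le_pow₀ hZ1 (n := 3)] : Z ≤ Z ^ 4) hZX))
      have hup : |(h : ℝ) * (σ w - σ v)| ≤ 1 / 2 := by
        rw [hx]
        calc (h : ℝ) * (n * |1 / (f w).den y₀ ^ 2 - 1 / (f v).den y₀ ^ 2| * (1 / X ^ 12)) ≤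
              Z ^ 2 * (X ^ 10 * (1 / X ^ 12)) := by gcongr; exact hslope' w v
          _ ≤ X * (X ^ 10 * (1 / X ^ 12)) := by
              gcongr
              exact le_trans (pow_le_pow_right₀ hZ1 (by norm_num)) hZX
          _ = 1 / X := by field_simp
          _ ≤ 1 / 2 := one_div_le_one_div_of_le (by norm_num) hX2
      have h5 : 1 / (X ^ 5 * (k : ℝ) ^ 33) ≤ 1 / 2 := hlow.trans hup
      refine (norm_geom_ee_diff_le (by positivity) h5 hlow hup _).trans ?_
      rw [hN]
      have : 1 / (2 * (1 / (X ^ 5 * (k : ℝ) ^ 33))) = X ^ 5 * (k : ℝ) ^ 33 / 2 := by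
        field_simp
      rw [this]
      have h6 : (k : ℝ) ^ 33 / X * X ^ 6 = X ^ 5 * (k : ℝ) ^ 33 := by field_simp
      rw [h6]
      have : 0 < X ^ 5 * (k : ℝ) ^ 33 := by positivity
      linarith)
    (by
      refine lt_of_lt_of_le ?_ hE2
      rw [hN, hH4, hcard]
      push_cast
      rw [e2]
      have h1 : (k : ℝ) ^ 33 / X ≤ 1 / Z ^ 12 := by
        rw [div_le_div_iff₀ hX0 (by positivity), one_mul]; exact hkX
      calc 2 * (Z ^ 2) ^ 3 * X ^ 6 * (1 / Z ^ 12 + (k : ℝ) ^ 33 / X) ≤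
            2 * (Z ^ 2) ^ 3 * X ^ 6 * (1 / Z ^ 12 + 1 / Z ^ 12) := by gcongr
        _ = 4 * X ^ 6 / Z ^ 6 := by field_simp; norm_num
        _ < X ^ 6 / Z ^ 3 := by
            rw [div_lt_div_iff₀ (by positivity) (by positivity)]
            have h3 : 4 < Z ^ 3 := by
              have : (1 : ℝ) ≤ Z ^ 2 := one_le_pow₀ hZ1
              nlinarith
            have : 0 < X ^ 6 * Z ^ 3 := by positivity
            nlinarith [mul_lt_mul_of_pos_right h3 this])
  obtain ⟨hek, He⟩ := hE' e heE
  have hsubE := cell_child_subset (by omega : 0 < k) (2 * (3 * g)) (2 * (3 * g)) j₀ hek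
  rw [show 3 * g + 3 * g = 6 * g by ring] at He
  rw [show 2 * (3 * g) + 2 * (3 * g) = 2 * (6 * g) by ring] at hsubE
  have eX12 : (k : ℝ) ^ (2 * (6 * g)) = X ^ 12 := by rw [hX, ← pow_mul]; ring_nf
  refine ⟨f w, (hq w).1, (hq w).2.1, hdet' w, (hqr w).2.2.2, hsub w, hhom w,
    (k : ℤ) ^ (2 * (3 * g)) * j₀ + e, He, hsubE.trans hj₀, a, fun y hy => ?_⟩
  have hy' := hsubE hy
  obtain ⟨hy0, hy1⟩ := hj₀ hy'
  have hyy₀ : |y - y₀| ≤ 1 / X ^ 6 := by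
    rw [← eX6]; exact abs_sub_le_of_mem_cell hy' hy₀mem
  have hleft : y₀ + e / X ^ 12 ∈ cell ((k : ℝ) ^ (2 * (6 * g))) ((k : ℤ) ^ (2 * (3 * g)) * j₀ + e) := by
    have h := left_mem_cell (by positivity : (0 : ℝ) < (k : ℝ) ^ (2 * (6 * g)))
      ((k : ℤ) ^ (2 * (3 * g)) * j₀ + e)
    convert h using 1
    push_cast
    rw [hy₀, eX6, eX12]
    field_simp
  have hyw : |y - (y₀ + e / X ^ 12)| ≤ 1 / X ^ 12 := by
    rw [← eX12]; rw [← eX12] at hleft; exact abs_sub_le_of_mem_cell hy hleft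
  have hlin := Mob.linearize (hq w).1 (hq w).2.1 (hdet' w) hy0 hy₀0 (y₀ + e / X ^ 12)
  rw [hds w] at hlin
  have herr : n * (((y - y₀) ^ 2 + |y - (y₀ + e / X ^ 12)|) / ((f w).Q : ℝ) ^ 2) ≤ (1 / 2) ^ g := by
    have h1 : (y - y₀) ^ 2 ≤ 1 / X ^ 12 := by
      rw [← sq_abs]
      calc |y - y₀| ^ 2 ≤ (1 / X ^ 6) ^ 2 := by gcongr
        _ = _ := by rw [div_pow, one_pow, ← pow_mul]
    calc n * (((y - y₀) ^ 2 + |y - (y₀ + e / X ^ 12)|) / ((f w).Q : ℝ) ^ 2) ≤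
          (X ^ 10 * Q₀ ^ 2) * ((1 / X ^ 12 + 1 / X ^ 12) / Q₀ ^ 2) := by
            gcongr
            exact (hqr w).2.2.1
      _ = 2 / X ^ 2 := by field_simp; norm_num
      _ ≤ 1 / Z := by
          rw [div_le_div_iff₀ (by positivity) hZ0]
          have h2 : 2 * Z ≤ X := by
            refine le_trans ?_ hZX
            have : (2 : ℝ) ≤ Z ^ 3 := by
              have : (1 : ℝ) ≤ Z ^ 2 := one_le_pow₀ hZ1
              nlinarith
            nlinarith
          nlinarith
      _ = _ := by rw [hZ, one_div, one_div, inv_pow]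
  have hkey : n * (f w).app y - θ - a =
      (A w + σ w * e - a) + n * ((f w).app y - (f w).app y₀ -
        s * (y₀ + e / X ^ 12 - y₀) / (f w).den y₀ ^ 2) := by
    simp only [hA, hσ]; ring
  rw [hkey]
  refine (abs_add_le _ _).trans ?_
  rw [abs_mul, abs_of_nonneg hn0]
  have := mul_le_mul_of_nonneg_left hlin hn0
  linarith

theorem window_hom {k : ℕ} (hk : 2 ^ 200 ≤ k) {t : ℕ} {i : ℤ}
    (H : HomCell k 4 (1 / (k : ℝ) ^ 20) 0 t i) {g : ℕ} (hg : 36 ≤ g) {n : ℝ}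
    (hn1 : (k : ℝ) ^ (2 * t + 10 * g) ≤ n) (hn2 : n ≤ (k : ℝ) ^ (2 * t + 10 * g + 2)) (θ : ℝ) :
    ∃ j, HomCell k 4 (1 / (k : ℝ) ^ 20) 0 (t + 7 * g) j ∧
      cell ((k : ℝ) ^ (2 * (t + 7 * g))) j ⊆ cell ((k : ℝ) ^ (2 * t)) i ∧
      ∃ a : ℤ, ∀ β ∈ cell ((k : ℝ) ^ (2 * (t + 7 * g))) j, |n * β - θ - a| ≤ 2 * (1 / 2) ^ g := by
  have hkbig : (2 : ℝ) ^ 200 ≤ k := by exact_mod_cast hk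
  have hk32 : (32 : ℝ) ≤ k := le_trans (by norm_num) hkbig
  have hk32' : 32 ≤ k := le_trans (by norm_num) hk
  have hk0 : (0 : ℝ) < k := by linarith
  have hk1 : (1 : ℝ) ≤ k := by linarith
  obtain ⟨M, hQ', hQQ, hdet, hlow, hup, hmem, hbase⟩ := exists_base (by omega) H
  have hQ : 0 < M.Q := hQ'.trans_le hQQ
  have hQ0 : (0 : ℝ) < M.Q := by exact_mod_cast hQ
  obtain ⟨F, hF', hFF, hFdet, hFQ, hFsub, hFhom, e, He, he, a, ha⟩ :=
    exists_family_hit hk hg hQ' hQQ hdet (n := n)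
      (by
        calc ((k : ℝ) ^ g) ^ 10 * (M.Q : ℝ) ^ 2 ≤ ((k : ℝ) ^ g) ^ 10 * (4 * (k : ℝ) ^ (t + 16)) ^ 2 := by
              gcongr
          _ = 16 * (k : ℝ) ^ 32 * (k : ℝ) ^ (2 * t + 10 * g) := by ring
          _ ≤ _ := by gcongr)
      (by
        calc n ≤ (k : ℝ) ^ (2 * t + 10 * g + 2) := hn2
          _ ≤ (k : ℝ) ^ (2 * t + 10 * g + 12) := pow_le_pow_right₀ hk1 (by omega)
          _ = ((k : ℝ) ^ g) ^ 10 * ((k : ℝ) ^ (t + 6)) ^ 2 := by ring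
          _ ≤ ((k : ℝ) ^ g) ^ 10 * (2 * (k : ℝ) ^ (t + 6)) ^ 2 := by
              gcongr
              have : 0 < (k : ℝ) ^ (t + 6) := by positivity
              linarith
          _ ≤ _ := by gcongr) θ
  have hkZ : (k : ℝ) ^ 18 * ((2 : ℝ) ^ g) ^ 24 ≤ (k : ℝ) ^ g := by
    have h1 : ((2 : ℝ) ^ g) ^ 24 ≤ (k : ℝ) ^ (g - 18) := by
      have h2 : ((2 : ℝ) ^ 200) ^ (g - 18) ≤ (k : ℝ) ^ (g - 18) := by gcongr
      refine le_trans ?_ h2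
      rw [← pow_mul, ← pow_mul]
      exact pow_le_pow_right₀ (by norm_num) (by omega)
    calc (k : ℝ) ^ 18 * ((2 : ℝ) ^ g) ^ 24 ≤ (k : ℝ) ^ 18 * (k : ℝ) ^ (g - 18) := by gcongr
      _ = _ := by rw [← pow_add]; congr 1; omega
  have hFp : (0 : ℝ) < F.Q := by exact_mod_cast hF'.trans_le hFF
  obtain ⟨j, Hj, hj⟩ := exists_cell_in_image hk32' (by omega : 2 ≤ 6 * g) hF' hFF hFdet he He
    (by
      intro y hy hy1 m hm hmQ b
      by_cases hmM : 4 * (m : ℤ) < M.Q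
      · obtain ⟨z, hz, hz1, hzz⟩ := hFsub y hy hy1
        rw [hzz]
        exact hbase z hz hz1 m hm hmM b
      · refine le_trans ?_ (hFhom y hy hy1 m (not_lt.mp hmM) hmQ b)
        apply one_div_le_one_div_of_le (by norm_num)
        calc (32 : ℝ) ≤ k := hk32
          _ = (k : ℝ) ^ 1 := by ring
          _ ≤ _ := pow_le_pow_right₀ hk1 (by norm_num))
    (T := t + 7 * g)
    (by
      calc (k : ℝ) * (3 * (k : ℝ) ^ (6 * g) * F.Q) ≤
            k * (3 * (k : ℝ) ^ (6 * g) * ((2 ^ g) ^ 24 * (4 * (k : ℝ) ^ (t + 16)))) := by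
              gcongr
              exact hFQ.trans (by gcongr)
        _ = 12 * (((2 : ℝ) ^ g) ^ 24 * (k : ℝ) ^ 17 * ((k : ℝ) ^ (6 * g) * (k : ℝ) ^ t)) := by ring
        _ ≤ k * (((2 : ℝ) ^ g) ^ 24 * (k : ℝ) ^ 17 * ((k : ℝ) ^ (6 * g) * (k : ℝ) ^ t)) := by
            gcongr; linarith
        _ = (k : ℝ) ^ 18 * ((2 : ℝ) ^ g) ^ 24 * ((k : ℝ) ^ (6 * g) * (k : ℝ) ^ t) := by ring
        _ ≤ (k : ℝ) ^ g * ((k : ℝ) ^ (6 * g) * (k : ℝ) ^ t) := by gcongr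
        _ = _ := by ring)
  refine ⟨j, Hj, fun β hβ => ?_, a, fun β hβ => ?_⟩
  · obtain ⟨y, hy, rfl⟩ := hj β hβ
    obtain ⟨z, hz, hz1, hzz⟩ := hFsub y (he hy).1 (he hy).2
    rw [hzz]
    exact hmem z hz hz1
  · obtain ⟨y, hy, rfl⟩ := hj β hβ
    exact ha y hy

/-- Both coordinates are badly approximable up to the scale `t`. -/
def GoodBox (k t : ℕ) (p : ℤ × ℤ) : Prop :=
  HomCell k 4 (1 / (k : ℝ) ^ 20) 0 t p.1 ∧
    ∀ β ∈ cell ((k : ℝ) ^ (2 * t)) p.1, ∀ δ ∈ cell ((k : ℝ) ^ t) p.2,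
      InhBd (1 / (k : ℝ) ^ 23) ((k : ℝ) ^ t / (k : ℝ) ^ 22) β δ

/-- The box at scale `t` with index `p`. -/
def box (k t : ℕ) (p : ℤ × ℤ) : Set (ℝ × ℝ) :=
  cell ((k : ℝ) ^ (2 * t)) p.1 ×ˢ cell ((k : ℝ) ^ t) p.2

theorem goodBox_zero {k : ℕ} (hk : 2 ≤ k) : GoodBox k 0 (0, 0) := by
  have hk2 : (2 : ℝ) ≤ k := by exact_mod_cast hk
  have key : ∀ (e : ℕ) (m : ℕ), e ≠ 0 → 0 < m → ¬ (m : ℝ) ≤ (k : ℝ) ^ 0 / (k : ℝ) ^ e := by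
    intro e m he hm
    have hm1 : (1 : ℝ) ≤ m := by exact_mod_cast hm
    rw [pow_zero, not_le]
    refine lt_of_lt_of_le ?_ hm1
    rw [div_lt_one (by positivity)]
    exact one_lt_pow₀ (by linarith) he
  constructor
  · intro β _ m hm hm' a
    exact absurd hm' (key 4 m (by norm_num) (by exact_mod_cast hm))
  · intro β _ δ _ m hm hm' a
    exact absurd hm' (key 22 m (by norm_num) hm)

/-- Refinement of the second coordinate over a cell of the first coordinate which is already
badly approximable far enough. -/
theorem inhChildren {k : ℕ} (hk : 7 ≤ k) {t T : ℕ} (htT : t + 1 ≤ T) {j d : ℤ}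
    (Hj : HomCell k 4 (1 / (k : ℝ) ^ 20) 0 T j)
    (Hd : ∀ β ∈ cell ((k : ℝ) ^ (2 * T)) j, ∀ δ ∈ cell ((k : ℝ) ^ t) d,
      InhBd (1 / (k : ℝ) ^ 23) ((k : ℝ) ^ t / (k : ℝ) ^ 22) β δ) :
    ∃ S : Finset ℕ, k - 6 ≤ S.card ∧ ∀ b ∈ S, b < k ∧
      ∀ β ∈ cell ((k : ℝ) ^ (2 * T)) j, ∀ δ ∈ cell ((k : ℝ) ^ (t + 1)) (k * d + b),
        InhBd (1 / (k : ℝ) ^ 23) ((k : ℝ) ^ (t + 1) / (k : ℝ) ^ 22) β δ := by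
  have hk7 : (7 : ℝ) ≤ k := by exact_mod_cast hk
  have hk1 : (1 : ℝ) ≤ k := by linarith
  have hk0 : (0 : ℝ) < k := by linarith
  obtain ⟨U, hU, hU'⟩ := inhStep (by omega : 3 ≤ k) (h := 4) (h' := 22) (by norm_num)
    (c := 1 / (k : ℝ) ^ 20) (by rw [div_le_one (by positivity)]; exact one_le_pow₀ hk1)
    (by
      have : 1 / (k : ℝ) ^ 20 * (k : ℝ) ^ 22 = (k : ℝ) * k := by field_simp
      rw [this]
      nlinarith) (t := t) (J := cell ((k : ℝ) ^ (2 * T)) j)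
    (by
      intro x hx y hy
      refine (abs_sub_le_of_mem_cell hx hy).trans ?_
      apply one_div_le_one_div_of_le (by positivity)
      exact pow_le_pow_right₀ hk1 (by omega))
    (by
      intro β hβ m hm hm' a
      refine homCell_zero_iff.mp Hj β hβ m hm (hm'.trans ?_) a
      gcongr) d
  refine ⟨(Finset.range k).filter fun b : ℕ => (k : ℤ) * d + b ∉ U, ?_, fun b hb => ?_⟩
  · refine le_trans ?_ (card_filter_notMem_image U (k * d))
    omega
  · rw [Finset.mem_filter, Finset.mem_range] at hb
    refine ⟨hb.1, fun β hβ δ hδ m hm hm' a => ?_⟩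
    have hsub := cell_child_subset (by omega : 0 < k) t 1 d (by simpa using hb.1 : b < k ^ 1)
    rw [pow_one] at hsub
    by_cases hmt : (m : ℝ) ≤ (k : ℝ) ^ t / (k : ℝ) ^ 22
    · exact Hd β hβ δ (hsub hδ) m hm hmt a
    · exact hU' _ hb.2 hsub β hβ δ hδ m (not_le.mp hmt) hm' a

theorem box_subset_box {k t T : ℕ} {p p' : ℤ × ℤ}
    (h1 : cell ((k : ℝ) ^ (2 * T)) p'.1 ⊆ cell ((k : ℝ) ^ (2 * t)) p.1)
    (h2 : cell ((k : ℝ) ^ T) p'.2 ⊆ cell ((k : ℝ) ^ t) p.2) : box k T p' ⊆ box k t p :=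
  Set.prod_mono h1 h2

theorem goodBox_children {k : ℕ} (hk : 7 ≤ k) {t : ℕ} {p : ℤ × ℤ} (H : GoodBox k t p) :
    ∃ c : Fin ((k ^ 2 - 4) * (k - 6)) → ℤ × ℤ, Function.Injective c ∧
      ∀ x, GoodBox k (t + 1) (c x) ∧ box k (t + 1) (c x) ⊆ box k t p := by
  have hk1 : (1 : ℝ) ≤ k := by exact_mod_cast (by omega : 1 ≤ k)
  obtain ⟨S, hS, hS'⟩ := homChildren (by omega : 3 ≤ k) (by norm_num : 2 ≤ 4)
    (one_div_le_one_div_of_le (by positivity) (pow_le_pow_right₀ hk1 (by norm_num))) H.1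
  have hsub : ∀ d ∈ S, cell ((k : ℝ) ^ (2 * (t + 1))) ((k : ℤ) ^ 2 * p.1 + d) ⊆
      cell ((k : ℝ) ^ (2 * t)) p.1 := fun d hd =>
    cell_child_subset (by omega) (2 * t) 2 p.1 (hS' d hd).1
  have key : ∀ d : ℕ, ∃ U : Finset ℕ, k - 6 ≤ U.card ∧ (d ∈ S → ∀ b ∈ U, b < k ∧
      ∀ β ∈ cell ((k : ℝ) ^ (2 * (t + 1))) ((k : ℤ) ^ 2 * p.1 + d),
        ∀ δ ∈ cell ((k : ℝ) ^ (t + 1)) (k * p.2 + b),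
        InhBd (1 / (k : ℝ) ^ 23) ((k : ℝ) ^ (t + 1) / (k : ℝ) ^ 22) β δ) := by
    intro d
    by_cases hd : d ∈ S
    · obtain ⟨U, hU, hU'⟩ := inhChildren hk le_rfl (hS' d hd).2
        (fun β hβ δ hδ => H.2 β (hsub d hd hβ) δ hδ)
      exact ⟨U, hU, fun _ => hU'⟩
    · exact ⟨Finset.range k, by simp, fun h => absurd h hd⟩
  choose U hU hU' using key
  have hcard : Fintype.card (Fin ((k ^ 2 - 4) * (k - 6))) ≤ Fintype.card (S.sigma U) := by
    rw [Fintype.card_fin, Fintype.card_coe, Finset.card_sigma]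
    calc (k ^ 2 - 4) * (k - 6) ≤ S.card * (k - 6) := by gcongr
      _ = ∑ d ∈ S, (k - 6) := by simp
      _ ≤ _ := Finset.sum_le_sum fun d _ => hU d
  obtain ⟨φ⟩ := Function.Embedding.nonempty_of_card_le hcard
  refine ⟨fun x => ((k : ℤ) ^ 2 * p.1 + (φ x).1.1, k * p.2 + (φ x).1.2), ?_, ?_⟩
  · intro x y hxy
    simp only [Prod.mk.injEq, add_right_inj, Nat.cast_inj] at hxy
    apply φ.injective
    apply Subtype.ext
    exact Sigma.ext hxy.1 (heq_of_eq hxy.2)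
  · intro x
    have hx := Finset.mem_sigma.mp (φ x).2
    have hb := hU' _ hx.1 _ hx.2
    refine ⟨⟨(hS' _ hx.1).2, hb.2⟩, box_subset_box (hsub _ hx.1) ?_⟩
    have := cell_child_subset (by omega : 0 < k) t 1 p.2 (by simpa using hb.1 : (φ x).1.2 < k ^ 1)
    rwa [pow_one] at this

theorem inh_descend {k : ℕ} (hk : 7 ≤ k) {t T : ℕ} {j d : ℤ}
    (Hj : HomCell k 4 (1 / (k : ℝ) ^ 20) 0 T j)
    (Hd : ∀ β ∈ cell ((k : ℝ) ^ (2 * T)) j, ∀ δ ∈ cell ((k : ℝ) ^ t) d,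
      InhBd (1 / (k : ℝ) ^ 23) ((k : ℝ) ^ t / (k : ℝ) ^ 22) β δ) (q : ℕ) (hq : t + q ≤ T) :
    ∃ d', cell ((k : ℝ) ^ (t + q)) d' ⊆ cell ((k : ℝ) ^ t) d ∧
      ∀ β ∈ cell ((k : ℝ) ^ (2 * T)) j, ∀ δ ∈ cell ((k : ℝ) ^ (t + q)) d',
        InhBd (1 / (k : ℝ) ^ 23) ((k : ℝ) ^ (t + q) / (k : ℝ) ^ 22) β δ := by
  induction q with
  | zero => exact ⟨d, by simp, Hd⟩
  | succ q ih =>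
    obtain ⟨d', hd', Hd'⟩ := ih (by omega)
    obtain ⟨S, hS, hS'⟩ := inhChildren hk (by omega : t + q + 1 ≤ T) Hj Hd'
    obtain ⟨b, hb⟩ : S.Nonempty := by
      rw [← Finset.card_pos]; omega
    obtain ⟨hbk, hb'⟩ := hS' b hb
    refine ⟨k * d' + b, subset_trans ?_ hd', hb'⟩
    have := cell_child_subset (by omega : 0 < k) (t + q) 1 d' (by simpa using hbk : b < k ^ 1)
    rwa [pow_one] at this

theorem goodBox_window {k : ℕ} (hk : 2 ^ 200 ≤ k) {t : ℕ} {p : ℤ × ℤ} (H : GoodBox k t p)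
    {g : ℕ} (hg : 36 ≤ g) (hgt : g ≤ t) {n : ℝ}
    (hn1 : (k : ℝ) ^ (2 * t + 10 * g) ≤ n) (hn2 : n ≤ (k : ℝ) ^ (2 * t + 10 * g + 2)) :
    ∃ p', GoodBox k (t + 7 * g) p' ∧ box k (t + 7 * g) p' ⊆ box k t p ∧
      ∃ a : ℤ, ∀ x ∈ box k (t + 7 * g) p', |n * x.1 - x.2 - a| ≤ 3 * (1 / 2) ^ g := by
  have hk7 : 7 ≤ k := le_trans (by norm_num) hk
  have hk0 : (0 : ℝ) < k := by exact_mod_cast (by omega : 0 < k)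
  obtain ⟨j, Hj, hj, a, ha⟩ := window_hom hk H.1 hg hn1 hn2 ((p.2 : ℝ) / (k : ℝ) ^ t)
  obtain ⟨d, hd, Hd⟩ := inh_descend hk7 Hj (t := t) (d := p.2)
    (fun β hβ δ hδ => H.2 β (hj hβ) δ hδ) (7 * g) le_rfl
  refine ⟨(j, d), ⟨Hj, Hd⟩, box_subset_box hj hd, a, fun x hx => ?_⟩
  have h1 := ha x.1 hx.1
  have h2 : |x.2 - (p.2 : ℝ) / (k : ℝ) ^ t| ≤ 1 / (k : ℝ) ^ t :=
    abs_sub_le_of_mem_cell (hd hx.2) (left_mem_cell (by positivity) _)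
  have h3 : 1 / (k : ℝ) ^ t ≤ (1 / 2) ^ g := by
    rw [one_div_pow]
    apply one_div_le_one_div_of_le (by positivity)
    have hk2 : (2 : ℝ) ≤ k := by exact_mod_cast (by omega : 2 ≤ k)
    calc (2 : ℝ) ^ g ≤ 2 ^ t := pow_le_pow_right₀ (by norm_num) hgt
      _ ≤ _ := by gcongr
  rw [show n * x.1 - x.2 - a = (n * x.1 - (p.2 : ℝ) / (k : ℝ) ^ t - a) -
    (x.2 - (p.2 : ℝ) / (k : ℝ) ^ t) by ring]
  refine (abs_sub _ _).trans ?_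
  linarith

theorem exists_dist_int_lower_bound {α : ℝ} (hα : Irrational α) (N : ℕ) :
    ∃ c > 0, ∀ m : ℕ, 0 < m → m < N → ∀ a : ℤ, c ≤ |m * α - a| := by
  induction N with
  | zero => exact ⟨1, one_pos, fun m _ h => absurd h (Nat.not_lt_zero m)⟩
  | succ N ih =>
    obtain ⟨c, hc, h⟩ := ih
    by_cases hN : N = 0
    · exact ⟨1, one_pos, fun m h1 h2 => by omega⟩
    refine ⟨min c |N * α - round ((N : ℝ) * α)|, lt_min hc ?_, fun m hm hmN a => ?_⟩
    · rw [abs_pos, sub_ne_zero]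
      exact (hα.natCast_mul hN).ne_int _
    · rcases Nat.lt_succ_iff_lt_or_eq.mp hmN with h1 | rfl
      · exact (min_le_left _ _).trans (h m hm h1 a)
      · exact (min_le_right _ _).trans (round_le _ a)

theorem exists_inhomogeneous_approx {α : ℝ} (hα : Irrational α) (γ : ℝ) (N : ℕ) :
    ∃ n : ℕ, N ≤ n ∧ ∃ b : ℤ, (n : ℝ) * |n * α - γ - b| ≤ 5 := by
  obtain ⟨c, hc, hlow⟩ := exists_dist_int_lower_bound hα N
  obtain ⟨K, hK⟩ := exists_nat_gt (1 / c)
  obtain ⟨q, hq, hqK⟩ := Real.exists_rat_abs_sub_le_and_den_le α (Nat.succ_pos K)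
  have hQ : (0 : ℝ) < q.den := by exact_mod_cast q.den_pos
  have hqc : (q : ℝ) = q.num / q.den := by exact_mod_cast (Rat.num_div_den q).symm
  have hmul : |(q.den : ℝ) * α - q.num| ≤ 1 / ((K.succ : ℝ) + 1) := by
    have : (q.den : ℝ) * α - q.num = q.den * (α - q) := by rw [hqc]; field_simp
    rw [this, abs_mul, abs_of_pos hQ]
    calc (q.den : ℝ) * |α - q| ≤ q.den * (1 / (((K.succ : ℕ) + 1) * q.den)) := by gcongr
      _ = _ := by field_simp
  have hNq : N ≤ q.den := by
    by_contra! hlt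
    have h1 := hlow q.den q.den_pos hlt q.num
    have h2 : 1 / ((K.succ : ℝ) + 1) < c := by
      rw [div_lt_iff₀ hc] at hK
      rw [div_lt_iff₀ (by positivity)]
      push_cast
      nlinarith
    linarith
  have happ : |α - q.num / q.den| ≤ 1 / (q.den : ℝ) ^ 2 := by
    rw [← hqc]
    refine hq.trans ?_
    apply one_div_le_one_div_of_le (by positivity)
    have : (q.den : ℝ) ≤ (K.succ : ℕ) := by exact_mod_cast hqK
    nlinarith
  set b := round ((q.den : ℝ) * γ) with hb
  have hbr : |(q.den : ℝ) * γ - b| ≤ 1 / 2 := abs_sub_round _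
  have hcop : IsCoprime q.num (q.den : ℤ) := by
    rw [Int.isCoprime_iff_gcd_eq_one]
    have := q.reduced
    rwa [Nat.Coprime, ← Int.natAbs_natCast q.den] at this
  obtain ⟨u, w, huw⟩ := hcop
  have hd0 : (q.den : ℤ) ≠ 0 := by exact_mod_cast q.den_ne_zero
  set r := (b * u) % (q.den : ℤ) with hr
  have hr0 : 0 ≤ r := Int.emod_nonneg _ hd0
  have hr1 : r < q.den := Int.emod_lt_of_pos _ (by exact_mod_cast q.den_pos)
  obtain ⟨s, hs⟩ : ∃ s : ℤ, ((q.den : ℤ) + r) * q.num = b + q.den * s := by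
    have h1 := Int.emod_add_mul_ediv (b * u) (q.den : ℤ)
    refine ⟨q.num - (b * u / q.den) * q.num - b * w, ?_⟩
    rw [← hr] at h1
    linear_combination q.num * h1 + b * huw
  refine ⟨q.den + r.toNat, by omega, s, ?_⟩
  have hnr : ((q.den + r.toNat : ℕ) : ℝ) = q.den + r := by
    have : ((q.den + r.toNat : ℕ) : ℤ) = q.den + r := by
      push_cast; rw [Int.toNat_of_nonneg hr0]
    exact_mod_cast this
  rw [hnr]
  have hrr : (0 : ℝ) ≤ r := by exact_mod_cast hr0
  have hrr1 : (r : ℝ) ≤ q.den := by exact_mod_cast hr1.le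
  have hsr : ((q.den : ℝ) + r) * q.num = b + q.den * s := by exact_mod_cast hs
  have e : ((q.den : ℝ) + r) * α - γ - s =
      (q.den + r) * (α - q.num / q.den) - (q.den * γ - b) / q.den := by
    field_simp
    linear_combination hsr
  have h1 : |((q.den : ℝ) + r) * α - γ - s| ≤ (5 / 2) / q.den := by
    rw [e]
    refine (abs_sub _ _).trans ?_
    rw [abs_mul, abs_div, abs_of_pos hQ, abs_of_nonneg (by positivity : (0 : ℝ) ≤ q.den + r)]
    calc ((q.den : ℝ) + r) * |α - q.num / q.den| + |q.den * γ - b| / q.den ≤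
          (q.den + q.den) * (1 / (q.den : ℝ) ^ 2) + (1 / 2) / q.den := by gcongr
      _ = _ := by field_simp; norm_num
  calc ((q.den : ℝ) + r) * |(q.den + r) * α - γ - s| ≤ (q.den + q.den) * ((5 / 2) / q.den) := by
        gcongr
    _ = 5 := by field_simp; norm_num

/-- The scale `t` admits a window of depth `g`. -/
def IsWindow (k : ℕ) (ε α γ : ℝ) (t g : ℕ) : Prop :=
  36 ≤ g ∧ g ≤ t ∧ ∃ n : ℕ, (k : ℝ) ^ (2 * t + 10 * g) ≤ n ∧ (n : ℝ) ≤ (k : ℝ) ^ (2 * t + 10 * g + 2) ∧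
    (∃ b : ℤ, (n : ℝ) * |n * α - γ - b| ≤ 5) ∧
    15 * (1 / 2 : ℝ) ^ g < Real.log (Real.log n) ^ ((3 : ℝ) + ε) / Real.log n

theorem exists_quadratic_lt_two_pow (A : ℝ) :
    ∃ G : ℕ, ∀ g : ℕ, G ≤ g → A * (g + 2 : ℝ) ^ 2 < 2 ^ g := by
  have h1 := tendsto_pow_const_div_const_pow_of_one_lt 2 (by norm_num : (1 : ℝ) < 2)
  have h2 : (0 : ℝ) < 1 / (9 * (|A| + 1)) := by positivity
  obtain ⟨G, hG⟩ := Filter.eventually_atTop.mp (h1.eventually (gt_mem_nhds h2))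
  refine ⟨max G 1, fun g hg => ?_⟩
  have hg1 : (1 : ℝ) ≤ g := by exact_mod_cast (le_max_right _ _).trans hg
  have h3 := hG g ((le_max_left _ _).trans hg)
  rw [div_lt_div_iff₀ (by positivity) (by positivity), one_mul] at h3
  refine lt_of_le_of_lt ?_ h3
  have h4 : A ≤ |A| + 1 := (le_abs_self A).trans (by linarith)
  calc A * (g + 2 : ℝ) ^ 2 ≤ (|A| + 1) * (g + 2 : ℝ) ^ 2 := by gcongr
    _ ≤ (|A| + 1) * (9 * (g : ℝ) ^ 2) := by
        gcongr
        nlinarith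
    _ = _ := by ring

theorem exists_isWindow {k : ℕ} (hk : 3 ≤ k) {ε : ℝ} (hε : 0 < ε) {α : ℝ} (hα : Irrational α)
    (γ : ℝ) (v T : ℕ) : ∃ t, T ≤ t ∧ ∃ g, IsWindow k ε α γ t g ∧ v * g ≤ t := by
  have hk3 : (3 : ℝ) ≤ k := by exact_mod_cast hk
  have hk1 : (1 : ℝ) < k := by linarith
  have hlogk : 1 ≤ Real.log k := by
    rw [Real.le_log_iff_exp_le (by linarith)]
    exact Real.exp_one_lt_three.le.trans hk3
  obtain ⟨G₀, hG₀⟩ := exists_quadratic_lt_two_pow (30 * Real.log k)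
  set G := G₀ + T + v + 50 with hG
  obtain ⟨n, hn, b, hb⟩ := exists_inhomogeneous_approx hα γ (k ^ (2 * G ^ 2))
  have hnr : (k : ℝ) ^ (2 * G ^ 2) ≤ n := by exact_mod_cast hn
  have hn1 : (1 : ℝ) ≤ n := le_trans (one_le_pow₀ hk1.le) hnr
  obtain ⟨L, hL1, hL2⟩ := exists_nat_pow_near hn1 (one_lt_pow₀ hk1 (two_ne_zero))
  rw [← pow_mul] at hL1 hL2
  have hLG : G ^ 2 ≤ L := by
    have := hnr.trans_lt hL2
    rw [pow_lt_pow_iff_right₀ hk1] at this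
    omega
  set g := Nat.sqrt L with hg
  have hgG : G ≤ g := by rw [hg, Nat.le_sqrt']; exact hLG
  have hgL : g ^ 2 ≤ L := Nat.sqrt_le' L
  have hLg : L < (g + 1) ^ 2 := Nat.lt_succ_sqrt' L
  have hvg : v * g + 5 * g ≤ L := by
    calc v * g + 5 * g = (v + 5) * g := by ring
      _ ≤ g * g := by gcongr; omega
      _ ≤ L := by rw [← pow_two]; exact hgL
  have hTg : T + 5 * g ≤ L := by
    have : (T + 50) * g ≤ g * g := Nat.mul_le_mul_right g (by omega)
    nlinarith
  have h6 : 6 * g ≤ L := by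
    have : 6 * g ≤ g * g := Nat.mul_le_mul_right g (by omega)
    nlinarith
  have e : 2 * (L - 5 * g) + 10 * g = 2 * L := by omega
  refine ⟨L - 5 * g, by omega, g, ⟨by omega, by omega, n, by rw [e]; exact hL1,
    by rw [e]; exact hL2.le, ⟨b, hb⟩, ?_⟩, by omega⟩
  have hlog_up : Real.log n ≤ 2 * (g + 2 : ℝ) ^ 2 * Real.log k := by
    calc Real.log n ≤ Real.log ((k : ℝ) ^ (2 * (L + 1))) := Real.log_le_log (by linarith) hL2.le
      _ = 2 * ((L : ℝ) + 1) * Real.log k := by rw [Real.log_pow]; push_cast; ring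
      _ ≤ 2 * (g + 2 : ℝ) ^ 2 * Real.log k := by
          gcongr
          have : ((L + 1 : ℕ) : ℝ) ≤ (((g + 2) ^ 2 : ℕ) : ℝ) := by
            exact_mod_cast hLg.trans_le (Nat.pow_le_pow_left (by omega) 2)
          push_cast at this
          exact this
  have hlog_low : 3 ≤ Real.log n := by
    calc (3 : ℝ) ≤ 2 * (L : ℝ) * 1 := by
          have : (2 : ℝ) ≤ L := by exact_mod_cast (by omega : 2 ≤ L)
          linarith
      _ ≤ 2 * (L : ℝ) * Real.log k := by gcongr
      _ = Real.log ((k : ℝ) ^ (2 * L)) := by rw [Real.log_pow]; push_cast; ring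
      _ ≤ Real.log n := Real.log_le_log (by positivity) hL1
  have hloglog : 1 ≤ Real.log (Real.log n) := by
    rw [Real.le_log_iff_exp_le (by linarith)]
    exact Real.exp_one_lt_three.le.trans hlog_low
  have hrp : 1 ≤ Real.log (Real.log n) ^ ((3 : ℝ) + ε) := Real.one_le_rpow hloglog (by linarith)
  have h5 := hG₀ g (by omega)
  calc 15 * (1 / 2 : ℝ) ^ g < 1 / Real.log n := by
        rw [one_div_pow, mul_one_div, div_lt_div_iff₀ (by positivity) (by linarith), one_mul]
        refine lt_of_le_of_lt ?_ h5
        nlinarith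
    _ ≤ _ := by gcongr

/-- A schedule of scales with sparse windows. -/
theorem exists_schedule {P : ℕ → ℕ → Prop}
    (hP : ∀ v T, ∃ t, T ≤ t ∧ ∃ g, P t g ∧ v * g ≤ t) (v : ℕ) :
    ∃ (τ W : ℕ → ℕ) (win : ℕ → Prop), τ 0 = 0 ∧ W 0 = 0 ∧
      (∀ i, ¬ win i → τ (i + 1) = τ i + 1 ∧ W (i + 1) = W i) ∧
      (∀ i, win i → ∃ g, P (τ i) g ∧ τ (i + 1) = τ i + 7 * g ∧ W (i + 1) = W i + 7 * g) ∧
      (∀ i, v * W (i + 1) ≤ τ i) ∧ ∀ i, ∃ j, i ≤ j ∧ win j := by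
  classical
  let elig : ℕ × ℕ → Prop := fun s => ∃ g, P s.1 g ∧ v * (s.2 + 7 * g) ≤ s.1
  let next : ℕ × ℕ → ℕ × ℕ := fun s =>
    if h : elig s then (s.1 + 7 * h.choose, s.2 + 7 * h.choose) else (s.1 + 1, s.2)
  let st : ℕ → ℕ × ℕ := fun i => next^[i] (0, 0)
  have hst : ∀ i, st (i + 1) = next (st i) := fun i => Function.iterate_succ_apply' _ _ _
  have hord : ∀ i, ¬ elig (st i) → (st (i + 1)).1 = (st i).1 + 1 ∧ (st (i + 1)).2 = (st i).2 := by
    intro i hi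
    simp only [hst, next, dif_neg hi, and_self]
  have hwin : ∀ i, elig (st i) → ∃ g, P (st i).1 g ∧ v * ((st i).2 + 7 * g) ≤ (st i).1 ∧
      (st (i + 1)).1 = (st i).1 + 7 * g ∧ (st (i + 1)).2 = (st i).2 + 7 * g := by
    intro i hi
    refine ⟨hi.choose, hi.choose_spec.1, hi.choose_spec.2, ?_⟩
    simp only [hst, next, dif_pos hi, and_self]
  refine ⟨fun i => (st i).1, fun i => (st i).2, fun i => elig (st i), rfl, rfl, hord, ?_, ?_, ?_⟩
  · intro i hi
    obtain ⟨g, h1, _, h2⟩ := hwin i hi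
    exact ⟨g, h1, h2⟩
  · have hmono : ∀ i, (st i).1 ≤ (st (i + 1)).1 := by
      intro i
      by_cases hi : elig (st i)
      · obtain ⟨g, _, _, h2, _⟩ := hwin i hi
        omega
      · have := hord i hi
        omega
    intro i
    induction i with
    | zero =>
      by_cases hi : elig (st 0)
      · obtain ⟨g, _, h1, _, h2⟩ := hwin 0 hi
        simp only [h2]
        exact h1
      · simp only [(hord 0 hi).2]
        show v * 0 ≤ 0
        simp
    | succ i ih =>
      by_cases hi : elig (st (i + 1))
      · obtain ⟨g, _, h1, _, h2⟩ := hwin (i + 1) hi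
        simp only [h2]
        exact h1
      · simp only [(hord (i + 1) hi).2]
        exact ih.trans (hmono i)
  · by_contra! hcon
    obtain ⟨i, hi⟩ := hcon
    have hrun : ∀ q, (st (i + q)).1 = (st i).1 + q ∧ (st (i + q)).2 = (st i).2 := by
      intro q
      induction q with
      | zero => simp
      | succ q ih =>
        have := hord (i + q) (hi _ (by omega))
        rw [← add_assoc]
        omega
    obtain ⟨t, ht, g, hPg, hg⟩ := hP (14 * v) ((st i).1 + 2 * v * (st i).2)
    have hq := hrun (t - (st i).1)
    apply hi (i + (t - (st i).1)) (by omega)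
    refine ⟨g, ?_, ?_⟩
    · rw [hq.1]
      convert hPg using 1
      omega
    · rw [hq.1, hq.2]
      have e1 : 2 * (v * ((st i).2 + 7 * g)) = 2 * v * (st i).2 + 14 * v * g := by ring
      omega

open scoped ENNReal NNReal

/-- Mass distribution principle. -/
theorem mass_distribution {Ω X : Type*} [MeasurableSpace Ω] [EMetricSpace X]
    (μ : Measure Ω) [IsProbabilityMeasure μ] (f : Ω → X) (s : ℝ≥0) {C : ℝ≥0∞} (hC : C ≠ ⊤)
    (h : ∀ x : X, ∀ d : ℝ, 0 < d → d < 1 →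
      μ (f ⁻¹' Metric.closedEBall x (ENNReal.ofReal d)) ≤ C * ENNReal.ofReal d ^ (s : ℝ)) :
    (s : ℝ≥0∞) ≤ dimH (Set.range f) := by
  borelize X
  apply le_dimH_of_hausdorffMeasure_ne_zero
  have hset : ∀ U : Set X, Metric.ediam U ≤ ENNReal.ofReal (1 / 2) →
      μ (f ⁻¹' U) ≤ C * ⨆ _ : U.Nonempty, Metric.ediam U ^ (s : ℝ) := by
    intro U hU
    rcases U.eq_empty_or_nonempty with rfl | hne
    · simp
    rw [iSup_pos hne]
    obtain ⟨x, hx⟩ := hne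
    have hfin : Metric.ediam U ≠ ⊤ := ne_top_of_le_ne_top ENNReal.ofReal_ne_top hU
    set D := (Metric.ediam U).toReal with hD
    have hDU : ENNReal.ofReal D = Metric.ediam U := ENNReal.ofReal_toReal hfin
    have hD1 : D < 1 := by
      have := ENNReal.toReal_mono ENNReal.ofReal_ne_top hU
      rw [ENNReal.toReal_ofReal (by norm_num)] at this
      linarith
    have hD0 : 0 ≤ D := ENNReal.toReal_nonneg
    rw [← hDU]
    have ht : Filter.Tendsto (fun r : ℝ => C * ENNReal.ofReal r ^ (s : ℝ)) (nhdsWithin D (Set.Ioi D))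
        (nhds (C * ENNReal.ofReal D ^ (s : ℝ))) := by
      apply ENNReal.Tendsto.const_mul _ (Or.inr hC)
      apply Filter.Tendsto.mono_left _ nhdsWithin_le_nhds
      exact (ENNReal.continuous_rpow_const.comp ENNReal.continuous_ofReal).tendsto D
    refine ge_of_tendsto ht ?_
    filter_upwards [Ioo_mem_nhdsGT hD1] with r hr
    refine (measure_mono (Set.preimage_mono fun y hy => ?_)).trans
      (h x r (hD0.trans_lt hr.1) hr.2)
    rw [Metric.mem_closedEBall]
    refine (Metric.edist_le_ediam_of_mem hy hx).trans ?_
    rw [← hDU]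
    exact ENNReal.ofReal_le_ofReal hr.1.le
  have hlow : 1 / C ≤ Measure.hausdorffMeasure (s : ℝ) (Set.range f) := by
    rw [Measure.hausdorffMeasure_apply]
    refine le_iSup₂_of_le (ENNReal.ofReal (1 / 2)) (by simp) ?_
    refine le_iInf fun t => le_iInf fun ht => le_iInf fun hd => ?_
    apply ENNReal.div_le_of_le_mul'
    rw [← ENNReal.tsum_mul_left]
    calc (1 : ℝ≥0∞) = μ Set.univ := measure_univ.symm
      _ ≤ μ (⋃ n, f ⁻¹' t n) := by
          apply measure_mono
          intro ω _
          rw [← Set.preimage_iUnion]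
          exact ht ⟨ω, rfl⟩
      _ ≤ ∑' n, μ (f ⁻¹' t n) := measure_iUnion_le _
      _ ≤ _ := ENNReal.tsum_le_tsum fun n => hset _ (hd n)
  have hpos : 0 < 1 / C := ENNReal.div_pos one_ne_zero hC
  exact (hpos.trans_le hlow).ne'

theorem exists_finset_cells_of_dist {B : ℝ} (hB : 0 < B) (x : ℝ) {d : ℝ} (hd : 1 ≤ d * B) :
    ∃ T : Finset ℤ, (T.card : ℝ) ≤ 6 * (d * B) ∧
      ∀ j : ℤ, (∃ z ∈ cell B j, |z - x| ≤ d) → j ∈ T := by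
  obtain ⟨T, hT, hT'⟩ := exists_finset_cells_near hB x ⌈d * B⌉₊
  refine ⟨T, ?_, fun j ⟨z, hz, hzx⟩ => hT' j ⟨z, hz, hzx.trans ?_⟩⟩
  · have h1 : (T.card : ℝ) ≤ 2 * (⌈d * B⌉₊ : ℝ) + 2 := by exact_mod_cast hT
    have h2 := Nat.ceil_lt_add_one (by linarith : 0 ≤ d * B)
    linarith
  · rw [le_div_iff₀ hB]
    exact Nat.le_ceil _

theorem exists_finset_boxes_of_dist {k : ℕ} (hk : 1 ≤ k) (t : ℕ) (x : ℝ × ℝ) {d : ℝ} (hd0 : 0 < d)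
    (hd : 1 ≤ d * (k : ℝ) ^ t) :
    ∃ T : Finset (ℤ × ℤ), (T.card : ℝ) ≤ 36 * d ^ 2 * (k : ℝ) ^ (3 * t) ∧
      ∀ p, (∃ z ∈ box k t p, |z.1 - x.1| ≤ d ∧ |z.2 - x.2| ≤ d) → p ∈ T := by
  have hk1 : (1 : ℝ) ≤ k := by exact_mod_cast hk
  have hd' : 1 ≤ d * (k : ℝ) ^ (2 * t) :=
    hd.trans (by gcongr; omega)
  obtain ⟨T₁, h1, h1'⟩ := exists_finset_cells_of_dist (by positivity) x.1 hd'
  obtain ⟨T₂, h2, h2'⟩ := exists_finset_cells_of_dist (by positivity) x.2 hd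
  refine ⟨T₁ ×ˢ T₂, ?_, fun p ⟨z, hz, hz1, hz2⟩ => ?_⟩
  · rw [Finset.card_product]
    push_cast
    calc (T₁.card : ℝ) * T₂.card ≤ (6 * (d * (k : ℝ) ^ (2 * t))) * (6 * (d * (k : ℝ) ^ t)) := by
          gcongr
      _ = _ := by ring
  · exact Finset.mem_product.mpr ⟨h1' _ ⟨z.1, hz.1, hz1⟩, h2' _ ⟨z.2, hz.2, hz2⟩⟩

theorem branching_mass_le {k M v o W τ' : ℕ} (hv : 1 ≤ v) (hkv : 8 ^ v ≤ k) (hM : k ^ 3 ≤ 8 * M)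
    (hW : v * W ≤ τ') (ho : o ≤ τ' + 1) {d : ℝ} (hd : 0 < d) (hd1 : d * (k : ℝ) ^ τ' < 1) :
    36 * d ^ 2 * (k : ℝ) ^ (3 * (o + W)) * (1 / (M : ℝ)) ^ o ≤ 36 * k * d ^ (2 - 5 / v : ℝ) := by
  have hk1' : 1 ≤ k := le_trans Nat.one_le_two_pow (le_trans (Nat.pow_le_pow_left (by norm_num) v) hkv)
  have hk1 : (1 : ℝ) ≤ k := by exact_mod_cast hk1'
  have hk0 : (0 : ℝ) < k := by linarith
  have hMr : (k : ℝ) ^ 3 ≤ 8 * M := by exact_mod_cast hM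
  have hM0 : (0 : ℝ) < M := by
    have : 0 < (k : ℝ) ^ 3 := by positivity
    linarith
  have h1 : (1 / (M : ℝ)) ^ o ≤ (8 / (k : ℝ) ^ 3) ^ o := by
    gcongr ?_ ^ o
    rw [div_le_div_iff₀ hM0 (by positivity), one_mul]
    exact hMr
  have hv0 : (v : ℝ) ≠ 0 := by positivity
  set y := d ^ (-(5 / v : ℝ)) with hy
  have hy0 : 0 < y := by positivity
  have hyv : y ^ v = (1 / d) ^ 5 := by
    rw [hy, ← Real.rpow_natCast, ← Real.rpow_mul hd.le, show -(5 / (v : ℝ)) * v = -((5 : ℕ) : ℝ) by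
      field_simp; norm_num, Real.rpow_neg hd.le, Real.rpow_natCast, one_div_pow, one_div]
  have hkd : (k : ℝ) ^ τ' ≤ 1 / d := by
    rw [le_div_iff₀ hd, mul_comm]; exact hd1.le
  have hx : (k : ℝ) ^ (3 * W) * 8 ^ o ≤ k * y := by
    refine le_of_pow_le_pow_left₀ (by omega : v ≠ 0) (by positivity) ?_
    have h8 : (8 : ℝ) ^ v ≤ k := by exact_mod_cast hkv
    calc ((k : ℝ) ^ (3 * W) * 8 ^ o) ^ v = (k : ℝ) ^ (3 * (v * W)) * ((8 : ℝ) ^ v) ^ o := by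
          rw [mul_pow, ← pow_mul, ← pow_mul, ← pow_mul, mul_comm o v]; ring_nf
      _ ≤ (k : ℝ) ^ (3 * τ') * (k : ℝ) ^ o := by
          gcongr
      _ = (k : ℝ) ^ (3 * τ' + o) := by rw [pow_add]
      _ ≤ (k : ℝ) ^ (5 * τ' + 1) := pow_le_pow_right₀ hk1 (by omega)
      _ = k * ((k : ℝ) ^ τ') ^ 5 := by ring
      _ ≤ (k : ℝ) ^ v * (1 / d) ^ 5 := by
          gcongr
          calc (k : ℝ) = (k : ℝ) ^ 1 := (pow_one _).symm
            _ ≤ (k : ℝ) ^ v := pow_le_pow_right₀ hk1 hv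
      _ = (k * y) ^ v := by rw [mul_pow, hyv]
  have hdd : d ^ (2 - 5 / v : ℝ) = d ^ 2 * y := by
    rw [hy, sub_eq_add_neg, Real.rpow_add hd]
    norm_cast
  calc 36 * d ^ 2 * (k : ℝ) ^ (3 * (o + W)) * (1 / (M : ℝ)) ^ o ≤
        36 * d ^ 2 * (k : ℝ) ^ (3 * (o + W)) * (8 / (k : ℝ) ^ 3) ^ o := by gcongr
    _ = 36 * d ^ 2 * ((k : ℝ) ^ (3 * W) * 8 ^ o) := by
        rw [div_pow, ← pow_mul, mul_add, pow_add]; field_simp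
    _ ≤ 36 * d ^ 2 * (k * y) := by gcongr
    _ = _ := by rw [hdd]; ring

theorem box_index_unique {k : ℕ} (hk : 1 ≤ k) {t t' : ℕ} {p p' q : ℤ × ℤ}
    (h : box k t' q ⊆ box k t p) (h' : box k t' q ⊆ box k t p') : p = p' := by
  have hk0 : (0 : ℝ) < k := by exact_mod_cast hk
  have hne : (box k t' q).Nonempty :=
    ⟨(_, _), left_mem_cell (by positivity) q.1, left_mem_cell (by positivity) q.2⟩
  have h1 := (Set.prod_subset_prod_iff.mp h).resolve_right
    (by rw [← Set.prod_eq_empty_iff]; exact hne.ne_empty)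
  have h2 := (Set.prod_subset_prod_iff.mp h').resolve_right
    (by rw [← Set.prod_eq_empty_iff]; exact hne.ne_empty)
  exact Prod.ext (cell_index_unique (by positivity) (by positivity) h1.1 h2.1)
    (cell_index_unique (by positivity) (by positivity) h1.2 h2.2)

theorem infinitePi_agree_le {M : ℕ} [NeZero M] (F : Finset ℕ) (A : Set (ℕ → Fin M))
    (hA : ∀ ω ∈ A, ∀ ω' ∈ A, ∀ j ∈ F, ω j = ω' j) :
    Measure.infinitePi (fun _ : ℕ => (PMF.uniformOfFintype (Fin M)).toMeasure) A ≤
      (M : ℝ≥0∞)⁻¹ ^ F.card := by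
  rcases A.eq_empty_or_nonempty with rfl | ⟨ω₀, h₀⟩
  · simp
  refine (measure_mono (t := Set.pi (F : Set ℕ) fun j => {ω₀ j}) ?_).trans ?_
  · intro ω hω j hj
    exact hA ω hω ω₀ h₀ j hj
  · rw [Measure.infinitePi_pi _ (fun j _ => MeasurableSet.singleton _)]
    simp

theorem tree_dimension {k M v : ℕ} (hv : 3 ≤ v) (hkv : 8 ^ v ≤ k) (hM : k ^ 3 ≤ 8 * M)
    {τ W : ℕ → ℕ} {win : ℕ → Prop} (hτ0 : τ 0 = 0) (hW0 : W 0 = 0)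
    (hord : ∀ i, ¬ win i → τ (i + 1) = τ i + 1 ∧ W (i + 1) = W i)
    (hwin : ∀ i, win i → ∃ g, 1 ≤ g ∧ τ (i + 1) = τ i + g ∧ W (i + 1) = W i + g)
    (hW : ∀ i, v * W (i + 1) ≤ τ i) {Good : ℕ → ℤ × ℤ → Prop} {p₀ : ℤ × ℤ} (hroot : Good 0 p₀)
    (hstep : ∀ i p, Good i p → ∃ c : Fin M → ℤ × ℤ, (¬ win i → Function.Injective c) ∧
      ∀ x, Good (i + 1) (c x) ∧ box k (τ (i + 1)) (c x) ⊆ box k (τ i) p) :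
    ∃ G : Set (ℝ × ℝ), (∀ x ∈ G, ∃ p : ℕ → ℤ × ℤ, ∀ i, Good i (p i) ∧ x ∈ box k (τ i) (p i)) ∧
      ((2 - 5 / v : ℝ).toNNReal : ℝ≥0∞) ≤ dimH G := by
  classical
  have hk : 1 ≤ k := le_trans (Nat.one_le_pow _ _ (by norm_num)) hkv
  have hk0 : (0 : ℝ) < k := by exact_mod_cast hk
  have hM1 : 1 ≤ M := by
    have := Nat.one_le_pow 3 k hk
    omega
  have : NeZero M := ⟨by omega⟩
  choose c hinj hc using hstep
  obtain ⟨node, hsucc⟩ : ∃ node : (ℕ → Fin M) → ∀ i, {p // Good i p},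
      ∀ ω i, (node ω (i + 1)).1 = c i (node ω i).1 (node ω i).2 (ω i) :=
    ⟨fun ω i => Nat.rec (motive := fun i => {p // Good i p}) ⟨p₀, hroot⟩
      (fun i p => ⟨c i p.1 p.2 (ω i), (hc i p.1 p.2 (ω i)).1⟩) i, fun ω i => rfl⟩
  have hnest : ∀ ω i j, i ≤ j → box k (τ j) (node ω j).1 ⊆ box k (τ i) (node ω i).1 := by
    intro ω i j hij
    induction j, hij using Nat.le_induction with
    | base => exact subset_rfl
    | succ j _ ih =>
      rw [hsucc]
      exact (hc j _ _ _).2.trans ih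
  have hpt : ∀ ω, ∃ x, ∀ i, x ∈ box k (τ i) (node ω i).1 := by
    intro ω
    have hcomp : ∀ i, IsCompact (box k (τ i) (node ω i).1) := fun i => isCompact_Icc.prod isCompact_Icc
    obtain ⟨x, hx⟩ := IsCompact.nonempty_iInter_of_sequence_nonempty_isCompact_isClosed
      (fun i => box k (τ i) (node ω i).1) (fun i => hnest ω i (i + 1) (by omega))
      (fun i => ⟨(_, _), left_mem_cell (by positivity) _, left_mem_cell (by positivity) _⟩)
      (hcomp 0) (fun i => (hcomp i).isClosed)
    exact ⟨x, Set.mem_iInter.mp hx⟩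
  choose f hf using hpt
  refine ⟨range f, ?_, ?_⟩
  · rintro _ ⟨ω, rfl⟩
    exact ⟨fun i => (node ω i).1, fun i => ⟨(node ω i).2, hf ω i⟩⟩
  have hagree : ∀ i p, ∀ ω ∈ {ω | (node ω i).1 = p}, ∀ ω' ∈ {ω | (node ω i).1 = p},
      ∀ j ∈ (Finset.range i).filter (¬ win ·), ω j = ω' j := by
    intro i p ω hω ω' hω' j hj
    obtain ⟨hji, hjw⟩ := Finset.mem_filter.mp hj
    rw [Finset.mem_range] at hji
    simp only [Set.mem_ofPred_eq] at hω hω'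
    have heq : ∀ l ≤ i, (node ω l).1 = (node ω' l).1 := by
      intro l hl
      have h1 := hnest ω l i hl
      have h2 := hnest ω' l i hl
      rw [hω] at h1
      rw [hω'] at h2
      exact box_index_unique hk h1 h2
    have h1 := heq j hji.le
    have h2 := heq (j + 1) hji
    rw [hsucc, hsucc, ← Subtype.ext h1] at h2
    exact hinj j _ _ hjw h2
  have hcard : ∀ i, ((Finset.range i).filter (¬ win ·)).card + W i = τ i := by
    intro i
    induction i with
    | zero => simp [hτ0, hW0]
    | succ i ih =>
      rw [Finset.range_add_one, Finset.filter_insert]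
      by_cases h : win i
      · obtain ⟨g, -, h1, h2⟩ := hwin i h
        simp only [h, not_true_eq_false, if_false]
        omega
      · obtain ⟨h1, h2⟩ := hord i h
        simp only [h, not_false_eq_true, if_true]
        rw [Finset.card_insert_of_notMem (by simp)]
        omega
  have hτi : ∀ i, i ≤ τ i := by
    intro i
    induction i with
    | zero => omega
    | succ i ih =>
      by_cases h : win i
      · obtain ⟨g, h0, h1, h2⟩ := hwin i h
        omega
      · have := (hord i h).1
        omega
  have hk2 : (1 : ℝ) < k := by
    have : 8 ^ 1 ≤ k := (Nat.pow_le_pow_right (by norm_num) (by omega)).trans hkv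
    exact_mod_cast (by omega : 1 < k)
  refine mass_distribution
    (Measure.infinitePi (fun _ : ℕ => (PMF.uniformOfFintype (Fin M)).toMeasure)) f _
    (C := ENNReal.ofReal (36 * k)) ENNReal.ofReal_ne_top ?_
  intro x d hd0 hd1
  have hex : ∃ i, 1 ≤ d * (k : ℝ) ^ τ i := by
    obtain ⟨i, hi⟩ := pow_unbounded_of_one_lt (1 / d) hk2
    refine ⟨i, ?_⟩
    rw [div_lt_iff₀ hd0, mul_comm] at hi
    refine hi.le.trans ?_
    gcongr
    · exact hk2.le
    · exact hτi i
  obtain ⟨i, hi, hmin⟩ : ∃ i, 1 ≤ d * (k : ℝ) ^ τ (i + 1) ∧ d * (k : ℝ) ^ τ i < 1 := by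
    have h1 := Nat.find_spec hex
    rcases hn : Nat.find hex with _ | i
    · rw [hn, hτ0] at h1
      simp at h1
      linarith
    · rw [hn] at h1
      exact ⟨i, h1, not_le.mp (Nat.find_min hex (by omega : i < Nat.find hex))⟩
  obtain ⟨T, hT, hT'⟩ := exists_finset_boxes_of_dist hk (τ (i + 1)) x hd0 hi
  set o := ((Finset.range (i + 1)).filter (¬ win ·)).card with ho
  have ho1 : o ≤ τ i + 1 := by
    have h1 := hcard i
    have h2 : o ≤ ((Finset.range i).filter (¬ win ·)).card + 1 := by
      rw [ho, Finset.range_add_one, Finset.filter_insert]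
      split_ifs
      · omega
      · exact Finset.card_insert_le _ _
    omega
  have hmass := branching_mass_le (by omega : 1 ≤ v) hkv hM (hW i) ho1 hd0 hmin
  rw [hcard (i + 1)] at hmass
  have hs : (0 : ℝ) ≤ 2 - 5 / v := by
    have : (3 : ℝ) ≤ v := by exact_mod_cast hv
    rw [sub_nonneg, div_le_iff₀ (by positivity)]
    linarith
  calc _ ≤ Measure.infinitePi (fun _ : ℕ => (PMF.uniformOfFintype (Fin M)).toMeasure)
        (⋃ p ∈ T, {ω | (node ω (i + 1)).1 = p}) := by
        refine measure_mono fun ω hω => ?_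
        simp only [Set.mem_iUnion]
        refine ⟨(node ω (i + 1)).1, hT' _ ⟨f ω, hf ω _, ?_⟩, rfl⟩
        rw [Set.mem_preimage, Metric.mem_closedEBall, edist_dist,
          ENNReal.ofReal_le_ofReal_iff hd0.le, Prod.dist_eq, max_le_iff] at hω
        exact hω
    _ ≤ ∑ p ∈ T, Measure.infinitePi (fun _ : ℕ => (PMF.uniformOfFintype (Fin M)).toMeasure)
        {ω | (node ω (i + 1)).1 = p} := measure_biUnion_finset_le _ _
    _ ≤ ∑ p ∈ T, (M : ℝ≥0∞)⁻¹ ^ o := Finset.sum_le_sum fun p _ =>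
        infinitePi_agree_le _ _ (hagree (i + 1) p)
    _ = ENNReal.ofReal (T.card * (1 / (M : ℝ)) ^ o) := by
        rw [Finset.sum_const, nsmul_eq_mul, ENNReal.ofReal_mul (by positivity),
          ENNReal.ofReal_natCast, ENNReal.ofReal_pow (by positivity), one_div,
          ENNReal.ofReal_inv_of_pos (by exact_mod_cast hM1), ENNReal.ofReal_natCast]
    _ ≤ ENNReal.ofReal (36 * k * d ^ (2 - 5 / v : ℝ)) := by
        refine ENNReal.ofReal_le_ofReal (le_trans ?_ hmass)
        gcongr
    _ = _ := by
        rw [ENNReal.ofReal_mul (by positivity), ENNReal.ofReal_rpow_of_pos hd0,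
          Real.coe_toNNReal _ hs]

theorem nint_nonneg (x : ℝ) : 0 ≤ nint x := Real.iInf_nonneg fun _ => abs_nonneg _

theorem nint_le (x : ℝ) (a : ℤ) : nint x ≤ |x - a| :=
  ciInf_le ⟨0, by rintro _ ⟨n, rfl⟩; exact abs_nonneg _⟩ a

theorem le_mul_nint {c x m : ℝ} (hm : 0 < m) (h : ∀ a : ℤ, c ≤ m * |x - a|) : c ≤ m * nint x := by
  rw [← div_le_iff₀' hm]
  exact le_ciInf fun a => by rw [div_le_iff₀' hm]; exact h a

/-- On the set `S`, some integer `n ≥ N` realises the required product bound. -/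
def Hit (ε α γ : ℝ) (N : ℕ) (S : Set (ℝ × ℝ)) : Prop :=
  ∃ n : ℕ, N ≤ n ∧ 0 < n ∧ ∀ x ∈ S, (n : ℝ) * nint (n * α - γ) * nint (n * x.1 - x.2) <
    Real.log (Real.log n) ^ ((3 : ℝ) + ε) / Real.log n

theorem goodBox_hit {k : ℕ} (hk : 2 ^ 200 ≤ k) {ε α γ : ℝ} {t g : ℕ} {p : ℤ × ℤ}
    (H : GoodBox k t p) (hw : IsWindow k ε α γ t g) :
    ∃ p', GoodBox k (t + 7 * g) p' ∧ box k (t + 7 * g) p' ⊆ box k t p ∧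
      Hit ε α γ t (box k (t + 7 * g) p') := by
  obtain ⟨hg, hgt, n, hn1, hn2, ⟨b, hb⟩, hlog⟩ := hw
  obtain ⟨p', h1, h2, a, ha⟩ := goodBox_window hk H hg hgt hn1 hn2
  have hk2 : 2 ≤ k := le_trans (by norm_num) hk
  have htn : t < n := by
    have h3 : t < k ^ t := Nat.lt_pow_self hk2
    have h4 : k ^ t ≤ k ^ (2 * t + 10 * g) := Nat.pow_le_pow_right (by omega) (by omega)
    have h5 : k ^ (2 * t + 10 * g) ≤ n := by exact_mod_cast hn1
    omega
  refine ⟨p', h1, h2, n, htn.le, by omega, fun x hx => lt_of_le_of_lt ?_ hlog⟩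
  calc (n : ℝ) * nint (n * α - γ) * nint (n * x.1 - x.2)
      ≤ ((n : ℝ) * |n * α - γ - b|) * |n * x.1 - x.2 - a| := by
        gcongr
        · exact nint_nonneg _
        · exact nint_le _ _
        · exact nint_le _ _
    _ ≤ 5 * (3 * (1 / 2) ^ g) := by
        gcongr
        exact ha x hx
    _ = 15 * (1 / 2) ^ g := by ring

theorem mem_calB_of_goodBox {k : ℕ} (hk : 2 ≤ k) {τ : ℕ → ℕ} (hτ : ∀ i, i ≤ τ i) {x : ℝ × ℝ}
    {p : ℕ → ℤ × ℤ} (hp : ∀ i, GoodBox k (τ i) (p i) ∧ x ∈ box k (τ i) (p i)) : x ∈ calB := by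
  have hk1 : (1 : ℝ) < k := by exact_mod_cast (by omega : 1 < k)
  have hk0 : (0 : ℝ) < k := by linarith
  have hbig : ∀ (m h : ℕ), ∃ i, (m : ℝ) ≤ (k : ℝ) ^ τ i / (k : ℝ) ^ h := by
    intro m h
    obtain ⟨i, hi⟩ := pow_unbounded_of_one_lt ((m : ℝ) * (k : ℝ) ^ h) hk1
    refine ⟨i, ?_⟩
    rw [le_div_iff₀ (by positivity)]
    exact hi.le.trans (pow_le_pow_right₀ hk1.le (hτ i))
  refine ⟨⟨1 / (k : ℝ) ^ 20, by positivity, fun m hm => ?_⟩,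
    ⟨1 / (k : ℝ) ^ 23, by positivity, fun m hm => ?_⟩⟩
  · obtain ⟨i, hi⟩ := hbig m 4
    refine le_mul_nint (by exact_mod_cast hm) fun a => ?_
    exact (homCell_zero_iff.mp (hp i).1.1) x.1 (hp i).2.1 m hm hi a
  · obtain ⟨i, hi⟩ := hbig m 22
    refine le_mul_nint (by exact_mod_cast hm) fun a => ?_
    exact (hp i).1.2 x.1 (hp i).2.1 x.2 (hp i).2.2 m hm hi a

theorem exists_large_subset {ε α γ : ℝ} (hε : 0 < ε) (hα : Irrational α) {v : ℕ} (hv : 3 ≤ v) :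
    ∃ G : Set (ℝ × ℝ), G ⊆ calB ∧ ((2 - 5 / v : ℝ).toNNReal : ℝ≥0∞) ≤ dimH G ∧
      ∀ p ∈ G, Set.Infinite {n : ℕ | 0 < n ∧
        (n : ℝ) * nint (n * α - γ) * nint (n * p.1 - p.2) <
          Real.log (Real.log n) ^ ((3 : ℝ) + ε) / Real.log n} := by
  obtain ⟨k, hk, hkv⟩ : ∃ k : ℕ, 2 ^ 200 ≤ k ∧ 8 ^ v ≤ k :=
    ⟨max (2 ^ 200) (8 ^ v), le_max_left _ _, le_max_right _ _⟩
  have hk12 : 12 ≤ k := le_trans (by norm_num) hk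
  have hM : k ^ 3 ≤ 8 * ((k ^ 2 - 4) * (k - 6)) := by
    have h1 : k ^ 2 ≤ 2 * (k ^ 2 - 4) := by
      have : 12 * 12 ≤ k ^ 2 := by nlinarith
      omega
    have h2 : k ≤ 2 * (k - 6) := by omega
    calc k ^ 3 = k ^ 2 * k := by ring
      _ ≤ (2 * (k ^ 2 - 4)) * (2 * (k - 6)) := Nat.mul_le_mul h1 h2
      _ ≤ _ := by nlinarith [Nat.zero_le ((k ^ 2 - 4) * (k - 6))]
  obtain ⟨τ, W, win, hτ0, hW0, hord, hwin, hW, hinf⟩ :=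
    exists_schedule (fun v T => exists_isWindow (by omega : 3 ≤ k) hε hα γ v T) v
  have hwin' : ∀ i, win i → ∃ g, 1 ≤ g ∧ τ (i + 1) = τ i + g ∧ W (i + 1) = W i + g := by
    intro i hi
    obtain ⟨g, hg, h1, h2⟩ := hwin i hi
    exact ⟨7 * g, by have := hg.1; omega, h1, h2⟩
  have hτ : ∀ i, i ≤ τ i := by
    intro i
    induction i with
    | zero => omega
    | succ i ih =>
      by_cases h : win i
      · obtain ⟨g, h0, h1, -⟩ := hwin' i h
        omega
      · have := (hord i h).1
        omega
  obtain ⟨G, hG, hdim⟩ := tree_dimension hv hkv hM hτ0 hW0 hord hwin' hW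
    (Good := fun i p => GoodBox k (τ i) p ∧
      ∀ j, i = j + 1 → win j → Hit ε α γ (τ j) (box k (τ i) p)) (p₀ := (0, 0))
    ⟨by rw [hτ0]; exact goodBox_zero (by omega), fun j hj => by omega⟩ (by
      rintro i p ⟨H, -⟩
      by_cases h : win i
      · obtain ⟨g, hg, h1, -⟩ := hwin i h
        obtain ⟨p', hp', hsub, hhit⟩ := goodBox_hit hk H hg
        rw [h1]
        refine ⟨fun _ => p', fun h' => absurd h h', fun _ => ⟨⟨hp', fun j hj _ => ?_⟩, hsub⟩⟩
        obtain rfl : i = j := by omega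
        exact hhit
      · obtain ⟨c, hc, hc'⟩ := goodBox_children (by omega) H
        rw [(hord i h).1]
        refine ⟨c, fun _ => hc, fun x => ⟨⟨(hc' x).1, fun j hj hj' => ?_⟩, (hc' x).2⟩⟩
        obtain rfl : i = j := by omega
        exact absurd hj' h)
  refine ⟨G, fun x hx => ?_, hdim, fun x hx => ?_⟩
  · obtain ⟨p, hp⟩ := hG x hx
    exact mem_calB_of_goodBox (by omega) hτ fun i => ⟨(hp i).1.1, (hp i).2⟩
  · obtain ⟨p, hp⟩ := hG x hx
    refine Set.infinite_of_forall_exists_gt fun N => ?_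
    obtain ⟨j, hj, hjw⟩ := hinf (N + 1)
    obtain ⟨n, hn, hn0, hlt⟩ := (hp (j + 1)).1.2 j rfl hjw
    have := hτ j
    exact ⟨n, ⟨hn0, hlt x (hp (j + 1)).2⟩, by omega⟩

theorem littlewood_calB (ε : ℝ) (hε : 0 < ε) (α : ℝ) (hα : memK α) (γ : ℝ) :
    ∃ G : Set (ℝ × ℝ), G ⊆ calB ∧ dimH G = 2 ∧
      ∀ p ∈ G,
        Set.Infinite {n : ℕ | 0 < n ∧ (n : ℝ) * nint (n * α - γ) * nint (n * p.1 - p.2) <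
          Real.log (Real.log n) ^ ((3 : ℝ) + ε) / Real.log n} := by
  choose G hG hdim hinf using fun u : ℕ =>
    exists_large_subset (γ := γ) hε hα.1 (by omega : 3 ≤ u + 3)
  refine ⟨⋃ u, G u, iUnion_subset hG, le_antisymm ?_ ?_, fun p hp => ?_⟩
  · refine (dimH_mono (subset_univ _)).trans_eq ?_
    rw [Real.dimH_univ_eq_finrank]
    simp
  · refine le_of_tendsto' (f := fun u : ℕ => (((2 - 5 / (u + 3 : ℕ) : ℝ).toNNReal : ℝ≥0) : ℝ≥0∞))
      (x := Filter.atTop) ?_ fun u => (hdim u).trans (dimH_mono (subset_iUnion G u))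
    have h1 : Filter.Tendsto (fun u : ℕ => (2 - 5 / (u + 3 : ℕ) : ℝ)) Filter.atTop
        (nhds (2 - 0)) :=
      ((tendsto_const_div_atTop_nhds_zero_nat 5).comp
        (Filter.tendsto_add_atTop_nat 3)).const_sub 2
    have h2 := ENNReal.tendsto_ofReal h1
    simpa [ENNReal.ofReal] using h2
  · obtain ⟨u, hu⟩ := mem_iUnion.mp hp
    exact hinf u p hu
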